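/- arXiv:1902.00022 — 6 statements merged into one kernel-verified Lean document; each statement's English description precedes it below -/
import Mathlib

section
/- Let n be a positive multiple of 3 and r = n/3, and let f : F_2^n → F_2^2 be a (2n/3 − 1)-resilient (n,2)-function. Then the four preimages (f^{-1}(00), f^{-1}(01), f^{-1}(10), f^{-1}(11)) form an equitable partition of the hypercube graph Q_n with quotient matrix [[0,r,r,r],[r,0,r,r],[r,r,0,r],[r,r,r,0]]. -/
/-- Binary words of length `n`: the vertex set of the hypercube `Q_n`. -/
abbrev BW (n : ℕ) := Fin n → ZMod 2

/-- Adjacency in a Hamming-type graph (hypercube `Q_n`, Hamming graph `H(r,q)`, ...):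
two words are adjacent iff they differ in exactly one coordinate. -/
def hAdj {ι : Type*} {β : ι → Type*} [Fintype ι] [∀ i, DecidableEq (β i)]
    (x y : ∀ i, β i) : Prop :=
  hammingDist x y = 1

/-- `(Cs i)_{i < k}` is an equitable partition of the graph with vertex set `V` and
adjacency relation `adj`, with quotient matrix `S`: the cells are nonempty, every vertex
lies in exactly one cell, and every vertex of `Cs i` has exactly `S i j` neighbors in `Cs j`. -/
def IsEquitablePartition {V : Type*} (adj : V → V → Prop) {k : ℕ}
    (Cs : Fin k → Set V) (S : Fin k → Fin k → ℕ) : Prop :=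
  (∀ i, (Cs i).Nonempty) ∧
  (∀ v : V, ∃! i, v ∈ Cs i) ∧
  ∀ i j : Fin k, ∀ v ∈ Cs i, {w | w ∈ Cs j ∧ adj v w}.ncard = S i j

/-- `f` is correlation immune of order `t`: for every subcube obtained by fixing the
coordinates in a set `K` with `|K| ≤ t` (i.e. an `l`-subcube with `l = n - |K| ≥ n - t`)
and every value `y`, `|f⁻¹(y) ∩ Q'| = |f⁻¹(y)| / 2^{|K|}`. -/
def CorrImmune {n m : ℕ} (f : BW n → BW m) (t : ℕ) : Prop :=
  ∀ K : Finset (Fin n), K.card ≤ t → ∀ a : BW n, ∀ y : BW m,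
    2 ^ K.card * {x | f x = y ∧ ∀ i ∈ K, x i = a i}.ncard = {x | f x = y}.ncard

/-- `f` is a `t`-resilient `(n,m)`-function: balanced and correlation immune of order `t`. -/
def Resilient {n m : ℕ} (f : BW n → BW m) (t : ℕ) : Prop :=
  (∀ y : BW m, {x | f x = y}.ncard = 2 ^ (n - m)) ∧ CorrImmune f t

/-- The 2-bit binary representation of `i ∈ {0,1,2,3}`. -/
def bits2 : Fin 4 → BW 2 := ![![0,0], ![0,1], ![1,0], ![1,1]]

/-- The sign character of `ZMod 2`. -/
noncomputable def sgn (a : ZMod 2) : ℝ := if a = 0 then 1 else -1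

lemma zmod2_cases (a : ZMod 2) : a = 0 ∨ a = 1 := by
  revert a; decide

lemma sgn_add_one (a : ZMod 2) : sgn (a + 1) = - sgn a := by
  rcases zmod2_cases a with rfl | rfl
  · simp [sgn]
  · have : (1 + 1 : ZMod 2) = 0 := by decide
    simp [sgn, this]

lemma one_add_sgn (a b : ZMod 2) : 1 + sgn a * sgn b = if a = b then 2 else 0 := by
  rcases zmod2_cases a with rfl | rfl <;> rcases zmod2_cases b with rfl | rfl <;>
    norm_num [sgn]

/-- Characters of the cube. -/
noncomputable def psi {n : ℕ} (u : Finset (Fin n)) (x : BW n) : ℝ := ∏ i ∈ u, sgn (x i)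

/-- Fourier transform. -/
noncomputable def ft {n : ℕ} (g : BW n → ℝ) (u : Finset (Fin n)) : ℝ := ∑ x, g x * psi u x

lemma psi_ne_zero {n : ℕ} (u : Finset (Fin n)) (x : BW n) : psi u x ≠ 0 := by
  unfold psi
  refine Finset.prod_ne_zero_iff.mpr fun i _ => ?_
  unfold sgn; split_ifs <;> norm_num

lemma sum_psi_powerset {n : ℕ} (K : Finset (Fin n)) (x y : BW n) :
    ∑ u ∈ K.powerset, psi u x * psi u y = if ∀ i ∈ K, x i = y i then (2:ℝ) ^ K.card else 0 := by
  have h1 : ∑ u ∈ K.powerset, psi u x * psi u y = ∏ i ∈ K, (1 + sgn (x i) * sgn (y i)) := by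
    rw [Finset.prod_one_add]
    refine Finset.sum_congr rfl fun u _ => ?_
    simp [psi, Finset.prod_mul_distrib]
  rw [h1]
  simp_rw [one_add_sgn]
  split_ifs with h
  · rw [Finset.prod_congr rfl (fun i hi => if_pos (h i hi))]
    simp
  · push Not at h
    obtain ⟨i, hi, hne⟩ := h
    exact Finset.prod_eq_zero hi (if_neg hne)

lemma sum_psi {n : ℕ} (x y : BW n) :
    ∑ u, psi u x * psi u y = if x = y then (2:ℝ) ^ n else 0 := by
  have := sum_psi_powerset Finset.univ x y
  simpa [← funext_iff] using this

lemma parseval {n : ℕ} (g h : BW n → ℝ) :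
    ∑ u, ft g u * ft h u = 2 ^ n * ∑ x, g x * h x := by
  have h1 : ∀ u, ft g u * ft h u = ∑ x, ∑ y, g x * h y * (psi u x * psi u y) := by
    intro u
    unfold ft
    rw [Finset.sum_mul_sum]
    refine Finset.sum_congr rfl fun x _ => Finset.sum_congr rfl fun y _ => by ring
  simp_rw [h1]
  rw [Finset.sum_comm, Finset.mul_sum]
  refine Finset.sum_congr rfl fun x _ => ?_
  rw [Finset.sum_comm]
  simp_rw [← Finset.mul_sum, sum_psi]
  simp
  ring

/-- Flipping a coordinate. -/
def flipc {n : ℕ} (i : Fin n) (x : BW n) : BW n := x + Pi.single i 1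

lemma flipc_flipc {n : ℕ} (i : Fin n) (x : BW n) : flipc i (flipc i x) = x := by
  have h : (1 + 1 : ZMod 2) = 0 := by decide
  unfold flipc
  rw [add_assoc, ← Pi.single_add, h]; simp

lemma psi_flip {n : ℕ} (u : Finset (Fin n)) (i : Fin n) (x : BW n) :
    psi u (flipc i x) = (if i ∈ u then -1 else 1) * psi u x := by
  unfold psi
  split_ifs with hi
  · rw [← Finset.mul_prod_erase u _ hi, ← Finset.mul_prod_erase u (fun j => sgn (x j)) hi]
    have : ∏ j ∈ u.erase i, sgn (flipc i x j) = ∏ j ∈ u.erase i, sgn (x j) := by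
      refine Finset.prod_congr rfl fun j hj => ?_
      simp [flipc, Finset.ne_of_mem_erase hj]
    rw [this]
    simp [flipc, sgn_add_one]
  · rw [one_mul]
    refine Finset.prod_congr rfl fun j hj => ?_
    have : j ≠ i := fun h => hi (h ▸ hj)
    simp [flipc, this]

/-- Adjacency operator. -/
noncomputable def adjOp {n : ℕ} (g : BW n → ℝ) (x : BW n) : ℝ := ∑ i, g (flipc i x)

lemma ft_adj {n : ℕ} (g : BW n → ℝ) (u : Finset (Fin n)) :
    ft (adjOp g) u = (n - 2 * u.card) * ft g u := by
  have h1 : ∀ i, ∑ x, g (flipc i x) * psi u x = (if i ∈ u then -1 else 1) * ft g u := by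
    intro i
    let e : BW n ≃ BW n := ⟨flipc i, flipc i, flipc_flipc i, flipc_flipc i⟩
    rw [← Equiv.sum_comp e]
    unfold ft
    rw [Finset.mul_sum]
    refine Finset.sum_congr rfl fun x _ => ?_
    change g (flipc i (flipc i x)) * psi u (flipc i x) = _
    rw [flipc_flipc, psi_flip]; ring
  have h2 : ∑ i : Fin n, (if i ∈ u then (-1:ℝ) else 1) = n - 2 * u.card := by
    have : ∀ i : Fin n, (if i ∈ u then (-1:ℝ) else 1) = 1 - 2 * (if i ∈ u then 1 else 0) := by
      intro i; split_ifs <;> norm_num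
    simp_rw [this, Finset.sum_sub_distrib, ← Finset.mul_sum]
    simp
  rw [← h2, Finset.sum_mul]
  simp_rw [← h1]
  unfold ft adjOp
  simp_rw [Finset.sum_mul]
  rw [Finset.sum_comm]

/-- Indicator of a fibre. -/
noncomputable def ind {n : ℕ} (f : BW n → BW 2) (y : BW 2) (x : BW n) : ℝ :=
  if f x = y then 1 else 0

lemma ft_empty {n : ℕ} (g : BW n → ℝ) : ft g ∅ = ∑ x, g x := by
  simp [ft, psi]

lemma sum_ind {n : ℕ} (f : BW n → BW 2) (y : BW 2) :
    ∑ x, ind f y x = ({x | f x = y}.ncard : ℝ) := by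
  rw [Set.ncard_eq_toFinset_card']
  simp [ind]

lemma ft_ci {n t : ℕ} (f : BW n → BW 2) (h : CorrImmune f t) (y : BW 2)
    (K : Finset (Fin n)) : K.Nonempty → K.card ≤ t → ft (ind f y) K = 0 := by
  induction K using Finset.strongInduction with
  | H K ih =>
    intro hne hK
    have h0 := h K hK 0 y
    have h1 : ∑ u ∈ K.powerset, ft (ind f y) u * psi u 0
        = 2 ^ K.card * ({x | f x = y ∧ ∀ i ∈ K, x i = (0 : BW n) i}.ncard : ℝ) := by
      unfold ft
      simp_rw [Finset.sum_mul]
      rw [Finset.sum_comm]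
      simp_rw [mul_assoc, ← Finset.mul_sum, sum_psi_powerset]
      rw [Set.ncard_eq_toFinset_card', Set.toFinset_setOf, Finset.card_filter, Nat.cast_sum,
        Finset.mul_sum]
      refine Finset.sum_congr rfl fun x _ => ?_
      unfold ind
      by_cases ha : f x = y <;> by_cases hb : ∀ i ∈ K, x i = (0 : BW n) i <;>
        simp [ha, hb]
    have h2 : ∑ u ∈ K.powerset, ft (ind f y) u * psi u 0
        = ft (ind f y) ∅ + ft (ind f y) K * psi K 0 := by
      rw [← Finset.sum_subset (s₁ := {∅, K})]
      · rw [Finset.sum_pair hne.ne_empty.symm]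
        simp [psi]
      · intro u hu
        simp at hu
        rcases hu with rfl | rfl <;> simp
      · intro u hu hu'
        simp at hu hu'
        rw [ih u (Finset.ssubset_iff_subset_ne.mpr ⟨hu, hu'.2⟩)
          (Finset.nonempty_iff_ne_empty.mpr hu'.1) ((Finset.card_le_card hu).trans hK), zero_mul]
    have h3 : ft (ind f y) ∅ = 2 ^ K.card *
        ({x | f x = y ∧ ∀ i ∈ K, x i = (0 : BW n) i}.ncard : ℝ) := by
      rw [ft_empty, sum_ind, ← h0]; push_cast; rfl
    have h4 : ft (ind f y) K * psi K 0 = 0 := by linarith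
    exact (mul_eq_zero.mp h4).resolve_right (psi_ne_zero _ _)

lemma adj_ind (n r : ℕ) (hr : 0 < r) (hn : n = 3 * r)
    (f : BW n → BW 2) (hf : Resilient f (2 * r - 1)) (y : BW 2) (x : BW n) :
    adjOp (ind f y) x = r - r * ind f y x := by
  set c := ind f y with hc
  let h : BW n → ℝ := fun x => adjOp c x + r * c x - r
  have hsum : 4 * ∑ x, c x = 2 ^ n := by
    rw [hc, sum_ind, hf.1 y]
    have : n = (n - 2) + 2 := by omega
    conv_rhs => rw [this, pow_add]
    push_cast; ring
  have hnr : (n : ℝ) = 3 * r := by rw [hn]; push_cast; ring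
  have hone : ∀ u : Finset (Fin n), u.Nonempty → ∑ x : BW n, psi u x = 0 := by
    intro u hu
    obtain ⟨i, hi⟩ := hu
    let e : BW n ≃ BW n := ⟨flipc i, flipc i, flipc_flipc i, flipc_flipc i⟩
    have h1 := Equiv.sum_comp e (psi u)
    have h2 : ∀ x, psi u (e x) = - psi u x := by
      intro x
      change psi u (flipc i x) = _
      rw [psi_flip, if_pos hi]; ring
    simp_rw [h2, Finset.sum_neg_distrib] at h1
    linarith
  have hft : ∀ u, ft h u = (4 * r - 2 * u.card) * ft c u - r * ∑ x : BW n, psi u x := by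
    intro u
    have : ft h u = ft (adjOp c) u + r * ft c u - r * ∑ x : BW n, psi u x := by
      simp only [ft, h, Finset.mul_sum, ← Finset.sum_add_distrib, ← Finset.sum_sub_distrib]
      refine Finset.sum_congr rfl fun x _ => by ring
    rw [this, ft_adj, hnr]; ring
  have hft0 : ft h ∅ = 0 := by
    rw [hft, ft_empty]
    simp [psi]
    linear_combination (r:ℝ) * hsum
  have hft1 : ∀ u, u.Nonempty → ft h u = (4 * r - 2 * u.card) * ft c u := by
    intro u hu
    rw [hft, hone u hu]; ring
  have hle : ∀ u ∈ Finset.univ, ft c u * ft h u ≤ 0 := by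
    intro u _
    rcases u.eq_empty_or_nonempty with rfl | hu
    · simp [hft0]
    · by_cases hcard : u.card ≤ 2 * r - 1
      · rw [hc, ft_ci f hf.2 y u hu hcard]; simp
      · rw [hft1 u hu]
        have : (2 * r : ℝ) ≤ u.card := by
          have : 2 * r ≤ u.card := by omega
          exact_mod_cast this
        nlinarith [sq_nonneg (ft c u)]
  have hge : 0 ≤ ∑ x, c x * h x := by
    refine Finset.sum_nonneg fun x _ => ?_
    have h1 : 0 ≤ adjOp c x := Finset.sum_nonneg fun i _ => by
      rw [hc]; unfold ind; split_ifs <;> norm_num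
    by_cases hx : f x = y
    · have : c x = 1 := by simp [hc, ind, hx]
      simp [h, this, h1]
    · have : c x = 0 := by simp [hc, ind, hx]
      simp [this]
  have hzero : ∀ u ∈ Finset.univ, ft c u * ft h u = 0 := by
    have hs : ∑ u, ft c u * ft h u = 0 := by
      apply le_antisymm (Finset.sum_nonpos hle)
      rw [parseval]; positivity
    exact (Finset.sum_eq_zero_iff_of_nonpos hle).mp hs
  have hz : ∀ u, ft h u = 0 := by
    intro u
    rcases u.eq_empty_or_nonempty with rfl | hu
    · exact hft0
    · rcases mul_eq_zero.mp (hzero u (Finset.mem_univ u)) with h1 | h1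
      · rw [hft1 u hu, h1, mul_zero]
      · exact h1
  have hp := parseval h h
  simp only [hz, mul_zero, Finset.sum_const_zero] at hp
  have hq : ∑ x, h x * h x = 0 := by
    have : (2:ℝ) ^ n ≠ 0 := by positivity
    exact (mul_eq_zero.mp hp.symm).resolve_left this
  have hx := (Finset.sum_eq_zero_iff_of_nonneg (fun x _ => mul_self_nonneg (h x))).mp hq x
    (Finset.mem_univ x)
  have hx' : adjOp c x + r * c x - r = 0 := mul_self_eq_zero.mp hx
  linarith

lemma adj_iff {n : ℕ} (v w : BW n) : hAdj v w ↔ ∃ i, flipc i v = w := by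
  unfold hAdj hammingDist
  constructor
  · intro h
    obtain ⟨i, hi⟩ := Finset.card_eq_one.mp h
    refine ⟨i, funext fun j => ?_⟩
    have hj := Finset.ext_iff.mp hi j
    simp at hj
    by_cases hji : j = i
    · subst hji
      have : v j ≠ w j := hj.mpr rfl
      simp [flipc]
      clear hj
      generalize v j = a at *
      generalize w j = b at *
      revert a b; decide
    · have : v j = w j := by
        by_contra hne; exact hji (hj.mp hne)
      simp [flipc, hji, this]
  · rintro ⟨i, rfl⟩
    rw [Finset.card_eq_one]
    refine ⟨i, ?_⟩
    ext j
    by_cases hji : j = i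
    · subst hji; simp [flipc]
    · simp [flipc, hji]

lemma ncard_adj {n : ℕ} (f : BW n → BW 2) (y : BW 2) (v : BW n) :
    ({w | f w = y ∧ hAdj v w}.ncard : ℝ) = adjOp (ind f y) v := by
  have h1 : {w | f w = y ∧ hAdj v w} = (fun i => flipc i v) '' {i | f (flipc i v) = y} := by
    ext w
    simp only [Set.mem_setOf_eq, Set.mem_image, adj_iff]
    constructor
    · rintro ⟨h, i, rfl⟩; exact ⟨i, h, rfl⟩
    · rintro ⟨i, h, rfl⟩; exact ⟨h, i, rfl⟩
  have hinj : Function.Injective (fun i => flipc i v) := by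
    intro i j hij
    have h2 : flipc i v i = flipc j v i := congrFun hij i
    by_contra hne
    simp [flipc, hne] at h2
  rw [h1, Set.ncard_image_of_injective _ hinj, Set.ncard_eq_toFinset_card']
  simp [adjOp, ind]

lemma bits2_unique (y : BW 2) : ∃! i, y = bits2 i := by
  have h : ∀ y : BW 2, ∃ i, y = bits2 i ∧ ∀ j, y = bits2 j → j = i := by
    unfold bits2; decide
  exact h y

theorem stmt_0 (n r : ℕ) (hr : 0 < r) (hn : n = 3 * r)
    (f : BW n → BW 2) (hf : Resilient f (2 * r - 1)) :
    IsEquitablePartition hAdj (fun i : Fin 4 => {x | f x = bits2 i})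
      (fun i j => if i = j then 0 else r) := by
  refine ⟨fun i => ?_, fun v => bits2_unique (f v), fun i j v hv => ?_⟩
  · apply Set.nonempty_of_ncard_ne_zero
    change {x | f x = bits2 i}.ncard ≠ 0
    rw [hf.1]; positivity
  · have h1 := ncard_adj f (bits2 j) v
    rw [adj_ind n r hr hn f hf] at h1
    have hv' : f v = bits2 i := hv
    change {w | f w = bits2 j ∧ hAdj v w}.ncard = if i = j then 0 else r
    split_ifs with hij
    · subst hij
      simp only [ind, hv', if_true] at h1
      have : ({w | f w = bits2 i ∧ hAdj v w}.ncard : ℝ) = 0 := by rw [h1]; ring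
      exact_mod_cast this
    · have hne : f v ≠ bits2 j := fun h => hij ((bits2_unique (f v)).unique hv' h)
      simp only [ind, hne, if_false] at h1
      have : ({w | f w = bits2 j ∧ hAdj v w}.ncard : ℝ) = r := by rw [h1]; ring
      exact_mod_cast this
end

section
/- There are exactly 10 equivalence classes of 5-resilient (9,2)-functions, where two functions f, g : F_2^9 → F_2^2 are equivalent if f(x) = β(g(α(x))) for all x, for some graph automorphism α of Q_9 and some permutation β of F_2^2. Moreover, among these 10 classes, exactly one consists of functions whose graph G(f) = {(x, f(x)) : x ∈ F_2^9} ⊆ F_2^{11} has affine rank 9 (the linear class), and exactly one consists of functions whose graph has affine rank 11 (the full-rank class). -/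
/-- The affine rank of a subset of `F_2^N`: the dimension of its affine span. -/
noncomputable def affRank {N : ℕ} (s : Set (BW N)) : ℕ :=
  Module.finrank (ZMod 2) (affineSpan (ZMod 2) s).direction

/-- `α` is an automorphism (isometry) of the hypercube `Q_n`. -/
def IsCubeAut {n : ℕ} (α : BW n ≃ BW n) : Prop :=
  ∀ x y : BW n, hAdj (α x) (α y) ↔ hAdj x y

/-- The graph `G(f) = {(x, f(x))} ⊆ F_2^{n+m}` of an `(n,m)`-function. -/
def graphOf {n m : ℕ} (f : BW n → BW m) : Set (BW (n + m)) :=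
  {z | ∃ x : BW n, z = Fin.append x (f x)}

/-- Equivalence of `(9,2)`-functions: `f x = β (g (α x))` for some automorphism `α` of `Q_9`
and some permutation `β` of `F_2^2`. -/
def EquivFn (f g : BW 9 → BW 2) : Prop :=
  ∃ (α : BW 9 ≃ BW 9) (β : BW 2 ≃ BW 2), IsCubeAut α ∧ ∀ x, f x = β (g (α x))

namespace Res9

/-- Evaluate `n` before passing it on (helps kernel reduction). -/
def force {A : Type} (n : ℕ) (k : ℕ → A) : A :=
  Nat.rec (k 0) (fun m _ => k (Nat.succ m)) n

theorem force_eq {A : Type} (n : ℕ) (k : ℕ → A) : force n k = k n := by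
  cases n <;> rfl

/-- Mask of all words `x < 512` whose `i`-th bit is zero. -/
def lowMask (i : ℕ) : ℕ := Nat.div (2 ^ 512 - 1) (Nat.add (Nat.pow 2 (Nat.pow 2 i)) 1)

/-- Translate a mask by the `i`-th unit vector, `s = 2 ^ i`, `l = lowMask i`. -/
def sh (m s l : ℕ) : ℕ :=
  Nat.lor (Nat.land (Nat.shiftRight m s) l) (Nat.shiftLeft (Nat.land m l) s)

def andn (a b : ℕ) : ℕ := Nat.xor a (Nat.land a b)

/-- The list of pairs `(2 ^ i, lowMask i)` for `i < n`, in decreasing order. -/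
def dirs : ℕ → List (ℕ × ℕ)
  | 0 => []
  | n + 1 => force (2 ^ n) fun s => force (lowMask n) fun l => (s, l) :: dirs n

/-- Saturating counters: `a1`, `a2`, `a3` are the masks of points with at least one, two,
three neighbours in `d` in the directions of the list. -/
def count3 {A : Type} (d : ℕ) : List (ℕ × ℕ) → (ℕ → ℕ → ℕ → A) → A
  | [], k => k 0 0 0
  | p :: r, k => count3 d r fun a1 a2 a3 =>
      force (sh d p.1 p.2) fun z =>
      force (Nat.lor a3 (Nat.land a2 z)) fun b3 =>
      force (Nat.lor a2 (Nat.land a1 z)) fun b2 =>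
      force (Nat.lor a1 z) fun b1 => k b1 b2 b3

def spread {A : Type} (a : ℕ) : List (ℕ × ℕ) → (ℕ → A) → A
  | [], k => k 0
  | p :: r, k => spread a r fun z => force (Nat.lor z (sh a p.1 p.2)) k

/-- Propagation for one colour: `m` is the mask of the colour, `x y z` are those of the others. -/
def pass1 {A : Type} (ds : List (ℕ × ℕ)) (m x y z : ℕ) (k : ℕ → A) : A :=
  force (andn m (Nat.lor x (Nat.lor y z))) fun d =>
  count3 d ds fun a1 _ a3 =>
  spread a3 ds fun w =>
  force (andn (andn m a1) (andn w d)) k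

def pass {A : Type} (ds : List (ℕ × ℕ)) (m0 m1 m2 m3 : ℕ) (k : ℕ → ℕ → ℕ → ℕ → A) : A :=
  pass1 ds m0 m1 m2 m3 fun n0 =>
  pass1 ds m1 m0 m2 m3 fun n1 =>
  pass1 ds m2 m0 m1 m3 fun n2 =>
  pass1 ds m3 m0 m1 m2 fun n3 => k n0 n1 n2 n3

def passN {A : Type} (ds : List (ℕ × ℕ)) :
    ℕ → ℕ → ℕ → ℕ → ℕ → (ℕ → ℕ → ℕ → ℕ → A) → A
  | 0, m0, m1, m2, m3, k => k m0 m1 m2 m3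
  | n + 1, m0, m1, m2, m3, k =>
      pass ds m0 m1 m2 m3 fun a b c d => passN ds n a b c d k

/-- The colour of `x` if it is determined, and `4` otherwise. -/
def val (m0 m1 m2 m3 x : ℕ) : ℕ :=
  cond (m0.testBit x)
    (cond (m1.testBit x || m2.testBit x || m3.testBit x) 4 0)
    (cond (m1.testBit x) (cond (m2.testBit x || m3.testBit x) 4 1)
      (cond (m2.testBit x) (cond (m3.testBit x) 4 2) (cond (m3.testBit x) 3 4)))

/-- The image of `x` under the automorphism given by the list `p` and the translation `t`. -/
def alpha : List ℕ → ℕ → ℕ → ℕ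
  | [], _, t => t
  | q :: p, x, t =>
      alpha p (Nat.div x 2) (Nat.xor t (Nat.shiftLeft (Nat.mod x 2) q))

def lkp : List ℕ → ℕ → ℕ
  | [], _ => 4
  | a :: l, n => Nat.rec a (fun m _ => lkp l m) n

/-- `f ∘ α` coincides with `f` on the given list. -/
def sameOn (m0 m1 m2 m3 t : ℕ) (p b : List ℕ) : List ℕ → Bool
  | [] => true
  | x :: r =>
      force (val m0 m1 m2 m3 x) fun u =>
      force (val m0 m1 m2 m3 (alpha p x t)) fun v =>
      Nat.blt u 4 && Nat.blt v 4 && Nat.beq (lkp b v) u && sameOn m0 m1 m2 m3 t p b r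

/-- `f ∘ α` is lexicographically smaller than `f`. -/
def lexLt (m0 m1 m2 m3 t : ℕ) (p b : List ℕ) : List ℕ → Bool
  | [] => false
  | x :: r =>
      force (val m0 m1 m2 m3 x) fun u =>
      force (val m0 m1 m2 m3 (alpha p x t)) fun v =>
      Nat.blt u 4 && Nat.blt v 4 &&
        (Nat.blt (lkp b v) u || (Nat.beq (lkp b v) u && lexLt m0 m1 m2 m3 t p b r))

def isPerm (n : ℕ) (p : List ℕ) : Bool :=
  Nat.beq p.length n && (p.all fun q => Nat.blt q n) &&
    (List.range n).all fun j => (List.range n).any fun i => Nat.beq (lkp p i) j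

/-- Certificates for the search. -/
inductive T
  | P (n : ℕ) (t : T)
  | X (v : ℕ) (a b c d : T)
  | D (v : ℕ)
  | S (t : ℕ) (p b : List ℕ)
  | L (k : ℕ)

/-- The points on which functions are normalized. -/
def normL : List ℕ := [0, 1, 2, 4, 8, 16, 32, 64, 128, 256]

/-- The points used for the lexicographic order. -/
def keyL : List ℕ := [9, 10, 12, 17, 18, 20, 33, 34, 36, 65, 66, 68, 72, 80, 96, 129, 130, 132, 136, 144, 160, 257, 258, 260, 264, 272, 288, 3, 5, 6, 24, 40, 48, 192, 320, 384, 7, 11, 13]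

/-- The two bit planes of the representatives. -/
def plane : List (ℕ × ℕ) := [
   (0x7f0820fd40fbef0180f7df02bf0410fe80f7df02bf0410fe7f0820fd40fbef0180f7df02bf0410fe7f0820fd40fbef017f0820fd40fbef0180f7df02bf0410fe,
    0x169eb694d6928697e961496b296d7968e961496b296d7968169eb694d6928697e961496b296d7968169eb694d6928697169eb694d6928697e961496b296d7968),
   (0x7e1824bd42dbe78181e7db42bd24187e81e7db42bd24187e7e1824bd42dbe78181e7db42bd24187e7e1824bd42dbe7817e1824bd42dbe78181e7db42bd24187e,
    0x178eb2d4d4b28e17e8714d2b2b4d71e8e8714d2b2b4d71e8178eb2d4d4b28e17e8714d2b2b4d71e8178eb2d4d4b28e17178eb2d4d4b28e17e8714d2b2b4d71e8),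
   (0x7e1822dd44bbe78181e7dd22bb44187e81e7dd22bb44187e7e1822dd44bbe78181e7dd22bb44187e7e1822dd44bbe7817e1822dd44bbe78181e7dd22bb44187e,
    0x178eb4b4d2d28e17e8714b4b2d2d71e8e8714b4b2d2d71e8178eb4b4d2d28e17e8714b4b2d2d71e8178eb4b4d2d28e17178eb4b4d2d28e17e8714b4b2d2d71e8),
   (0x7e0c22f550bbcf8181f3dd0aaf44307e81f3dd0aaf44307e7e0c22f550bbcf8181f3dd0aaf44307e7e0c22f550bbcf817e0c22f550bbcf8181f3dd0aaf44307e,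
    0x179ab49cc6d2a617e8654b63392d59e8e8654b63392d59e8179ab49cc6d2a617e8654b63392d59e8179ab49cc6d2a617179ab49cc6d2a617e8654b63392d59e8),
   (0x7d0928f960eb6f4182f6d7069f1490be82f6d7069f1490be7d0928f960eb6f4182f6d7069f1490be7d0928f960eb6f417d0928f960eb6f4182f6d7069f1490be,
    0x149fbe90f68206d7eb60416f097df928eb60416f097df928149fbe90f68206d7eb60416f097df928149fbe90f68206d7149fbe90f68206d7eb60416f097df928),
   (0x7c0b2cf170cb2fc183f4d30e8f34d03e83f4d30e8f34d03e7c0b2cf170cb2fc183f4d30e8f34d03e7c0b2cf170cb2fc17c0b2cf170cb2fc183f4d30e8f34d03e,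
    0x159dba98e6a24657ea624567195db9a8ea624567195db9a8159dba98e6a24657ea624567195db9a8159dba98e6a24657159dba98e6a24657ea624567195db9a8),
   (0x6e1961e961e96e1994b69b469b4694b692d69d269d2692d6678968796879678991e69e169e1691e66b4964b964b96b496d2962d962d96d299876978697869876,
    0x169ee691e691169eb964496b496bb964d962296d296dd9628697769876988697e961196e196ee961469bb694b694469b269dd692d692269d7968896789677968),
   (0x6f0960f960f96f0990f69f069f0690f690f69f069f0690f66f0960f960f96f0990f69f069f0690f66f0960f960f96f096f0960f960f96f0990f69f069f0690f6,
    0x69ff690f690069ff960096f096ff960f960096f096ff960069ff690f690069ff960096f096ff960069ff690f690069f069ff690f690069ff960096f096ff960),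
   (0x782d4be1782d4be187d2b41e87d2b41e87d2b41e87d2b41e782d4be1782d4be187d2b41e87d2b41e782d4be1782d4be1782d4be1782d4be187d2b41e87d2b41e,
    0x11bbdd88ee442277ee44227711bbdd88ee44227711bbdd8811bbdd88ee442277ee44227711bbdd8811bbdd88ee44227711bbdd88ee442277ee44227711bbdd88),
   (0x69696969696969699696969696969696969696969696969669696969696969699696969696969696696969696969696969696969696969699696969696969696,
    0xffff00ff0000ffff0000ff00ffff00ff0000ff00ffff0000ffff00ff0000ffff0000ff00ffff0000ffff00ff0000ff00ffff00ff0000ffff0000ff00ffff00)]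

def lkp2 : List (ℕ × ℕ) → ℕ → ℕ × ℕ
  | [], _ => (0, 0)
  | a :: l, n => Nat.rec a (fun m _ => lkp2 l m) n

def leafOk (m0 m1 m2 m3 : ℕ) (p : ℕ × ℕ) : Bool :=
  Nat.beq (Nat.lor m1 m3) p.1 && Nat.beq (Nat.lor m2 m3) p.2 &&
    Nat.beq (Nat.land (Nat.lor m0 m2) p.1) 0 && Nat.beq (Nat.land (Nat.lor m0 m1) p.2) 0

def clr (m v : ℕ) : ℕ := andn m (Nat.shiftLeft 1 v)

def check (ds : List (ℕ × ℕ)) : T → ℕ → ℕ → ℕ → ℕ → Bool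
  | .P n t, m0, m1, m2, m3 => passN ds n m0 m1 m2 m3 (check ds t)
  | .X v a b c d, m0, m1, m2, m3 =>
      Nat.blt v 512 &&
      (force (clr m0 v) fun n0 => force (clr m1 v) fun n1 =>
      force (clr m2 v) fun n2 => force (clr m3 v) fun n3 =>
        check ds a m0 n1 n2 n3 && check ds b n0 m1 n2 n3 &&
        check ds c n0 n1 m2 n3 && check ds d n0 n1 n2 m3)
  | .D v, m0, m1, m2, m3 =>
      Nat.blt v 512 && !(m0.testBit v || m1.testBit v || m2.testBit v || m3.testBit v)
  | .S t p b, m0, m1, m2, m3 =>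
      isPerm 9 p && isPerm 4 b && Nat.blt t 512 && sameOn m0 m1 m2 m3 t p b normL &&
        lexLt m0 m1 m2 m3 t p b keyL
  | .L k, m0, m1, m2, m3 => Nat.blt k 10 && leafOk m0 m1 m2 m3 (lkp2 plane k)

def allMask : ℕ := 2 ^ 512 - 1

/-- Restrict the masks so that `v` gets the colour `c`. -/
def start : T → Bool := fun t =>
  force (dirs 9 |>.length) fun _ =>
  check (dirs 9) t (allMask - 115792089237316195423570985008687907853610267032561502502939405359422902436118) (allMask - 115792089237316195423570985008687907853610267032561502502939405359422902436097) (allMask - 115792089237316195423570985008687907853610267032561502502939405359418607403031) (allMask - 4295033111)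

def tree : T :=
  .P 1 (.X 9 
  (.P 1 (.X 10 
   (.P 3 (.X 17 
    (.P 3 (.X 18  (.P 2 (.D 6)) (.D 18) (.D 18)
     (.P 1 (.X 20 
      (.P 10 (.X 7  (.D 7) (.P 7 (.L 0))
       (.P 5 (.X 11  (.D 11)
        (.P 6 (.X 13  (.D 13)
         (.P 6 (.S 4 [2,4,5,1,0,3,6,7,8] [1,0,3,2]))
         (.P 5 (.X 14  (.D 14)
          (.P 6 (.S 4 [2,4,5,0,1,3,6,7,8] [1,0,3,2]))
          (.P 5 (.X 21  (.D 21) (.P 6 (.L 1)) (.P 6 (.L 2)) (.D 21))) (.D 14))) (.D 13)))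
        (.P 5 (.X 13  (.D 13)
         (.P 5 (.X 14  (.D 14)
          (.P 6 (.S 7 [4,5,3,0,1,2,6,7,8] [1,3,0,2]))
          (.P 5 (.X 19  (.D 19)
           (.P 6 (.S 0 [1,2,0,5,3,4,6,7,8] [0,1,2,3])) (.P 6 (.L 3)) (.D 19))) (.D 14)))
         (.P 6 (.S 0 [1,0,2,3,5,4,6,7,8] [0,1,2,3])) (.D 13))) (.D 11))) (.D 7))) (.D 20) (.D 20)
      (.P 2 (.X 34  (.P 3 (.D 38)) (.D 34) (.D 34)
       (.P 1 (.X 66  (.P 4 (.D 35)) (.D 66)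
        (.P 2 (.X 68  (.P 3 (.D 39)) (.D 68)
         (.P 2 (.X 80  (.P 2 (.D 92))
          (.P 2 (.X 96  (.P 3 (.D 60))
           (.P 4 (.X 130  (.P 3 (.D 14)) (.D 130)
            (.P 2 (.X 132  (.P 3 (.D 14)) (.D 132)
             (.P 2 (.X 144 
              (.P 2 (.D 156))
              (.P 2 (.X 160  (.P 3 (.D 49))
               (.P 7 (.X 7  (.D 7) (.P 7 (.L 4))
                (.P 5 (.X 11  (.D 11)
                 (.P 7 (.S 3 [0,1,3,5,4,2,6,7,8] [3,1,2,0]))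
                 (.P 6 (.X 13  (.D 13)
                  (.P 5 (.X 14  (.D 14)
                   (.P 6 (.S 21 [1,2,3,0,4,5,6,7,8] [1,3,0,2]))
                   (.P 5 (.X 19  (.D 19)
                    (.P 6 (.S 1 [0,3,4,2,1,5,6,7,8] [1,0,3,2]))
                    (.P 6 (.S 14 [2,3,4,0,1,5,6,7,8] [1,3,0,2])) (.D 19))) (.D 14)))
                  (.P 6 (.X 19  (.D 19)
                   (.P 6 (.S 21 [1,2,3,0,4,5,6,7,8] [1,3,0,2])) (.P 6 (.L 5)) (.D 19))) (.D 13))) (.D 11))) (.D 7))) (.D 160) (.D 160))) (.D 144) (.D 144))) (.D 132))) (.D 130))) (.D 96) (.D 96))) (.D 80) (.D 80))) (.D 68))) (.D 66))))))))) (.D 17) (.D 17)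
    (.P 1 (.X 18 
     (.P 3 (.S 0 [1,0,2,3,4,5,6,7,8] [0,1,2,3])) (.D 18) (.D 18)
     (.P 2 (.X 33 
      (.P 3 (.S 0 [0,1,2,3,5,4,6,7,8] [0,1,2,3])) (.D 33) (.D 33)
      (.P 1 (.X 34 
       (.P 3 (.S 0 [1,0,2,3,5,4,6,7,8] [0,1,2,3])) (.D 34) (.D 34)
       (.P 4 (.X 65 
        (.P 7 (.X 66 
         (.P 2 (.D 192)) (.D 66)
         (.P 4 (.X 80  (.P 5 (.D 61))
          (.P 5 (.X 96  (.P 3 (.D 35))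
           (.P 5 (.X 130  (.P 9 (.L 6)) (.D 130)
            (.P 9 (.S 0 [0,1,2,3,4,5,6,8,7] [0,1,2,3])) (.D 130))) (.D 96) (.D 96))) (.D 80) (.D 80))) (.D 66))) (.D 65)
        (.P 2 (.X 66 
         (.P 8 (.S 0 [1,0,2,3,4,5,6,7,8] [0,1,2,3])) (.D 66)
         (.P 2 (.X 80 
          (.P 10 (.S 0 [4,5,3,2,0,1,6,7,8] [0,2,1,3]))
          (.P 2 (.X 96 
           (.P 10 (.S 0 [5,4,3,2,0,1,6,7,8] [0,2,1,3]))
           (.P 4 (.X 129 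
            (.P 10 (.S 0 [0,1,2,3,4,5,7,6,8] [0,1,2,3])) (.D 129)
            (.P 2 (.X 130 
             (.P 10 (.S 0 [0,1,2,3,4,5,8,6,7] [0,1,2,3])) (.D 130)
             (.P 2 (.X 144 
              (.P 10 (.S 0 [4,5,3,2,0,1,7,6,8] [0,2,1,3]))
              (.P 2 (.X 160 
               (.P 10 (.S 0 [4,5,3,2,0,1,8,6,7] [0,2,1,3]))
               (.P 8 (.X 7  (.D 7) (.P 6 (.L 7))
                (.P 6 (.X 11  (.D 11)
                 (.P 6 (.X 13  (.D 13) (.P 4 (.D 61))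
                  (.P 5 (.X 14  (.D 14) (.P 4 (.D 62))
                   (.P 5 (.X 21  (.D 21)
                    (.P 6 (.S 4 [2,4,5,0,1,3,6,7,8] [1,0,3,2]))
                    (.P 6 (.S 4 [2,4,5,1,0,3,6,7,8] [1,0,3,2])) (.D 21))) (.D 14))) (.D 13)))
                 (.P 5 (.X 13  (.D 13)
                  (.P 5 (.X 14  (.D 14) (.P 4 (.D 62))
                   (.P 5 (.X 19  (.D 19)
                    (.P 6 (.S 1 [3,0,1,2,5,4,6,7,8] [1,0,3,2]))
                    (.P 6 (.S 1 [3,0,1,2,4,5,6,7,8] [1,0,3,2])) (.D 19))) (.D 14)))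
                  (.P 6 (.S 0 [1,0,2,3,4,5,6,7,8] [0,1,2,3])) (.D 13))) (.D 11))) (.D 7))) (.D 160) (.D 160))) (.D 144) (.D 144))) (.D 130))) (.D 129))) (.D 96) (.D 96))) (.D 80) (.D 80))) (.D 66))) (.D 65))))))))))) (.D 10) (.D 10)
   (.P 1 (.X 12 
    (.P 3 (.S 0 [0,2,1,3,4,5,6,7,8] [0,1,2,3])) (.D 12) (.D 12)
    (.P 1 (.X 17 
     (.P 3 (.S 0 [3,4,5,0,1,2,6,7,8] [0,2,1,3])) (.D 17) (.D 17)
     (.P 1 (.X 18 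
      (.P 1 (.X 20 
       (.P 3 (.S 0 [1,2,0,4,3,5,6,7,8] [0,1,2,3])) (.D 20) (.D 20)
       (.P 1 (.X 33 
        (.P 6 (.S 0 [0,2,1,5,3,4,6,7,8] [0,1,2,3])) (.D 33) (.D 33)
        (.P 1 (.X 34 
         (.P 6 (.S 0 [1,2,0,5,3,4,6,7,8] [0,1,2,3])) (.D 34) (.D 34)
         (.P 1 (.X 36 
          (.P 1 (.X 65 
           (.P 2 (.X 66 
            (.P 4 (.S 0 [0,1,2,6,7,8,3,4,5] [0,1,3,2])) (.D 66)
            (.P 1 (.X 68 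
             (.P 4 (.S 0 [0,2,1,6,7,8,3,4,5] [0,1,3,2])) (.D 68)
             (.P 1 (.X 72 
              (.P 3 (.X 130 
               (.P 3 (.X 132 
                (.P 2 (.D 384)) (.D 132)
                (.P 2 (.X 144 
                 (.P 3 (.X 260 
                  (.P 2 (.X 288 
                   (.P 2 (.X 3  (.D 3) (.D 3) (.P 2 (.D 11)) (.P 2 (.D 67))))
                   (.P 3 (.D 104)) (.D 288) (.D 288))) (.D 260) (.P 3 (.D 69)) (.D 260)))
                 (.P 2 (.X 160 
                  (.P 3 (.X 260 
                   (.P 2 (.X 272 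
                    (.P 2 (.X 3  (.D 3) (.D 3) (.P 2 (.D 11)) (.P 2 (.D 67)))) (.P 3 (.D 88)) (.D 272) (.D 272))) (.D 260) (.P 3 (.D 69)) (.D 260)))
                  (.P 3 (.D 200)) (.D 160) (.D 160))) (.D 144) (.D 144))) (.D 132))) (.D 130)
               (.P 2 (.X 132 
                (.P 3 (.S 0 [0,2,1,3,5,4,6,7,8] [0,1,2,3])) (.D 132) (.P 6 (.D 73)) (.D 132))) (.D 130)))
              (.P 2 (.X 80 
               (.P 3 (.X 130 
                (.P 3 (.X 132 
                 (.P 2 (.D 384)) (.D 132)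
                 (.P 2 (.X 136 
                  (.P 3 (.X 260 
                   (.P 2 (.X 288 
                    (.P 2 (.S 0 [2,0,1,5,3,4,8,6,7] [0,1,2,3])) (.P 4 (.D 25)) (.D 288) (.D 288))) (.D 260) (.P 4 (.D 11)) (.D 260)))
                  (.P 2 (.X 160 
                   (.P 3 (.X 260 
                    (.P 2 (.X 264 
                     (.P 2 (.X 3  (.D 3) (.D 3) (.P 2 (.D 19)) (.P 2 (.D 67)))) (.P 3 (.D 88)) (.D 264) (.D 264))) (.D 260)
                    (.P 3 (.D 134)) (.D 260)))
                   (.P 3 (.D 208)) (.D 160) (.D 160))) (.D 136) (.D 136))) (.D 132))) (.D 130)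
                (.P 2 (.X 132 
                 (.P 3 (.X 136 
                  (.P 3 (.S 0 [2,0,1,5,3,4,7,6,8] [0,1,2,3]))
                  (.P 2 (.X 160 
                   (.P 3 (.S 0 [2,0,1,5,3,4,7,6,8] [0,1,2,3]))
                   (.P 3 (.D 448)) (.D 160) (.D 160))) (.D 136) (.D 136))) (.D 132) (.P 6 (.D 81)) (.D 132))) (.D 130)))
               (.P 2 (.X 96 
                (.P 3 (.S 0 [0,2,1,3,5,4,6,7,8] [0,1,2,3]))
                (.P 2 (.X 130 
                 (.P 2 (.X 132 
                  (.P 2 (.D 384)) (.D 132)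
                  (.P 1 (.X 136 
                   (.P 3 (.D 200))
                   (.P 2 (.X 144 
                    (.P 3 (.D 208))
                    (.P 2 (.X 160 
                     (.P 3 (.D 448))
                     (.P 2 (.X 260 
                      (.P 1 (.X 264 
                       (.P 3 (.D 328))
                       (.P 2 (.X 272  (.P 2 (.D 48))
                        (.P 2 (.X 288 
                         (.P 3 (.D 296))
                         (.P 2 (.X 3  (.D 3) (.D 3) (.P 2 (.D 11)) (.P 2 (.D 67)))) (.D 288) (.D 288))) (.D 272) (.D 272))) (.D 264) (.D 264))) (.D 260) (.P 3 (.D 69)) (.D 260))) (.D 160) (.D 160))) (.D 144) (.D 144))) (.D 136) (.D 136))) (.D 132))) (.D 130)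
                 (.P 1 (.X 132 
                  (.P 2 (.S 0 [0,2,1,3,5,4,6,7,8] [0,1,2,3])) (.D 132)
                  (.P 3 (.X 136  (.P 5 (.D 3))
                   (.P 2 (.X 144  (.P 5 (.D 3))
                    (.P 2 (.X 160  (.P 5 (.D 3))
                     (.P 2 (.X 258  (.P 4 (.D 69)) (.D 258) (.P 2 (.D 6)) (.D 258))) (.D 160) (.D 160))) (.D 144) (.D 144))) (.D 136) (.D 136))) (.D 132))) (.D 130))) (.D 96) (.D 96))) (.D 80) (.D 80))) (.D 72) (.D 72))) (.D 68))) (.D 66))) (.D 65)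
           (.P 1 (.X 66 
            (.P 2 (.S 0 [1,0,2,4,3,5,6,7,8] [0,1,2,3])) (.D 66)
            (.P 1 (.X 68 
             (.P 2 (.S 0 [2,0,1,5,3,4,6,7,8] [0,1,2,3])) (.D 68)
             (.P 1 (.X 72 
              (.P 2 (.S 0 [3,4,5,0,1,2,6,7,8] [0,2,1,3]))
              (.P 2 (.X 80 
               (.P 2 (.S 0 [4,3,5,1,0,2,6,7,8] [0,2,1,3]))
               (.P 2 (.X 96 
                (.P 2 (.S 0 [5,3,4,2,0,1,6,7,8] [0,2,1,3]))
                (.P 2 (.X 129 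
                 (.P 3 (.S 0 [0,1,2,3,4,5,7,6,8] [0,1,2,3])) (.D 129)
                 (.P 1 (.X 130 
                  (.P 3 (.S 0 [1,0,2,4,3,5,7,6,8] [0,1,2,3])) (.D 130)
                  (.P 1 (.X 132 
                   (.P 3 (.S 0 [2,0,1,5,3,4,7,6,8] [0,1,2,3])) (.D 132)
                   (.P 1 (.X 136 
                    (.P 3 (.S 0 [3,4,5,0,1,2,7,6,8] [0,2,1,3]))
                    (.P 2 (.X 144 
                     (.P 3 (.S 0 [4,3,5,1,0,2,7,6,8] [0,2,1,3]))
                     (.P 2 (.X 160 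
                      (.P 2 (.S 0 [5,3,4,2,0,1,7,6,8] [0,2,1,3]))
                      (.P 4 (.X 3 
                       (.P 2 (.X 24 
                        (.P 2 (.X 7  (.D 7) (.P 3 (.D 43))
                         (.P 1 (.X 11  (.D 11) (.P 2 (.D 43))
                          (.P 8 (.X 13  (.D 13) (.P 5 (.D 35)) (.P 3 (.D 30)) (.D 13))) (.D 11))) (.D 7))) (.D 24) (.D 24)
                        (.P 2 (.S 0 [5,3,4,2,0,1,6,7,8] [0,2,1,3])))) (.D 3) (.D 3)
                       (.P 2 (.S 0 [0,2,1,3,5,4,6,7,8] [0,1,2,3])))) (.D 160) (.D 160))) (.D 144) (.D 144))) (.D 136) (.D 136))) (.D 132))) (.D 130))) (.D 129))) (.D 96) (.D 96))) (.D 80) (.D 80))) (.D 72) (.D 72))) (.D 68))) (.D 66))) (.D 65))) (.D 36) (.D 36)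
          (.P 1 (.X 65 
           (.P 8 (.S 1 [0,3,6,2,7,8,1,4,5] [1,0,2,3])) (.D 65)
           (.P 1 (.X 66  (.P 7 (.D 75)) (.D 66)
            (.P 1 (.X 68 
             (.P 1 (.X 72  (.P 6 (.D 50))
              (.P 2 (.X 80  (.P 6 (.D 41))
               (.P 2 (.X 96 
                (.P 2 (.X 129  (.P 8 (.D 39)) (.D 129)
                 (.P 1 (.X 130 
                  (.P 5 (.D 257)) (.D 130)
                  (.P 1 (.X 132  (.P 7 (.D 35)) (.D 132)
                   (.P 10 (.D 28)) (.D 132))) (.D 130))) (.D 129)))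
                (.P 2 (.X 129 
                 (.P 8 (.S 1 [0,3,7,2,6,8,1,4,5] [1,0,2,3])) (.D 129)
                 (.P 1 (.X 130 
                  (.P 5 (.D 257)) (.D 130)
                  (.P 1 (.X 132 
                   (.P 12 (.S 0 [0,1,2,8,6,7,3,4,5] [0,1,3,2])) (.D 132)
                   (.P 3 (.X 136  (.P 3 (.D 41))
                    (.P 2 (.X 144  (.P 3 (.D 50))
                     (.P 2 (.X 160 
                      (.P 5 (.D 329))
                      (.P 2 (.X 257  (.P 3 (.D 7)) (.D 257) (.P 4 (.D 22)) (.D 257))) (.D 160) (.D 160))) (.D 144) (.D 144))) (.D 136) (.D 136))) (.D 132))) (.D 130))) (.D 129))) (.D 96) (.D 96))) (.D 80) (.D 80))) (.D 72) (.D 72))) (.D 68)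
             (.P 1 (.X 72 
              (.P 8 (.S 8 [0,3,6,5,7,8,1,2,4] [1,2,0,3]))
              (.P 2 (.X 80  (.P 4 (.D 88))
               (.P 2 (.X 96 
                (.P 2 (.S 0 [3,4,5,0,1,2,6,7,8] [0,2,1,3]))
                (.P 2 (.X 129  (.P 3 (.D 7)) (.D 129)
                 (.P 1 (.X 130  (.P 3 (.D 7)) (.D 130)
                  (.P 1 (.X 132 
                   (.P 3 (.S 0 [0,1,2,3,4,5,7,6,8] [0,1,2,3])) (.D 132)
                   (.P 1 (.X 136  (.P 3 (.D 41))
                    (.P 2 (.X 144  (.P 3 (.D 50))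
                     (.P 2 (.X 160 
                      (.P 2 (.S 0 [3,4,5,0,1,2,7,6,8] [0,2,1,3]))
                      (.P 5 (.X 7  (.D 7)
                       (.P 8 (.S 1 [0,2,3,1,4,5,6,7,8] [1,0,3,2]))
                       (.P 1 (.X 11  (.D 11)
                        (.P 14 (.S 1 [0,3,2,1,4,5,6,7,8] [1,0,3,2]))
                        (.P 3 (.X 13  (.D 13)
                         (.P 5 (.X 14  (.D 14) (.P 4 (.D 62))
                          (.P 10 (.X 19  (.D 19)
                           (.P 6 (.S 2 [1,4,2,0,3,5,6,7,8] [1,0,3,2])) (.P 6 (.L 8)) (.D 19))) (.D 14)))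
                         (.P 9 (.S 1 [4,5,1,3,0,2,6,7,8] [2,0,3,1])) (.D 13))) (.D 11))) (.D 7))) (.D 160) (.D 160))) (.D 144) (.D 144))) (.D 136) (.D 136))) (.D 132))) (.D 130))) (.D 129))) (.D 96) (.D 96))) (.D 80) (.D 80))) (.D 72) (.D 72))) (.D 68))) (.D 66))) (.D 65))))))))))) (.D 18) (.D 18)
      (.P 1 (.X 20 
       (.P 1 (.S 0 [0,2,1,3,4,5,6,7,8] [0,1,2,3])) (.D 20) (.D 20)
       (.P 1 (.X 33  (.P 16 (.D 7)) (.D 33) (.D 33)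
        (.P 1 (.X 34 
         (.P 1 (.S 0 [0,1,2,3,5,4,6,7,8] [0,1,2,3])) (.D 34) (.D 34)
         (.P 1 (.X 36 
          (.P 1 (.S 0 [0,2,1,3,5,4,6,7,8] [0,1,2,3])) (.D 36) (.D 36)
          (.P 1 (.X 65  (.P 4 (.D 73)) (.D 65)
           (.P 1 (.X 66 
            (.P 1 (.X 68 
             (.P 3 (.S 0 [1,2,0,6,7,8,3,4,5] [0,1,3,2])) (.D 68)
             (.P 1 (.X 72  (.P 4 (.D 73))
              (.P 2 (.X 80 
               (.P 3 (.X 129  (.P 3 (.D 13)) (.D 129)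
                (.P 1 (.X 130  (.P 6 (.D 13)) (.D 130)
                 (.P 1 (.X 132 
                  (.P 1 (.S 0 [1,2,0,6,7,8,3,4,5] [0,1,3,2])) (.D 132)
                  (.P 8 (.D 168)) (.D 132))) (.D 130))) (.D 129)))
               (.P 2 (.X 96 
                (.P 2 (.S 0 [0,1,2,3,5,4,6,7,8] [0,1,2,3]))
                (.P 2 (.X 129  (.P 3 (.D 13)) (.D 129)
                 (.P 1 (.X 130  (.P 6 (.D 13)) (.D 130)
                  (.P 1 (.X 132 
                   (.P 1 (.S 0 [1,2,0,6,7,8,3,4,5] [0,1,3,2])) (.D 132)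
                   (.P 3 (.X 136  (.P 3 (.D 25))
                    (.P 2 (.X 144 
                     (.P 5 (.D 329))
                     (.P 2 (.X 160 
                      (.P 5 (.D 329))
                      (.P 2 (.X 257  (.P 3 (.D 11)) (.D 257)
                       (.P 6 (.S 0 [1,2,0,6,8,7,3,4,5] [0,1,3,2])) (.D 257))) (.D 160) (.D 160))) (.D 144) (.D 144))) (.D 136) (.D 136))) (.D 132))) (.D 130))) (.D 129))) (.D 96) (.D 96))) (.D 80) (.D 80))) (.D 72) (.D 72))) (.D 68))) (.D 66)
            (.P 1 (.X 68 
             (.P 1 (.S 0 [0,2,1,3,4,5,6,7,8] [0,1,2,3])) (.D 68)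
             (.P 1 (.X 72  (.P 4 (.D 73))
              (.P 2 (.X 80 
               (.P 2 (.S 0 [3,4,5,0,1,2,6,7,8] [0,2,1,3]))
               (.P 2 (.X 96 
                (.P 2 (.S 0 [3,5,4,0,1,2,6,7,8] [0,2,1,3]))
                (.P 2 (.X 129  (.P 3 (.D 11)) (.D 129)
                 (.P 1 (.X 130 
                  (.P 3 (.S 0 [0,1,2,3,4,5,7,6,8] [0,1,2,3])) (.D 130)
                  (.P 1 (.X 132 
                   (.P 3 (.S 0 [0,2,1,3,4,5,7,6,8] [0,1,2,3])) (.D 132)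
                   (.P 1 (.X 136  (.P 3 (.D 25))
                    (.P 2 (.X 144 
                     (.P 3 (.S 0 [3,4,5,0,1,2,7,6,8] [0,2,1,3]))
                     (.P 2 (.X 160 
                      (.P 2 (.S 0 [3,5,4,0,1,2,7,6,8] [0,2,1,3]))
                      (.P 4 (.X 7  (.D 7)
                       (.P 4 (.D 201))
                       (.P 1 (.X 11  (.D 11) (.P 3 (.D 69)) (.P 4 (.D 69)) (.D 11)))
                       (.P 1 (.X 11  (.D 11) (.P 3 (.D 69)) (.P 4 (.D 69)) (.D 11))))) (.D 160) (.D 160))) (.D 144) (.D 144))) (.D 136) (.D 136))) (.D 132))) (.D 130))) (.D 129))) (.D 96) (.D 96))) (.D 80) (.D 80))) (.D 72) (.D 72))) (.D 68))) (.D 66))) (.D 65))))))))))))))))))) (.D 9) (.D 9)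
  (.P 1 (.X 10 
   (.P 1 (.S 0 [1,0,2,3,4,5,6,7,8] [0,1,2,3])) (.D 10) (.D 10)
   (.P 1 (.X 12 
    (.P 1 (.S 0 [2,0,1,3,4,5,6,7,8] [0,1,2,3])) (.D 12) (.D 12)
    (.P 1 (.X 17 
     (.P 1 (.S 0 [0,1,2,4,3,5,6,7,8] [0,1,2,3])) (.D 17) (.D 17)
     (.P 1 (.X 18 
      (.P 1 (.S 0 [1,0,2,4,3,5,6,7,8] [0,1,2,3])) (.D 18) (.D 18)
      (.P 1 (.X 20 
       (.P 1 (.S 0 [2,0,1,4,3,5,6,7,8] [0,1,2,3])) (.D 20) (.D 20)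
       (.P 1 (.X 33 
        (.P 1 (.S 0 [0,1,2,5,3,4,6,7,8] [0,1,2,3])) (.D 33) (.D 33)
        (.P 1 (.X 34 
         (.P 1 (.S 0 [1,0,2,5,3,4,6,7,8] [0,1,2,3])) (.D 34) (.D 34)
         (.P 1 (.X 36 
          (.P 1 (.S 0 [2,0,1,5,3,4,6,7,8] [0,1,2,3])) (.D 36) (.D 36)
          (.P 1 (.X 65 
           (.P 1 (.S 0 [0,1,2,6,7,8,3,4,5] [0,1,3,2])) (.D 65)
           (.P 1 (.X 66 
            (.P 1 (.S 0 [1,0,2,6,7,8,3,4,5] [0,1,3,2])) (.D 66)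
            (.P 1 (.X 68 
             (.P 1 (.S 0 [2,0,1,6,7,8,3,4,5] [0,1,3,2])) (.D 68)
             (.P 1 (.X 72 
              (.P 2 (.S 0 [3,4,5,6,7,8,0,1,2] [0,3,1,2]))
              (.P 2 (.X 80 
               (.P 2 (.S 0 [4,3,5,6,7,8,0,1,2] [0,3,1,2]))
               (.P 2 (.X 96 
                (.P 2 (.S 0 [5,3,4,6,7,8,0,1,2] [0,3,1,2]))
                (.P 2 (.X 129 
                 (.P 3 (.S 0 [0,1,2,7,6,8,3,4,5] [0,1,3,2])) (.D 129)
                 (.P 1 (.X 130 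
                  (.P 3 (.S 0 [1,0,2,7,6,8,3,4,5] [0,1,3,2])) (.D 130)
                  (.P 1 (.X 132 
                   (.P 3 (.S 0 [2,0,1,7,6,8,3,4,5] [0,1,3,2])) (.D 132)
                   (.P 1 (.X 136 
                    (.P 3 (.S 0 [3,4,5,7,6,8,0,1,2] [0,3,1,2]))
                    (.P 2 (.X 144 
                     (.P 3 (.S 0 [4,3,5,7,6,8,0,1,2] [0,3,1,2]))
                     (.P 2 (.X 160 
                      (.P 2 (.S 0 [5,3,4,7,6,8,0,1,2] [0,3,1,2]))
                      (.P 4 (.X 7  (.D 7)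
                       (.P 5 (.X 56  (.D 56) (.D 56) (.P 6 (.L 9))
                        (.P 5 (.X 88  (.D 88) (.D 88)
                         (.P 6 (.S 8 [4,3,5,6,7,8,0,1,2] [1,2,0,3]))
                         (.P 5 (.S 56 [5,3,4,6,7,8,0,1,2] [1,2,3,0]))))))
                       (.P 1 (.X 11  (.D 11)
                        (.P 10 (.S 1 [1,0,2,3,4,5,6,7,8] [1,0,3,2]))
                        (.P 1 (.X 13  (.D 13)
                         (.P 10 (.S 1 [2,0,1,3,4,5,6,7,8] [1,0,3,2]))
                         (.P 11 (.S 2 [2,0,1,3,4,5,6,7,8] [1,0,3,2])) (.D 13))) (.D 11)))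
                       (.P 1 (.S 0 [0,1,2,6,7,8,3,4,5] [0,1,3,2])))) (.D 160) (.D 160))) (.D 144) (.D 144))) (.D 136) (.D 136))) (.D 132))) (.D 130))) (.D 129))) (.D 96) (.D 96))) (.D 80) (.D 80))) (.D 72) (.D 72))) (.D 68))) (.D 66))) (.D 65))))))))))))))))))))

set_option maxRecDepth 100000 in
theorem chk : start tree = true := by decide +kernel

end Res9

namespace Res9

theorem dir_facts : ∀ i < 9, ∀ x < 512,
    ((lowMask i).testBit x = !x.testBit i) ∧
    (x.testBit i = true → 2 ^ i ≤ x ∧ (lowMask i).testBit (x - 2 ^ i) = true ∧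
      x ^^^ 2 ^ i = x - 2 ^ i) ∧
    (x.testBit i = false → x ^^^ 2 ^ i = x + 2 ^ i ∧
      (2 ^ i ≤ x → (lowMask i).testBit (x - 2 ^ i) = false)) ∧ x ^^^ 2 ^ i < 512 := by
  decide +kernel

theorem testBit_sh (m i x : ℕ) (hi : i < 9) (hx : x < 512) :
    (sh m (2 ^ i) (lowMask i)).testBit x = m.testBit (x ^^^ 2 ^ i) := by
  obtain ⟨h1, h2, h3, -⟩ := dir_facts i hi x hx
  have e : sh m (2 ^ i) (lowMask i) =
    ((m >>> 2 ^ i) &&& lowMask i) ||| ((m &&& lowMask i) <<< 2 ^ i) := rfl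
  rw [e]
  simp only [Nat.testBit_or, Nat.testBit_and, Nat.testBit_shiftRight, Nat.testBit_shiftLeft, h1]
  cases hb : x.testBit i
  · obtain ⟨h4, h5⟩ := h3 hb
    rw [h4, Nat.add_comm x]
    by_cases h6 : 2 ^ i ≤ x
    · simp [h5 h6]
    · simp [h6]
  · obtain ⟨h4, h5, h6⟩ := h2 hb
    simp [h4, h5, h6]

theorem testBit_andn (a b x : ℕ) : (andn a b).testBit x = (a.testBit x && !b.testBit x) := by
  have e : andn a b = a ^^^ (a &&& b) := rfl
  rw [e, Nat.testBit_xor, Nat.testBit_and]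
  cases a.testBit x <;> cases b.testBit x <;> rfl

theorem testBit_lor (a b x : ℕ) : (Nat.lor a b).testBit x = (a.testBit x || b.testBit x) :=
  Nat.testBit_or a b x

theorem testBit_land (a b x : ℕ) : (Nat.land a b).testBit x = (a.testBit x && b.testBit x) :=
  Nat.testBit_and a b x

theorem dirs_succ (n : ℕ) : dirs (n + 1) = (2 ^ n, lowMask n) :: dirs n := by
  rw [dirs, force_eq, force_eq]

/-- Number of neighbours (in the first `n` directions) satisfying `d`. -/
def cnt (d : ℕ → Bool) (x n : ℕ) : ℕ := ((Finset.range n).filter fun i => d (x ^^^ 2 ^ i)).card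

theorem cnt_succ (d : ℕ → Bool) (x n : ℕ) :
    cnt d x (n + 1) = cnt d x n + (d (x ^^^ 2 ^ n)).toNat := by
  unfold cnt
  rw [Finset.range_add_one, Finset.filter_insert]
  split_ifs with h
  · rw [Finset.card_insert_of_notMem (by simp)]; simp [h]
  · simp [h]

theorem count3_spec {A : Type} (d n : ℕ) (hn : n ≤ 9) (k : ℕ → ℕ → ℕ → A) :
    ∃ a1 a2 a3, count3 d (dirs n) k = k a1 a2 a3 ∧
      ∀ x < 512, (a1.testBit x = true → 1 ≤ cnt d.testBit x n) ∧
        (a2.testBit x = true → 2 ≤ cnt d.testBit x n) ∧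
        (a3.testBit x = true → 3 ≤ cnt d.testBit x n) := by
  induction n generalizing k with
  | zero => exact ⟨0, 0, 0, rfl, by simp⟩
  | succ n ih =>
    rw [dirs_succ, count3]
    obtain ⟨a1, a2, a3, h, hs⟩ := ih (by omega) _
    refine ⟨Nat.lor a1 (sh d (2 ^ n) (lowMask n)),
      Nat.lor a2 (Nat.land a1 (sh d (2 ^ n) (lowMask n))),
      Nat.lor a3 (Nat.land a2 (sh d (2 ^ n) (lowMask n))), h.trans ?_, ?_⟩
    · simp only [force_eq]
    · intro x hx
      obtain ⟨s1, s2, s3⟩ := hs x hx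
      simp only [testBit_lor, testBit_land, testBit_sh _ _ _ (by omega : n < 9) hx, cnt_succ]
      cases d.testBit (x ^^^ 2 ^ n) <;> simp <;> grind

theorem spread_spec {A : Type} (a n : ℕ) (hn : n ≤ 9) (k : ℕ → A) :
    ∃ w, spread a (dirs n) k = k w ∧
      ∀ x < 512, w.testBit x = true → ∃ i < n, a.testBit (x ^^^ 2 ^ i) = true := by
  induction n generalizing k with
  | zero => exact ⟨0, rfl, by simp⟩
  | succ n ih =>
    rw [dirs_succ, spread]
    obtain ⟨w, h, hs⟩ := ih (by omega) _
    refine ⟨_, h.trans (force_eq _ _), ?_⟩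
    intro x hx
    simp only [testBit_lor, testBit_sh _ _ _ (by omega : n < 9) hx, Bool.or_eq_true]
    rintro (h | h)
    · obtain ⟨i, hi, h⟩ := hs x hx h
      exact ⟨i, by omega, h⟩
    · exact ⟨n, by omega, h⟩

/-- Coded version of the neighbour counting condition. -/
structure GoodN (F : ℕ → ℕ) : Prop where
  lt : ∀ x, F x < 4
  cnt : ∀ x < 512, ∀ c < 4, cnt (fun y => F y == c) x 9 = if F x = c then 0 else 3

/-- The masks allow `F`. -/
def Comp (F : ℕ → ℕ) (m0 m1 m2 m3 : ℕ) : Prop :=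
  ∀ x < 512, (F x = 0 → m0.testBit x = true) ∧ (F x = 1 → m1.testBit x = true) ∧
    (F x = 2 → m2.testBit x = true) ∧ (F x = 3 → m3.testBit x = true)

theorem xor_lt {x i : ℕ} (hi : i < 9) (hx : x < 512) : x ^^^ 2 ^ i < 512 :=
  (dir_facts i hi x hx).2.2.2

theorem cnt_pos_iff (d : ℕ → Bool) (x : ℕ) : 1 ≤ cnt d x 9 ↔ ∃ i < 9, d (x ^^^ 2 ^ i) = true := by
  unfold cnt
  rw [Nat.one_le_iff_ne_zero, ← Nat.pos_iff_ne_zero, Finset.card_pos]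
  simp [Finset.Nonempty]

theorem pass1_spec {A : Type} {F : ℕ → ℕ} (hF : GoodN F) (c : ℕ) (hc : c < 4) (m x y z : ℕ)
    (hm : ∀ v < 512, F v = c → m.testBit v = true)
    (ho : ∀ v < 512, F v ≠ c → (x.testBit v || (y.testBit v || z.testBit v)) = true)
    (k : ℕ → A) :
    ∃ n, pass1 (dirs 9) m x y z k = k n ∧ ∀ v < 512, F v = c → n.testBit v = true := by
  unfold pass1
  rw [force_eq]
  set d := andn m (Nat.lor x (Nat.lor y z)) with hd
  obtain ⟨a1, a2, a3, h, hs⟩ := count3_spec d 9 le_rfl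
    (fun a1 _ a3 => spread a3 (dirs 9) fun w => force (andn (andn m a1) (andn w d)) k)
  obtain ⟨w, h', hw⟩ := spread_spec a3 9 le_rfl (fun w => force (andn (andn m a1) (andn w d)) k)
  refine ⟨_, (h.trans h').trans (force_eq _ _), ?_⟩
  have hdc : ∀ v < 512, d.testBit v = true → F v = c := by
    intro v hv h
    by_contra hne
    have := ho v hv hne
    rw [hd, testBit_andn, testBit_lor, testBit_lor, this] at h
    simp at h
  have hsub : ∀ v < 512, ((Finset.range 9).filter fun i => d.testBit (v ^^^ 2 ^ i)) ⊆
      (Finset.range 9).filter fun i => (F (v ^^^ 2 ^ i) == c) := by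
    intro v hv i
    simp only [Finset.mem_filter, Finset.mem_range]
    rintro ⟨hi, h⟩
    exact ⟨hi, by simpa using hdc _ (xor_lt hi hv) h⟩
  intro v hv hvc
  simp only [testBit_andn, hm v hv hvc, Bool.true_and, Bool.and_eq_true, Bool.not_eq_true',
    Bool.and_eq_false_iff, Bool.not_eq_false']
  refine ⟨?_, ?_⟩
  · by_contra h1
    have h2 := (hs v hv).1 (by simpa using h1)
    have h3 : cnt d.testBit v 9 ≤ cnt (fun y => F y == c) v 9 := Finset.card_le_card (hsub v hv)
    rw [hF.cnt v hv c hc, if_pos hvc] at h3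
    omega
  · by_contra! h1
    obtain ⟨h1, h2⟩ := h1
    obtain ⟨i, hi, h3⟩ := hw v hv (by simpa using h1)
    have hu := xor_lt hi hv
    have h4 := (hs _ hu).2.2 h3
    have h5 : cnt d.testBit (v ^^^ 2 ^ i) 9 < cnt (fun y => F y == c) (v ^^^ 2 ^ i) 9 := by
      apply Finset.card_lt_card
      refine (Finset.ssubset_iff_of_subset (hsub _ hu)).2 ⟨i, ?_, ?_⟩
      · simp [hi, hvc, Nat.xor_assoc]
      · simpa [hi, Nat.xor_assoc] using h2
    rw [hF.cnt _ hu c hc] at h5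
    split_ifs at h5 <;> omega

theorem pass_spec {A : Type} {F : ℕ → ℕ} (hF : GoodN F) {m0 m1 m2 m3 : ℕ}
    (h : Comp F m0 m1 m2 m3) (k : ℕ → ℕ → ℕ → ℕ → A) :
    ∃ n0 n1 n2 n3, pass (dirs 9) m0 m1 m2 m3 k = k n0 n1 n2 n3 ∧ Comp F n0 n1 n2 n3 := by
  have hlt := hF.lt
  unfold pass
  obtain ⟨n0, e0, h0⟩ := pass1_spec hF 0 (by omega) m0 m1 m2 m3 (fun v hv => (h v hv).1)
    (fun v hv hn => by have := h v hv; have := hlt v; grind) (fun n0 =>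
      pass1 (dirs 9) m1 m0 m2 m3 fun n1 => pass1 (dirs 9) m2 m0 m1 m3 fun n2 =>
      pass1 (dirs 9) m3 m0 m1 m2 fun n3 => k n0 n1 n2 n3)
  obtain ⟨n1, e1, h1⟩ := pass1_spec hF 1 (by omega) m1 m0 m2 m3 (fun v hv => (h v hv).2.1)
    (fun v hv hn => by have := h v hv; have := hlt v; grind) (fun n1 =>
      pass1 (dirs 9) m2 m0 m1 m3 fun n2 =>
      pass1 (dirs 9) m3 m0 m1 m2 fun n3 => k n0 n1 n2 n3)
  obtain ⟨n2, e2, h2⟩ := pass1_spec hF 2 (by omega) m2 m0 m1 m3 (fun v hv => (h v hv).2.2.1)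
    (fun v hv hn => by have := h v hv; have := hlt v; grind) (fun n2 =>
      pass1 (dirs 9) m3 m0 m1 m2 fun n3 => k n0 n1 n2 n3)
  obtain ⟨n3, e3, h3⟩ := pass1_spec hF 3 (by omega) m3 m0 m1 m2 (fun v hv => (h v hv).2.2.2)
    (fun v hv hn => by have := h v hv; have := hlt v; grind) (fun n3 => k n0 n1 n2 n3)
  refine ⟨n0, n1, n2, n3, e0.trans (e1.trans (e2.trans e3)), fun x hx => ?_⟩
  exact ⟨h0 x hx, h1 x hx, h2 x hx, h3 x hx⟩

theorem passN_spec {A : Type} {F : ℕ → ℕ} (hF : GoodN F) (n : ℕ) {m0 m1 m2 m3 : ℕ}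
    (h : Comp F m0 m1 m2 m3) (k : ℕ → ℕ → ℕ → ℕ → A) :
    ∃ n0 n1 n2 n3, passN (dirs 9) n m0 m1 m2 m3 k = k n0 n1 n2 n3 ∧ Comp F n0 n1 n2 n3 := by
  induction n generalizing m0 m1 m2 m3 with
  | zero => exact ⟨_, _, _, _, rfl, h⟩
  | succ n ih =>
    rw [passN]
    obtain ⟨n0, n1, n2, n3, e, h'⟩ := pass_spec hF h fun a b c d => passN (dirs 9) n a b c d k
    obtain ⟨k0, k1, k2, k3, e', h''⟩ := ih h'
    exact ⟨k0, k1, k2, k3, e.trans e', h''⟩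

theorem val_spec {F : ℕ → ℕ} (hF : GoodN F) {m0 m1 m2 m3 : ℕ} (h : Comp F m0 m1 m2 m3)
    {x : ℕ} (hx : x < 512) (hv : val m0 m1 m2 m3 x < 4) : val m0 m1 m2 m3 x = F x := by
  obtain ⟨h0, h1, h2, h3⟩ := h x hx
  have hl := hF.lt x
  unfold val at *
  revert h0 h1 h2 h3 hv
  cases m0.testBit x <;> cases m1.testBit x <;> cases m2.testBit x <;> cases m3.testBit x <;>
    simp <;> omega

end Res9

namespace Res9

def key (F : ℕ → ℕ) : List ℕ → ℕ
  | [] => 0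
  | x :: r => F x * 4 ^ r.length + key F r

theorem key_lt {F : ℕ → ℕ} (l : List ℕ) (h : ∀ x ∈ l, F x < 4) : key F l < 4 ^ l.length := by
  induction l with
  | nil => simp [key]
  | cons x r ih =>
    have h1 := ih fun y hy => h y (by simp [hy])
    have h2 := h x (by simp)
    simp only [key, List.length_cons, pow_succ]
    nlinarith

theorem alpha_lt (p : List ℕ) (hp : ∀ q ∈ p, q < 9) (x t : ℕ) (ht : t < 512) :
    alpha p x t < 512 := by
  induction p generalizing x t with
  | nil => exact ht
  | cons q p ih =>
    rw [alpha]
    refine ih (fun q hq => hp q (by simp [hq])) _ _ ?_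
    refine Nat.xor_lt_two_pow (n := 9) ht ?_
    have h1 : q < 9 := hp q (by simp)
    have h2 : Nat.mod x 2 < 2 := Nat.mod_lt _ (by norm_num)
    change Nat.mod x 2 <<< q < 512
    rw [Nat.shiftLeft_eq]
    have h3 : 2 ^ q ≤ 2 ^ 8 := Nat.pow_le_pow_right (by norm_num) (by omega)
    nlinarith

theorem isPerm_lt {n : ℕ} {p : List ℕ} (h : isPerm n p = true) : ∀ q ∈ p, q < n := by
  simp only [isPerm, Bool.and_eq_true, List.all_eq_true] at h
  intro q hq
  simpa using h.1.2 q hq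

theorem isPerm_len {n : ℕ} {p : List ℕ} (h : isPerm n p = true) : p.length = n := by
  simp only [isPerm, Bool.and_eq_true, List.all_eq_true] at h
  exact Nat.eq_of_beq_eq_true h.1.1

theorem isPerm_surj {n : ℕ} {p : List ℕ} (h : isPerm n p = true) :
    ∀ j < n, ∃ i < n, lkp p i = j := by
  simp only [isPerm, Bool.and_eq_true, List.all_eq_true] at h
  intro j hj
  have := h.2 j (by simpa using hj)
  simp only [List.any_eq_true, List.mem_range] at this
  obtain ⟨i, hi, h⟩ := this
  exact ⟨i, hi, Nat.eq_of_beq_eq_true h⟩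

theorem lkp_cons_zero (a : ℕ) (l : List ℕ) : lkp (a :: l) 0 = a := rfl
theorem lkp_cons_succ (a : ℕ) (l : List ℕ) (n : ℕ) : lkp (a :: l) (n + 1) = lkp l n := rfl

theorem lkp_mem (l : List ℕ) (n : ℕ) (h : n < l.length) : lkp l n ∈ l := by
  induction l generalizing n with
  | nil => simp at h
  | cons a l ih =>
    cases n with
    | zero => simp [lkp_cons_zero]
    | succ n =>
      rw [lkp_cons_succ]
      exact List.mem_cons_of_mem _ (ih n (by simpa using h))

theorem isPerm_lkp_lt {n : ℕ} {p : List ℕ} (h : isPerm n p = true) {i : ℕ} (hi : i < n) :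
    lkp p i < n := isPerm_lt h _ (lkp_mem _ _ (by rw [isPerm_len h]; exact hi))

/-- The transformed function. -/
def trans (F : ℕ → ℕ) (t : ℕ) (p b : List ℕ) (x : ℕ) : ℕ := lkp b (F (alpha p x t))

/-- Minimality of the key. -/
def MinN (F : ℕ → ℕ) : Prop :=
  ∀ t < 512, ∀ p b, isPerm 9 p = true → isPerm 4 b = true →
    (∀ x ∈ normL, trans F t p b x = F x) → ¬ key (trans F t p b) keyL < key F keyL

section
variable {F : ℕ → ℕ} (hF : GoodN F) {m0 m1 m2 m3 : ℕ} (h : Comp F m0 m1 m2 m3)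
  {t : ℕ} (ht : t < 512) {p b : List ℕ} (hp : isPerm 9 p = true) (hb : isPerm 4 b = true)
include hF h ht hp

theorem sameOn_spec (l : List ℕ) (hl : ∀ x ∈ l, x < 512)
    (hs : sameOn m0 m1 m2 m3 t p b l = true) : ∀ x ∈ l, trans F t p b x = F x := by
  induction l with
  | nil => simp
  | cons x r ih =>
    simp only [sameOn, force_eq, Bool.and_eq_true, Nat.blt_eq] at hs
    obtain ⟨⟨⟨h1, h2⟩, h3⟩, h4⟩ := hs
    have e1 := val_spec hF h (hl x (by simp)) h1
    have e2 := val_spec hF h (alpha_lt p (isPerm_lt hp) x t ht) h2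
    have e3 := Nat.eq_of_beq_eq_true h3
    rw [e1, e2] at e3
    intro y hy
    rcases List.mem_cons.1 hy with rfl | hy
    · exact e3
    · exact ih (fun y hy => hl y (by simp [hy])) h4 y hy

include hb in
theorem lexLt_spec (l : List ℕ) (hl : ∀ x ∈ l, x < 512)
    (hs : lexLt m0 m1 m2 m3 t p b l = true) : key (trans F t p b) l < key F l := by
  induction l with
  | nil => simp [lexLt] at hs
  | cons x r ih =>
    simp only [lexLt, force_eq, Bool.and_eq_true, Nat.blt_eq, Bool.or_eq_true] at hs
    obtain ⟨⟨h1, h2⟩, h3⟩ := hs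
    have e1 := val_spec hF h (hl x (by simp)) h1
    have e2 := val_spec hF h (alpha_lt p (isPerm_lt hp) x t ht) h2
    rw [e1, e2] at h3
    have k1 : key (trans F t p b) r < 4 ^ r.length :=
      key_lt r fun y _ => isPerm_lkp_lt hb (hF.lt _)
    simp only [key]
    rcases h3 with h3 | ⟨h3, h4⟩
    · have : trans F t p b x < F x := h3
      nlinarith
    · have e3 : trans F t p b x = F x := Nat.eq_of_beq_eq_true h3
      have := ih (fun y hy => hl y (by simp [hy])) h4
      rw [e3]
      omega
end

theorem testBit_clr {m v x : ℕ} : (clr m v).testBit x = (m.testBit x && !decide (v = x)) := by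
  have e : clr m v = andn m (1 <<< v) := rfl
  rw [e, testBit_andn, Nat.shiftLeft_eq, one_mul, Nat.testBit_two_pow]

/-- `F` coincides with the representative with bit planes `P`. -/
def IsRep (F : ℕ → ℕ) (P : ℕ × ℕ) : Prop :=
  ∀ x < 512, (F x).testBit 0 = P.1.testBit x ∧ (F x).testBit 1 = P.2.testBit x

theorem leaf_spec {F : ℕ → ℕ} (hF : GoodN F) {m0 m1 m2 m3 : ℕ} (h : Comp F m0 m1 m2 m3)
    (P : ℕ × ℕ) (hl : leafOk m0 m1 m2 m3 P = true) : IsRep F P := by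
  simp only [leafOk, Bool.and_eq_true] at hl
  obtain ⟨⟨⟨l1, l2⟩, l3⟩, l4⟩ := hl
  replace l1 := Nat.eq_of_beq_eq_true l1
  replace l2 := Nat.eq_of_beq_eq_true l2
  replace l3 := Nat.eq_of_beq_eq_true l3
  replace l4 := Nat.eq_of_beq_eq_true l4
  intro x hx
  obtain ⟨h0, h1, h2, h3⟩ := h x hx
  have g1 := congrArg (fun n => n.testBit x) l1
  have g2 := congrArg (fun n => n.testBit x) l2
  have g3 := congrArg (fun n => n.testBit x) l3
  have g4 := congrArg (fun n => n.testBit x) l4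
  simp only [testBit_lor, testBit_land, Nat.zero_testBit] at g1 g2 g3 g4
  have hl := hF.lt x
  rcases (by omega : F x = 0 ∨ F x = 1 ∨ F x = 2 ∨ F x = 3) with e | e | e | e
  · have := h0 e; simp_all
  · have := h1 e; rw [e]; simp_all [Nat.testBit]
  · have := h2 e; rw [e]; simp_all [Nat.testBit]
  · have := h3 e; rw [e]; simp_all [Nat.testBit]

theorem check_spec {F : ℕ → ℕ} (hF : GoodN F) (hM : MinN F) (T0 : T) {m0 m1 m2 m3 : ℕ}
    (h : Comp F m0 m1 m2 m3) (hc : check (dirs 9) T0 m0 m1 m2 m3 = true) :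
    ∃ k < 10, IsRep F (lkp2 plane k) := by
  induction T0 generalizing m0 m1 m2 m3 with
  | P n t ih =>
    rw [check] at hc
    obtain ⟨n0, n1, n2, n3, e, h'⟩ := passN_spec hF n h (check (dirs 9) t)
    exact ih h' (e ▸ hc)
  | X v a b c d iha ihb ihc ihd =>
    simp only [check, force_eq, Bool.and_eq_true] at hc
    obtain ⟨hv, ⟨⟨h0, h1⟩, h2⟩, h3⟩ := hc
    have hl := hF.lt v
    rcases (by omega : F v = 0 ∨ F v = 1 ∨ F v = 2 ∨ F v = 3) with e | e | e | e
    · refine iha (fun x hx => ?_) h0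
      have := h x hx
      simp only [testBit_clr]
      grind
    · refine ihb (fun x hx => ?_) h1
      have := h x hx
      simp only [testBit_clr]
      grind
    · refine ihc (fun x hx => ?_) h2
      have := h x hx
      simp only [testBit_clr]
      grind
    · refine ihd (fun x hx => ?_) h3
      have := h x hx
      simp only [testBit_clr]
      grind
  | D v =>
    simp only [check, Bool.and_eq_true, Nat.blt_eq] at hc
    obtain ⟨hv, hc⟩ := hc
    have := h v hv
    have hl := hF.lt v
    exfalso
    simp at hc
    rcases (by omega : F v = 0 ∨ F v = 1 ∨ F v = 2 ∨ F v = 3) with e | e | e | e <;> simp_all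
  | S t p b =>
    simp only [check, Bool.and_eq_true, Nat.blt_eq] at hc
    obtain ⟨⟨⟨⟨hp, hb⟩, ht⟩, hs⟩, hl⟩ := hc
    exfalso
    exact hM t ht p b hp hb (sameOn_spec hF h ht hp normL (by decide) hs)
      (lexLt_spec hF h ht hp hb keyL (by decide) hl)
  | L k =>
    simp only [check, Bool.and_eq_true, Nat.blt_eq] at hc
    exact ⟨k, hc.1, leaf_spec hF h _ hc.2⟩

/-- The normalization condition. -/
def NormN (F : ℕ → ℕ) : Prop := F 0 = 0 ∧ ∀ i < 9, F (2 ^ i) = 1 + i / 3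

def stM (A c : ℕ) : ℕ := A - lkp
  [115792089237316195423570985008687907853610267032561502502939405359422902436118,
  115792089237316195423570985008687907853610267032561502502939405359422902436097,
  115792089237316195423570985008687907853610267032561502502939405359418607403031,
  4295033111] c

def okN (x c : ℕ) : Bool :=
  [(0, 0), (1, 1), (2, 1), (4, 1), (8, 2), (16, 2), (32, 2), (64, 3), (128, 3),
    (256, 3)].all fun p => !(Nat.beq x p.1) || Nat.beq c p.2

theorem okN_spec : ∀ x < 512, ∀ c < 4, okN x c = true → (stM allMask c).testBit x = true := by
  decide +kernel

theorem classN {F : ℕ → ℕ} (hF : GoodN F) (hM : MinN F) (hN : NormN F) :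
    ∃ k < 10, IsRep F (lkp2 plane k) := by
  have hc := chk
  unfold start at hc
  rw [force_eq] at hc
  refine check_spec hF hM tree ?_ hc
  have hz := hN.1
  have h0 := hN.2 0 (by norm_num)
  have h1 := hN.2 1 (by norm_num)
  have h2 := hN.2 2 (by norm_num)
  have h3 := hN.2 3 (by norm_num)
  have h4 := hN.2 4 (by norm_num)
  have h5 := hN.2 5 (by norm_num)
  have h6 := hN.2 6 (by norm_num)
  have h7 := hN.2 7 (by norm_num)
  have h8 := hN.2 8 (by norm_num)
  norm_num at h0 h1 h2 h3 h4 h5 h6 h7 h8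
  intro x hx
  have key : (stM allMask (F x)).testBit x = true := by
    refine okN_spec x hx (F x) (hF.lt x) ?_
    unfold okN
    rw [List.all_eq_true]
    intro p hp
    simp only [List.mem_cons, List.not_mem_nil, or_false] at hp
    by_cases e : x = p.1
    · have : F x = p.2 := by
        rcases hp with rfl | rfl | rfl | rfl | rfl | rfl | rfl | rfl | rfl | rfl <;> simp_all
      rw [this]
      simp
    · have h9 : Nat.beq x p.1 = false := Bool.eq_false_iff.2 fun h => e (Nat.eq_of_beq_eq_true h)
      rw [h9]
      rfl
  generalize allMask = A at key ⊢
  refine ⟨fun e => ?_, fun e => ?_, fun e => ?_, fun e => ?_⟩ <;> rw [e] at key <;> exact key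

end Res9

namespace Res9

/-! ### Words -/

/-- Unit vectors. -/
def ev (i : Fin 9) : BW 9 := Pi.single i 1

theorem zmod2_cases (a : ZMod 2) : a = 0 ∨ a = 1 := by revert a; decide

theorem bw_add_self {n : ℕ} (x : BW n) : x + x = 0 := by
  funext i
  have : ∀ a : ZMod 2, a + a = 0 := by decide
  exact this _

theorem bw_add_cancel {n : ℕ} (x y : BW n) : x + y + y = x := by
  rw [add_assoc, bw_add_self, add_zero]

theorem ev_app (i j : Fin 9) : ev i j = if j = i then 1 else 0 := by
  simp [ev, Pi.single_apply]

theorem ev_inj {i j : Fin 9} (h : ev i = ev j) : i = j := by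
  by_contra hn
  have := congrFun h i
  simp [ev, hn] at this

theorem ev_ne_zero (i : Fin 9) : ev i ≠ 0 := by
  intro h
  have := congrFun h i
  simp [ev] at this

theorem ev_sum (x : BW 9) : x = ∑ i ∈ Finset.univ.filter (fun i => x i = 1), ev i := by
  funext j
  rw [Finset.sum_apply]
  rw [Finset.sum_filter]
  rcases zmod2_cases (x j) with h | h
  · rw [h, Finset.sum_eq_zero]
    intro i _
    split_ifs with h1
    · have : j ≠ i := by rintro rfl; rw [h] at h1; exact absurd h1 (by decide)
      simp [ev, this]
    · rfl
  · rw [Finset.sum_eq_single j]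
    · simp [h, ev]
    · intro i _ hi
      simp [ev, hi.symm]
    · simp

theorem bw_induction {P : BW 9 → Prop} (h0 : P 0) (h1 : ∀ x i, P x → P (x + ev i)) (x : BW 9) :
    P x := by
  rw [ev_sum x]
  generalize Finset.univ.filter (fun i => x i = 1) = s
  induction s using Finset.induction_on with
  | empty => simpa using h0
  | insert i s hi ih => rw [Finset.sum_insert hi, add_comm]; exact h1 _ _ ih

theorem hAdj_iff (x y : BW 9) : hAdj x y ↔ ∃ i, y = x + ev i := by
  unfold hAdj hammingDist
  rw [Finset.card_eq_one]
  constructor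
  · rintro ⟨i, hi⟩
    refine ⟨i, ?_⟩
    funext j
    have := Finset.ext_iff.1 hi j
    simp only [Finset.mem_filter, Finset.mem_univ, true_and, Finset.mem_singleton] at this
    have h2 : ∀ a b : ZMod 2, a ≠ b → b = a + 1 := by decide
    by_cases hj : j = i
    · subst hj
      simpa [ev] using h2 _ _ (this.2 rfl)
    · have h3 : x j = y j := by
        by_contra h
        exact hj (this.1 h)
      simp [ev, hj, h3]
  · rintro ⟨i, rfl⟩
    refine ⟨i, ?_⟩
    ext j
    by_cases hj : j = i
    · subst hj; simp [ev]
    · simp [ev, hj]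

theorem cubeAut_spec {α : BW 9 ≃ BW 9} (h : IsCubeAut α) :
    ∃ σ : Equiv.Perm (Fin 9), ∀ x i, α (x + ev i) = α x + ev (σ i) := by
  have h1 : ∀ x i, ∃ j, α (x + ev i) = α x + ev j := fun x i =>
    (hAdj_iff _ _).1 ((h _ _).2 ((hAdj_iff _ _).2 ⟨i, rfl⟩))
  choose D hD using h1
  have hinj : ∀ x i k, D x i = D x k → i = k := by
    intro x i k hik
    have : α (x + ev i) = α (x + ev k) := by rw [hD, hD, hik]
    exact ev_inj (add_left_cancel (α.injective this))
  have hstep : ∀ x k i, D (x + ev k) i = D x i := by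
    intro x k i
    by_cases hk : k = i
    · subst hk
      have e1 := hD (x + ev k) k
      rw [bw_add_cancel, hD x k, add_assoc] at e1
      have e2 : ev (D x k) + ev (D (x + ev k) k) = 0 := by
        simpa using e1
      have e3 : ev (D x k) = ev (D (x + ev k) k) := by
        have := bw_add_cancel (ev (D x k)) (ev (D (x + ev k) k))
        rw [e2, zero_add] at this
        exact this.symm
      exact (ev_inj e3).symm
    · have e1 := hD (x + ev k) i
      have e2 := hD (x + ev i) k
      rw [add_right_comm, e1, hD x i, hD x k] at e2
      simp only [add_assoc] at e2
      have e3 := add_left_cancel e2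
      have hac : D x k ≠ D x i := fun e => hk (hinj _ _ _ e)
      have hab : D x k ≠ D (x + ev k) i := by
        intro e
        rw [← e, hD x k, bw_add_cancel] at e1
        have := α.injective e1
        rw [add_assoc] at this
        have h4 : ev k + ev i = 0 := by simpa using this
        have h5 := bw_add_cancel (ev k) (ev i)
        rw [h4, zero_add] at h5
        exact hk (ev_inj h5).symm
      have had : D x k = D (x + ev i) k := by
        by_contra hn
        have := congrFun e3 (D x k)
        simp [ev_app, hac, hab, hn] at this
      rw [← had, add_comm (ev (D x i))] at e3
      exact ev_inj (add_left_cancel e3)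
  have hconst : ∀ x, ∀ i, D x i = D 0 i :=
    bw_induction (P := fun x => ∀ i, D x i = D 0 i) (fun _ => rfl)
      (fun x k ih i => by rw [hstep, ih])
  refine ⟨Equiv.ofBijective (D 0) (Finite.injective_iff_bijective.1 fun i k => hinj 0 i k), ?_⟩
  intro x i
  rw [hD, hconst]
  rfl

theorem cubeAut_add {α : BW 9 ≃ BW 9} (h : IsCubeAut α) (a b c : BW 9) :
    α (a + b + c) = α a + α b + α c := by
  obtain ⟨σ, hσ⟩ := cubeAut_spec h
  have key : ∀ b, ∀ a, α (a + b) = α a + α b + α 0 :=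
    bw_induction (P := fun b => ∀ a, α (a + b) = α a + α b + α 0)
      (fun a => by simp [bw_add_cancel]) (fun b i ih a => by
        rw [← add_assoc, hσ, hσ, ih]; abel)
  have h0 : α 0 + α 0 = 0 := bw_add_self _
  rw [key c, key b]
  rw [add_right_comm, add_assoc (α a + α b), h0, add_zero]

/-! ### Equivalence -/

theorem equivFn_refl (f : BW 9 → BW 2) : EquivFn f f :=
  ⟨Equiv.refl _, Equiv.refl _, fun _ _ => Iff.rfl, fun _ => rfl⟩

theorem equivFn_symm {f g : BW 9 → BW 2} (h : EquivFn f g) : EquivFn g f := by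
  obtain ⟨α, β, hα, h⟩ := h
  refine ⟨α.symm, β.symm, fun x y => ?_, fun x => ?_⟩
  · have := hα (α.symm x) (α.symm y)
    simpa using this.symm
  · simp [h]

theorem equivFn_trans {f g k : BW 9 → BW 2} (h : EquivFn f g) (h' : EquivFn g k) :
    EquivFn f k := by
  obtain ⟨α, β, hα, h⟩ := h
  obtain ⟨α', β', hα', h'⟩ := h'
  refine ⟨α.trans α', β'.trans β, fun x y => ?_, fun x => ?_⟩
  · exact (hα' _ _).trans (hα _ _)
  · simp [h, h']

/-- The equitable partition condition. -/
def Eq9 (f : BW 9 → BW 2) : Prop :=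
  ∀ x y, (Finset.univ.filter fun i => f (x + ev i) = y).card = if f x = y then 0 else 3

theorem eq9_equiv {f g : BW 9 → BW 2} (h : EquivFn f g) (hg : Eq9 g) : Eq9 f := by
  obtain ⟨α, β, hα, h⟩ := h
  obtain ⟨σ, hσ⟩ := cubeAut_spec hα
  intro x y
  have := hg (α x) (β.symm y)
  rw [h x]
  have e : (β (g (α x)) = y) = (g (α x) = β.symm y) := by
    rw [Equiv.eq_symm_apply]
  simp only [e]
  rw [← this]
  refine Finset.card_equiv σ fun i => ?_
  simp only [Finset.mem_filter, Finset.mem_univ, true_and]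
  rw [h, hσ, Equiv.eq_symm_apply]

/-- The standard automorphisms. -/
def stdAut (t : BW 9) (σ : Equiv.Perm (Fin 9)) : BW 9 ≃ BW 9 where
  toFun x := t + x ∘ σ.symm
  invFun x := (t + x) ∘ σ
  left_inv x := by
    funext i
    have := congrFun (bw_add_self t) (σ i)
    simp only [Pi.add_apply, Function.comp, Equiv.symm_apply_apply] at *
    rw [← add_assoc, this]
    simp
  right_inv x := by
    funext i
    have := congrFun (bw_add_self t) i
    simp only [Pi.add_apply, Function.comp, Equiv.apply_symm_apply] at *
    rw [← add_assoc, this]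
    simp

theorem stdAut_aut (t : BW 9) (σ : Equiv.Perm (Fin 9)) : IsCubeAut (stdAut t σ) := by
  intro x y
  unfold hAdj hammingDist
  have : (Finset.univ.filter fun i => stdAut t σ x i ≠ stdAut t σ y i).card =
      (Finset.univ.filter fun i => x i ≠ y i).card := by
    refine Finset.card_equiv σ.symm fun i => ?_
    simp [stdAut]
  rw [this]

/-! ### Coding -/

def enc {n : ℕ} (v : BW n) : ℕ := Nat.ofBits fun i => decide (v i = 1)

def dec (n x : ℕ) : BW n := fun i => if x.testBit i then 1 else 0

theorem enc_lt {n : ℕ} (v : BW n) : enc v < 2 ^ n := Nat.ofBits_lt_two_pow _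

theorem testBit_enc {n : ℕ} (v : BW n) (i : Fin n) : (enc v).testBit i = decide (v i = 1) := by
  unfold enc
  rw [Nat.testBit_ofBits_lt _ _ i.2]

theorem dec_enc {n : ℕ} (v : BW n) : dec n (enc v) = v := by
  funext i
  simp only [dec, testBit_enc]
  rcases zmod2_cases (v i) with h | h <;> simp [h]

theorem dec_inj {n x y : ℕ} (hx : x < 2 ^ n) (hy : y < 2 ^ n) (h : dec n x = dec n y) :
    x = y := by
  apply Nat.eq_of_testBit_eq
  intro i
  by_cases hi : i < n
  · have := congrFun h ⟨i, hi⟩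
    simp only [dec] at this
    cases h1 : x.testBit i <;> cases h2 : y.testBit i <;> simp_all
  · have h3 : 2 ^ n ≤ 2 ^ i := Nat.pow_le_pow_right (by norm_num) (by omega)
    rw [Nat.testBit_lt_two_pow (by omega), Nat.testBit_lt_two_pow (by omega)]

theorem enc_dec {n x : ℕ} (hx : x < 2 ^ n) : enc (dec n x) = x :=
  dec_inj (enc_lt _) hx (dec_enc _)

theorem dec_xor (n x y : ℕ) : dec n (x ^^^ y) = dec n x + dec n y := by
  funext i
  simp only [dec, Nat.testBit_xor, Pi.add_apply]
  cases x.testBit i <;> cases y.testBit i <;> decide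

theorem dec_two_pow (i : Fin 9) : dec 9 (2 ^ (i : ℕ)) = ev i := by
  funext j
  simp only [dec, Nat.testBit_two_pow, ev, Pi.single_apply, decide_eq_true_eq]
  by_cases h : j = i
  · simp [h]
  · have : (i : ℕ) ≠ j := fun e => h (Fin.ext e.symm)
    simp [h, this]

theorem dec_zero (n : ℕ) : dec n 0 = 0 := by
  funext j
  simp [dec]

end Res9

namespace Res9

/-- The coded version of a function. -/
def FN (f : BW 9 → BW 2) (x : ℕ) : ℕ := enc (f (dec 9 x))

theorem dec_FN (f : BW 9 → BW 2) (x : ℕ) : dec 2 (FN f x) = f (dec 9 x) := dec_enc _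

theorem FN_eq (f : BW 9 → BW 2) (x c : ℕ) (hc : c < 4) : FN f x = c ↔ f (dec 9 x) = dec 2 c := by
  constructor
  · rintro rfl; exact (dec_FN f x).symm
  · intro h
    unfold FN
    rw [h, enc_dec (by simpa using hc)]

theorem goodN {f : BW 9 → BW 2} (hf : Eq9 f) : GoodN (FN f) where
  lt x := enc_lt (f (dec 9 x))
  cnt x hx c hc := by
    have := hf (dec 9 x) (dec 2 c)
    simp only [FN_eq f x c hc]
    rw [← this]
    unfold cnt
    symm
    refine Finset.card_bij (fun i _ => (i : ℕ)) ?_ ?_ ?_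
    · intro i hi
      simp only [Finset.mem_filter, Finset.mem_univ, true_and] at hi
      simp only [Finset.mem_filter, Finset.mem_range, i.2, true_and, beq_iff_eq]
      rw [FN_eq f _ c hc, dec_xor, dec_two_pow, hi]
    · intro i _ j _ h
      exact Fin.ext h
    · intro i hi
      simp only [Finset.mem_filter, Finset.mem_range, beq_iff_eq] at hi
      obtain ⟨h1, h2⟩ := hi
      rw [FN_eq f _ c hc, dec_xor] at h2
      refine ⟨⟨i, h1⟩, ?_, rfl⟩
      have := dec_two_pow ⟨i, h1⟩
      simp only at this
      rw [this] at h2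
      simpa using h2

/-- The function with the given bit planes. -/
def rep (P : ℕ × ℕ) (v : BW 9) : BW 2 := fun j =>
  if (if j = 0 then P.1 else P.2).testBit (enc v) then 1 else 0

theorem isRep_eq {f : BW 9 → BW 2} {P : ℕ × ℕ} (h : IsRep (FN f) P) : f = rep P := by
  funext v j
  obtain ⟨h0, h1⟩ := h (enc v) (by simpa using enc_lt v)
  have e := congrFun (dec_FN f (enc v)) j
  rw [dec_enc] at e
  rw [← e]
  simp only [rep, dec]
  fin_cases j
  · change (if (FN f (enc v)).testBit 0 = true then (1 : ZMod 2) else 0) = _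
    rw [h0]
    rfl
  · change (if (FN f (enc v)).testBit 1 = true then (1 : ZMod 2) else 0) = _
    rw [h1]
    rfl

theorem dec_alpha (p : List ℕ) (x t : ℕ) : dec 9 (alpha p x t) = dec 9 t +
    ∑ i ∈ Finset.range p.length, if x.testBit i then dec 9 (2 ^ lkp p i) else 0 := by
  induction p generalizing x t with
  | nil => simp [alpha]
  | cons q p ih =>
    rw [alpha, ih, List.length_cons, Finset.sum_range_succ']
    have e1 : Nat.xor t (Nat.shiftLeft (Nat.mod x 2) q) = t ^^^ ((x % 2) <<< q) := rfl
    have e2 : dec 9 ((x % 2) <<< q) = if x.testBit 0 then dec 9 (2 ^ q) else 0 := by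
      rcases Nat.mod_two_eq_zero_or_one x with h | h
      · simp [h, dec_zero]
      · simp [h, Nat.shiftLeft_eq]
    rw [e1, dec_xor, e2]
    simp only [lkp_cons_succ, lkp_cons_zero, Nat.testBit_succ]
    have e3 : ∀ i, (Nat.div x 2).testBit i = (x / 2).testBit i := fun i => rfl
    simp only [e3]
    abel

theorem exists_perm {p : List ℕ} (hp : isPerm 9 p = true) :
    ∃ σ : Equiv.Perm (Fin 9), ∀ i : Fin 9, lkp p i = σ i := by
  have hs : Function.Surjective fun i : Fin 9 => (⟨lkp p i, isPerm_lkp_lt hp i.2⟩ : Fin 9) := by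
    intro j
    obtain ⟨i, hi, h⟩ := isPerm_surj hp j j.2
    exact ⟨⟨i, hi⟩, Fin.ext h⟩
  exact ⟨Equiv.ofBijective _ (Finite.surjective_iff_bijective.1 hs), fun i => rfl⟩

theorem exists_perm4 {b : List ℕ} (hb : isPerm 4 b = true) :
    ∃ β : BW 2 ≃ BW 2, ∀ y, enc (β y) = lkp b (enc y) := by
  have hlt : ∀ y : BW 2, lkp b (enc y) < 2 ^ 2 := fun y => isPerm_lkp_lt hb (enc_lt y)
  have hs : Function.Surjective fun y : BW 2 => dec 2 (lkp b (enc y)) := by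
    intro z
    obtain ⟨i, hi, h⟩ := isPerm_surj hb (enc z) (enc_lt z)
    refine ⟨dec 2 i, ?_⟩
    simp only
    rw [enc_dec (by simpa using hi), h, dec_enc]
  exact ⟨Equiv.ofBijective _ (Finite.surjective_iff_bijective.1 hs), fun y => enc_dec (hlt y)⟩

theorem dec_alpha_std {p : List ℕ} (hp : isPerm 9 p = true) {σ : Equiv.Perm (Fin 9)}
    (hσ : ∀ i : Fin 9, lkp p i = σ i) (x t : ℕ) :
    dec 9 (alpha p x t) = stdAut (dec 9 t) σ (dec 9 x) := by
  rw [dec_alpha, isPerm_len hp, Finset.sum_range]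
  change _ = dec 9 t + dec 9 x ∘ σ.symm
  congr 1
  funext j
  rw [Finset.sum_apply, Finset.sum_eq_single (σ.symm j)]
  · rw [hσ, dec_two_pow]
    simp only [Equiv.apply_symm_apply, Function.comp, dec]
    split_ifs <;> simp [ev]
  · intro i _ hi
    rw [hσ, dec_two_pow]
    have : j ≠ σ i := fun e => hi (by rw [e]; simp)
    split_ifs
    · simp [ev_app, this]
    · rfl
  · simp

theorem trans_equiv (f : BW 9 → BW 2) {t : ℕ} {p b : List ℕ} (hp : isPerm 9 p = true)
    (hb : isPerm 4 b = true) : ∃ g, EquivFn g f ∧ ∀ x, FN g x = trans (FN f) t p b x := by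
  obtain ⟨σ, hσ⟩ := exists_perm hp
  obtain ⟨β, hβ⟩ := exists_perm4 hb
  refine ⟨fun x => β (f (stdAut (dec 9 t) σ x)), ⟨stdAut (dec 9 t) σ, β, stdAut_aut _ _,
    fun _ => rfl⟩, fun x => ?_⟩
  unfold FN trans
  rw [hβ, ← dec_alpha_std hp hσ]

theorem exists_norm {f : BW 9 → BW 2} (hf : Eq9 f) : ∃ g, EquivFn g f ∧ NormN (FN g) := by
  have hcol : ∀ y : BW 2, (Finset.univ.filter fun i : Fin 9 => dec 2 (1 + (i : ℕ) / 3) = y).card =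
      if 0 = y then 0 else 3 := by decide
  have hfib : ∀ y : BW 2, Nonempty ({i : Fin 9 // dec 2 (1 + (i : ℕ) / 3) = y} ≃
      {i : Fin 9 // f (ev i) + f 0 = y}) := by
    intro y
    rw [← Fintype.card_eq, Fintype.card_subtype, Fintype.card_subtype, hcol]
    have h1 := hf 0 (y + f 0)
    have h2 : ∀ z, (z + f 0 = y) = (z = y + f 0) := fun z => by
      apply propext
      constructor
      · rintro rfl; rw [bw_add_cancel]
      · rintro rfl; rw [bw_add_cancel]
    have h3 : (f 0 = y + f 0) = (0 = y) := by simp [eq_comm]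
    simp only [zero_add, h3] at h1
    simp only [h2]
    exact h1.symm
  let σ : Equiv.Perm (Fin 9) := Equiv.ofFiberEquiv fun y => (hfib y).some
  have hσ : ∀ i : Fin 9, f (ev (σ i)) + f 0 = dec 2 (1 + (i : ℕ) / 3) := fun i =>
    Equiv.ofFiberEquiv_map (fun y => (hfib y).some) i
  have h0 : ∀ y : BW 2, y + f 0 + f 0 = y := fun y => bw_add_cancel _ _
  let β : BW 2 ≃ BW 2 := ⟨fun y => y + f 0, fun y => y + f 0, h0, h0⟩
  have hz : stdAut 0 σ 0 = 0 := by
    funext j; simp [stdAut]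
  have he : ∀ i, stdAut 0 σ (ev i) = ev (σ i) := by
    intro i
    funext j
    simp [stdAut, ev_app, Equiv.symm_apply_eq]
  refine ⟨fun x => β (f (stdAut 0 σ x)), ⟨stdAut 0 σ, β, stdAut_aut _ _, fun _ => rfl⟩, ?_, ?_⟩
  · rw [FN_eq _ _ _ (by norm_num), dec_zero, dec_zero, hz]
    exact bw_add_self _
  · intro i hi
    rw [FN_eq _ _ _ (by omega)]
    have := dec_two_pow ⟨i, hi⟩
    simp only at this
    rw [this, he]
    exact hσ ⟨i, hi⟩

theorem key_congr {F G : ℕ → ℕ} (l : List ℕ) (h : ∀ x, F x = G x) : key F l = key G l := by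
  rw [funext h]

theorem classify {f : BW 9 → BW 2} (hf : Eq9 f) :
    ∃ k < 10, EquivFn f (rep (lkp2 plane k)) := by
  obtain ⟨g0, hg0⟩ := exists_norm hf
  have hex : ∃ n, ∃ g, EquivFn g f ∧ NormN (FN g) ∧ key (FN g) keyL = n :=
    ⟨_, g0, hg0.1, hg0.2, rfl⟩
  classical
  obtain ⟨g, h1, h2, h3⟩ := Nat.find_spec hex
  have hmin : MinN (FN g) := by
    intro t ht p b hp hb hs hlt
    obtain ⟨k, hk, hkF⟩ := trans_equiv g (t := t) hp hb
    rw [← key_congr keyL hkF, h3] at hlt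
    refine Nat.find_min hex hlt ⟨k, equivFn_trans hk h1, ?_, rfl⟩
    have hN : ∀ x ∈ normL, FN k x = FN g x := fun x hx => (hkF x).trans (hs x hx)
    refine ⟨?_, fun i hi => ?_⟩
    · rw [hN 0 (by decide)]; exact h2.1
    · rw [hN]
      · exact h2.2 i hi
      · interval_cases i <;> decide
  obtain ⟨k, hk, hr⟩ := classN (goodN (eq9_equiv h1 hf)) hmin h2
  have := isRep_eq hr
  exact ⟨k, hk, this ▸ equivFn_symm h1⟩

end Res9

namespace Res9

theorem card_agree (K : Finset (Fin 9)) (a : BW 9) :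
    (Finset.univ.filter fun x : BW 9 => ∀ i ∈ K, x i = a i).card * 2 ^ K.card = 512 := by
  have e : (Finset.univ.filter fun x : BW 9 => ∀ i ∈ K, x i = a i) =
      Fintype.piFinset fun i => if i ∈ K then {a i} else Finset.univ := by
    ext x
    simp only [Finset.mem_filter, Finset.mem_univ, true_and, Fintype.mem_piFinset]
    refine forall_congr' fun i => ?_
    split_ifs with h <;> simp [h]
  rw [e, Fintype.card_piFinset]
  have e2 : ∀ i, (if i ∈ K then ({a i} : Finset (ZMod 2)) else Finset.univ).card =
      if i ∈ K then 1 else 2 := by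
    intro i
    split_ifs <;> simp [ZMod.card]
  simp only [e2]
  have e3 : (2 : ℕ) ^ K.card = ∏ i : Fin 9, if i ∈ K then 2 else 1 := by
    rw [Finset.prod_ite_mem]; simp
  rw [e3, ← Finset.prod_mul_distrib]
  have e4 : ∀ i : Fin 9, ((if i ∈ K then 1 else 2) * if i ∈ K then 2 else 1) = 2 := by
    intro i; split_ifs <;> rfl
  simp only [e4]
  simp

theorem sum_translate {M : Type} [AddCommMonoid M] (u : BW 9 → M) (t : BW 9) :
    ∑ x, u (x + t) = ∑ x, u x := Equiv.sum_comp (Equiv.addRight t) u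

theorem ncard_eq (f : BW 9 → BW 2) (y : BW 2) (K : Finset (Fin 9)) (a : BW 9) :
    {x | f x = y ∧ ∀ i ∈ K, x i = a i}.ncard =
      (Finset.univ.filter fun x => f x = y ∧ ∀ i ∈ K, x i = a i).card := by
  rw [← Set.ncard_coe_finset]
  congr 1
  ext x
  simp

theorem ncard_eq' (f : BW 9 → BW 2) (y : BW 2) :
    {x | f x = y}.ncard = (Finset.univ.filter fun x => f x = y).card := by
  rw [← Set.ncard_coe_finset]
  congr 1
  ext x
  simp

theorem eq9_subcube {f : BW 9 → BW 2} (hf : Eq9 f) (y : BW 2) (K : Finset (Fin 9))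
    (hK : K.card ≤ 5) (a : BW 9) :
    2 ^ K.card * (Finset.univ.filter fun x => f x = y ∧ ∀ i ∈ K, x i = a i).card = 128 := by
  let h : BW 9 → ℤ := fun x => if f x = y then 3 else -1
  have hA : ∀ x, ∑ i, h (x + ev i) = -3 * h x := by
    intro x
    have h1 := hf x y
    have h2 : ∀ i, h (x + ev i) = 4 * (if f (x + ev i) = y then 1 else 0) - 1 := by
      intro i
      simp only [h]
      split_ifs <;> norm_num
    simp only [h2]
    rw [Finset.sum_sub_distrib, ← Finset.mul_sum, Finset.sum_boole, h1]
    simp only [h]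
    split_ifs <;> simp
  let s : BW 9 → ℤ := fun a => ∑ x, if (∀ i ∈ K, x i = a i) then h x else 0
  have hs1 : ∀ a i, s (a + ev i) = ∑ x, if (∀ j ∈ K, x j = a j) then h (x + ev i) else 0 := by
    intro a i
    simp only [s]
    rw [← sum_translate _ (ev i)]
    refine Finset.sum_congr rfl fun x _ => ?_
    simp only [Pi.add_apply, add_left_inj]
  have hs2 : ∀ a, ∑ i, s (a + ev i) = -3 * s a := by
    intro a
    simp only [hs1]
    rw [Finset.sum_comm]
    simp only [s]
    rw [Finset.mul_sum]
    refine Finset.sum_congr rfl fun x _ => ?_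
    split_ifs
    · exact hA x
    · simp
  have hs3 : ∀ a, ∀ i ∉ K, s (a + ev i) = s a := by
    intro a i hi
    simp only [s]
    refine Finset.sum_congr rfl fun x _ => ?_
    have : ∀ j ∈ K, (a + ev i) j = a j := by
      intro j hj
      have : j ≠ i := fun e => hi (e ▸ hj)
      simp [ev_app, this]
    have e : (∀ j ∈ K, x j = (a + ev i) j) ↔ (∀ j ∈ K, x j = a j) :=
      forall₂_congr fun j hj => by rw [this j hj]
    simp only [e]
  have hs4 : ∀ a, ∑ i ∈ K, s (a + ev i) = -(12 - (K.card : ℤ)) * s a := by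
    intro a
    have h1 := hs2 a
    rw [← Finset.sum_add_sum_compl K] at h1
    rw [Finset.sum_congr (s₁ := Kᶜ) rfl
      (fun i hi => hs3 a i (by simpa using hi))] at h1
    rw [Finset.sum_const, Finset.card_compl, nsmul_eq_mul, Fintype.card_fin,
      Nat.cast_sub (by omega)] at h1
    push_cast at h1
    linarith
  obtain ⟨m, hm⟩ := Finite.exists_max fun a => |s a|
  have hz : s m = 0 := by
    have h1 : |∑ i ∈ K, s (m + ev i)| ≤ K.card * |s m| := by
      refine (Finset.abs_sum_le_sum_abs _ _).trans ?_
      refine (Finset.sum_le_card_nsmul _ _ |s m| fun i _ => hm _).trans ?_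
      simp
    have hk : (K.card : ℤ) ≤ 5 := by exact_mod_cast hK
    rw [hs4, abs_mul, abs_neg, abs_of_nonneg (by linarith : (0 : ℤ) ≤ 12 - K.card)] at h1
    have h2 := abs_nonneg (s m)
    have h3 : |s m| = 0 := by nlinarith
    exact abs_eq_zero.1 h3
  have hz' : s a = 0 := by
    have := hm a
    rw [hz, abs_zero] at this
    exact abs_eq_zero.1 (le_antisymm this (abs_nonneg _))
  have hcount : s a = 4 * ((Finset.univ.filter fun x => f x = y ∧ ∀ i ∈ K, x i = a i).card : ℤ) -
      (Finset.univ.filter fun x : BW 9 => ∀ i ∈ K, x i = a i).card := by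
    rw [Finset.card_filter, Finset.card_filter]
    push_cast
    rw [Finset.mul_sum, ← Finset.sum_sub_distrib]
    refine Finset.sum_congr rfl fun x _ => ?_
    simp only [h]
    by_cases h1 : f x = y <;> simp only [h1, if_true, if_false, true_and, false_and] <;>
      split_ifs <;> norm_num
  have hc := card_agree K a
  rw [hz'] at hcount
  have : (Finset.univ.filter fun x : BW 9 => ∀ i ∈ K, x i = a i).card =
    4 * (Finset.univ.filter fun x => f x = y ∧ ∀ i ∈ K, x i = a i).card := by
    have : (0 : ℤ) = _ := hcount
    zify
    linarith
  rw [this] at hc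
  nlinarith

theorem resilient_of_eq9 {f : BW 9 → BW 2} (hf : Eq9 f) : Resilient f 5 := by
  have h0 : ∀ y, {x | f x = y}.ncard = 128 := by
    intro y
    have := eq9_subcube hf y ∅ (by simp) 0
    simp only [Finset.card_empty, pow_zero, one_mul, Finset.notMem_empty, false_imp_iff,
      implies_true, and_true] at this
    rw [ncard_eq']
    exact this
  refine ⟨fun y => by rw [h0]; norm_num, fun K hK a y => ?_⟩
  rw [h0, ncard_eq]
  exact eq9_subcube hf y K hK a

/-! ### Walsh transform -/

def sg (a : ZMod 2) : ℤ := if a = 0 then 1 else -1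

theorem sg_add : ∀ a b, sg (a + b) = sg a * sg b := by decide

def chi (S : Finset (Fin 9)) (x : BW 9) : ℤ := ∏ i ∈ S, sg (x i)

theorem chi_add (S : Finset (Fin 9)) (x y : BW 9) : chi S (x + y) = chi S x * chi S y := by
  simp [chi, sg_add, Finset.prod_mul_distrib]

theorem chi_ev (S : Finset (Fin 9)) (i : Fin 9) : chi S (ev i) = if i ∈ S then -1 else 1 := by
  unfold chi
  have : ∀ j, sg (ev i j) = if j = i then -1 else 1 := by
    intro j
    rw [ev_app]
    split_ifs <;> decide
  simp only [this]
  rw [Finset.prod_ite_eq']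

def hat (u : BW 9 → ℤ) (S : Finset (Fin 9)) : ℤ := ∑ x, u x * chi S x

theorem chi_orth (x y : BW 9) : ∑ S, chi S x * chi S y = if x = y then 512 else 0 := by
  simp only [← chi_add]
  have h : ∑ S, chi S (x + y) = ∏ i : Fin 9, (1 + sg ((x + y) i)) := by
    rw [Finset.prod_one_add]
    simp [chi, Finset.powerset_univ]
  rw [h]
  split_ifs with he
  · subst he
    rw [bw_add_self]
    simp [sg]
  · obtain ⟨i, hi⟩ := Function.ne_iff.1 he
    refine Finset.prod_eq_zero (Finset.mem_univ i) ?_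
    have : ∀ a b : ZMod 2, a ≠ b → 1 + sg (a + b) = 0 := by decide
    exact this _ _ hi

theorem hat_inv (u : BW 9 → ℤ) (y : BW 9) : ∑ S, hat u S * chi S y = 512 * u y := by
  simp only [hat, Finset.sum_mul]
  rw [Finset.sum_comm]
  simp only [mul_assoc, ← Finset.mul_sum, chi_orth]
  simp [mul_comm]

theorem hat_parseval (u v : BW 9 → ℤ) : ∑ S, hat u S * hat v S = 512 * ∑ x, u x * v x := by
  have : ∀ S, hat u S * hat v S = ∑ x, v x * (hat u S * chi S x) := by
    intro S
    conv_lhs => rw [hat.eq_def v, Finset.mul_sum]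
    refine Finset.sum_congr rfl fun x _ => by ring
  simp only [this]
  rw [Finset.sum_comm]
  simp only [← Finset.mul_sum, hat_inv]
  rw [Finset.mul_sum]
  refine Finset.sum_congr rfl fun x _ => by ring

theorem hat_adj (u : BW 9 → ℤ) (S : Finset (Fin 9)) :
    hat (fun x => ∑ i, u (x + ev i)) S = (9 - 2 * (S.card : ℤ)) * hat u S := by
  have h1 : hat (fun x => ∑ i, u (x + ev i)) S = ∑ i, ∑ x, u (x + ev i) * chi S x := by
    simp only [hat, Finset.sum_mul]
    rw [Finset.sum_comm]
  have h2 : ∀ i, ∑ x, u (x + ev i) * chi S x = (if i ∈ S then -1 else 1) * hat u S := by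
    intro i
    rw [← sum_translate _ (ev i), hat, Finset.mul_sum]
    refine Finset.sum_congr rfl fun x _ => ?_
    rw [bw_add_cancel, chi_add, chi_ev]
    ring
  rw [h1]
  simp only [h2]
  rw [← Finset.sum_mul]
  congr 1
  have h3 : ∀ i, (if i ∈ S then (-1 : ℤ) else 1) = 1 - 2 * (if i ∈ S then 1 else 0) := by
    intro i; split_ifs <;> norm_num
  simp only [h3]
  rw [Finset.sum_sub_distrib, ← Finset.mul_sum, Finset.sum_boole]
  simp

theorem chi_sum {S : Finset (Fin 9)} (hS : S ≠ ∅) : ∑ x, chi S x = 0 := by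
  obtain ⟨i, hi⟩ := Finset.nonempty_iff_ne_empty.2 hS
  have h := sum_translate (chi S) (ev i)
  simp only [chi_add, chi_ev, hi, if_true] at h
  rw [← Finset.sum_mul] at h
  linarith

theorem hat_corr {f : BW 9 → BW 2} (hf : Resilient f 5) (y : BW 2) {S : Finset (Fin 9)}
    (hS : S ≠ ∅) (hS5 : S.card ≤ 5) : hat (fun x => if f x = y then 1 else 0) S = 0 := by
  set h : BW 9 → ℤ := fun x => if f x = y then 1 else 0 with hh
  have key : ∑ a : BW 9, ∑ x, (if ∀ i ∈ S, a i = x i then h x * chi S x else 0) = 0 ∧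
      ∑ a : BW 9, ∑ x, (if ∀ i ∈ S, a i = x i then h x * chi S x else 0) * 2 ^ S.card =
        512 * hat h S := by
    constructor
    · have h1 : ∀ a : BW 9, ∑ x, (if ∀ i ∈ S, a i = x i then h x * chi S x else 0) * 2 ^ S.card =
          chi S a * 128 := by
        intro a
        have h2 := hf.2 S hS5 a y
        rw [hf.1, ncard_eq] at h2
        have h3 : ∀ x, (if ∀ i ∈ S, a i = x i then h x * chi S x else 0) =
            chi S a * if f x = y ∧ ∀ i ∈ S, x i = a i then 1 else 0 := by
          intro x
          by_cases h4 : ∀ i ∈ S, a i = x i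
          · have h5 : chi S x = chi S a :=
              Finset.prod_congr rfl fun i hi => by rw [h4 i hi]
            have h6 : ∀ i ∈ S, x i = a i := fun i hi => (h4 i hi).symm
            rw [if_pos h4, h5, hh]
            by_cases h7 : f x = y
            · simp only [h7, if_true, true_and]
              rw [if_pos h6]
              ring
            · simp [h7]
          · have h6 : ¬ ∀ i ∈ S, x i = a i := fun h => h4 fun i hi => (h i hi).symm
            rw [if_neg h4, if_neg (fun h => h6 h.2), mul_zero]
        simp only [h3]
        rw [← Finset.sum_mul, ← Finset.mul_sum, Finset.sum_boole, mul_assoc]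
        congr 1
        rw [mul_comm]
        exact_mod_cast h2
      have h8 : (∑ a : BW 9, ∑ x, (if ∀ i ∈ S, a i = x i then h x * chi S x else 0)) *
          2 ^ S.card = 0 := by
        rw [Finset.sum_mul]
        simp only [Finset.sum_mul] at h1 ⊢
        simp only [h1]
        rw [← Finset.sum_mul, chi_sum hS, zero_mul]
      rcases mul_eq_zero.1 h8 with h9 | h9
      · exact h9
      · exact absurd h9 (by positivity)
    · rw [Finset.sum_comm, hat, Finset.mul_sum]
      refine Finset.sum_congr rfl fun x _ => ?_
      have h1 := card_agree S x
      rw [← Finset.sum_mul, ← Finset.sum_filter, Finset.sum_const, nsmul_eq_mul]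
      have h2 : ((Finset.univ.filter fun a : BW 9 => ∀ i ∈ S, a i = x i).card : ℤ) * 2 ^ S.card =
        512 := by exact_mod_cast h1
      rw [← h2]
      ring
  have h2 : (∑ a : BW 9, ∑ x, (if ∀ i ∈ S, a i = x i then h x * chi S x else 0)) *
      2 ^ S.card = 512 * hat h S := by
    rw [← key.2, Finset.sum_mul]
    simp only [Finset.sum_mul]
  rw [key.1, zero_mul] at h2
  linarith

theorem eq9_of_resilient {f : BW 9 → BW 2} (hf : Resilient f 5) : Eq9 f := by
  intro x0 y
  set h : BW 9 → ℤ := fun x => if f x = y then 1 else 0 with hh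
  have h01 : ∀ x, h x = 0 ∨ h x = 1 := by
    intro x; simp only [hh]; split_ifs <;> simp
  let Ah : BW 9 → ℤ := fun x => ∑ i, h (x + ev i)
  let g : BW 9 → ℤ := fun x => Ah x + 3 * h x - 3
  have hA0 : ∀ x, 0 ≤ Ah x := fun x =>
    Finset.sum_nonneg fun i _ => by rcases h01 (x + ev i) with e | e <;> rw [e] <;> norm_num
  have hg : ∀ S, hat g S = (12 - 2 * (S.card : ℤ)) * hat h S - 3 * ∑ x, chi S x := by
    intro S
    have h1 : hat Ah S = _ := hat_adj h S
    have h2 : hat g S = hat Ah S + 3 * hat h S - 3 * ∑ x, chi S x := by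
      simp only [hat, g]
      rw [Finset.mul_sum, Finset.mul_sum, ← Finset.sum_add_distrib, ← Finset.sum_sub_distrib]
      refine Finset.sum_congr rfl fun x _ => by ring
    rw [h2, h1]
    ring
  have he : hat h ∅ = 128 := by
    have h1 := hf.1 y
    rw [ncard_eq'] at h1
    simp only [hat, chi, Finset.prod_empty, mul_one, hh]
    rw [Finset.sum_boole, h1]
    norm_num
  have hge : hat g ∅ = 0 := by
    rw [hg, he]
    simp [chi]
  have hgS : ∀ S, S ≠ ∅ → hat g S = (12 - 2 * (S.card : ℤ)) * hat h S := by
    intro S hS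
    rw [hg, chi_sum hS]
    ring
  have hterm : ∀ S ∈ (Finset.univ : Finset (Finset (Fin 9))), hat h S * hat g S ≤ 0 := by
    intro S _
    by_cases hS : S = ∅
    · rw [hS, hge, mul_zero]
    · by_cases h5 : S.card ≤ 5
      · rw [hat_corr hf y hS h5, zero_mul]
      · rw [hgS S hS]
        have : (6 : ℤ) ≤ S.card := by exact_mod_cast (by omega : 6 ≤ S.card)
        nlinarith [sq_nonneg (hat h S)]
  have hpos : 0 ≤ ∑ x, h x * g x := by
    refine Finset.sum_nonneg fun x _ => ?_
    have := hA0 x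
    rcases h01 x with e | e
    · rw [e]; norm_num
    · simp only [g, e]; linarith
  have hsum : ∑ S, hat h S * hat g S = 0 := by
    refine le_antisymm (Finset.sum_nonpos hterm) ?_
    rw [hat_parseval]
    positivity
  have hzero := (Finset.sum_eq_zero_iff_of_nonpos hterm).1 hsum
  have hgz : ∀ S, hat g S = 0 := by
    intro S
    by_cases hS : S = ∅
    · rw [hS, hge]
    · rcases mul_eq_zero.1 (hzero S (Finset.mem_univ S)) with e | e
      · rw [hgS S hS, e, mul_zero]
      · exact e
  have hg0 : g x0 = 0 := by
    have := hat_inv g x0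
    simp only [hgz, zero_mul, Finset.sum_const_zero] at this
    linarith
  have hcard : Ah x0 = ((Finset.univ.filter fun i => f (x0 + ev i) = y).card : ℤ) := by
    simp only [Ah, hh]
    rw [Finset.sum_boole]
  have : ((Finset.univ.filter fun i => f (x0 + ev i) = y).card : ℤ) = 3 - 3 * h x0 := by
    rw [← hcard]
    simp only [g] at hg0
    linarith
  simp only [hh] at this
  split_ifs at this ⊢ with h1
  · zify; linarith
  · zify; linarith

end Res9

namespace Res9

/-! ### Second derivatives -/

/-- Second derivative in the directions `i`, `j`. -/
def Dz {M : Type} [Add M] (f : BW 9 → M) (i j : Fin 9) (x : BW 9) : M :=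
  f x + f (x + ev i) + f (x + ev j) + f (x + ev i + ev j)

theorem sum4 : ∀ a b c d : BW 2, a + b + c + d = 0 ↔ (a = b ∧ c = d) ∨ (a = c ∧ b = d) ∨
    (a = d ∧ b = c) ∨ (a ≠ b ∧ a ≠ c ∧ a ≠ d ∧ b ≠ c ∧ b ≠ d ∧ c ≠ d) := by
  decide +kernel

theorem perm_affine (β : BW 2 ≃ BW 2) (a b c : BW 2) : β (a + b + c) = β a + β b + β c := by
  have h1 := (sum4 a b c (a + b + c)).1 (bw_add_self _)
  have h2 : β a + β b + β c + β (a + b + c) = 0 := by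
    rw [sum4]
    simpa only [ne_eq, β.injective.eq_iff] using h1
  have h3 := bw_add_cancel (β a + β b + β c) (β (a + b + c))
  rw [h2, zero_add] at h3
  exact h3

theorem equiv_Dz {f g : BW 9 → BW 2} (h : EquivFn f g) :
    ∃ (σ : Equiv.Perm (Fin 9)) (α : BW 9 ≃ BW 9) (L : BW 2 → BW 2), Function.Injective L ∧
      L 0 = 0 ∧ ∀ i j x, Dz f i j x = L (Dz g (σ i) (σ j) (α x)) := by
  obtain ⟨α, β, hα, h⟩ := h
  obtain ⟨σ, hσ⟩ := cubeAut_spec hα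
  refine ⟨σ, α, fun y => β y + β 0, ?_, bw_add_self _, ?_⟩
  · intro a b hab
    exact β.injective (add_right_cancel hab)
  · intro i j x
    simp only [Dz, h, hσ]
    generalize g (α x) = a
    generalize g (α x + ev (σ i)) = b
    generalize g (α x + ev (σ j)) = c
    generalize g (α x + ev (σ i) + ev (σ j)) = d
    have e : β (a + b + c + d + 0) = β (a + b + c) + β d + β 0 := perm_affine β _ _ _
    rw [add_zero, perm_affine β a b c] at e
    rw [e, bw_add_cancel]

/-- The invariant. -/
noncomputable def inv (f : BW 9 → BW 2) : ℕ := by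
  classical
  exact (Finset.univ.filter fun t : Fin 9 × Fin 9 × Fin 9 =>
    ∀ x, (Dz f t.1 t.2.1 x = 0 ↔ Dz f t.2.1 t.2.2 x = 0)).card

theorem inv_equiv {f g : BW 9 → BW 2} (h : EquivFn f g) : inv f = inv g := by
  obtain ⟨σ, α, L, hL, hL0, hD⟩ := equiv_Dz h
  have hz : ∀ i j x, Dz f i j x = 0 ↔ Dz g (σ i) (σ j) (α x) = 0 := by
    intro i j x
    rw [hD]
    constructor
    · intro e; exact hL (e.trans hL0.symm)
    · intro e; rw [e, hL0]
  unfold inv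
  refine Finset.card_equiv (σ.prodCongr (σ.prodCongr σ)) fun t => ?_
  simp only [Finset.mem_filter, Finset.mem_univ, true_and, hz, Equiv.prodCongr_apply, Prod.map]
  constructor
  · intro hx x
    simpa using hx (α.symm x)
  · intro hx x
    exact hx (α x)

/-! ### The representatives -/

def RN (P : ℕ × ℕ) (x : ℕ) : ℕ := (P.1.testBit x).toNat + 2 * (P.2.testBit x).toNat

theorem RN_lt (P : ℕ × ℕ) (x : ℕ) : RN P x < 4 := by
  unfold RN
  cases P.1.testBit x <;> cases P.2.testBit x <;> decide

theorem rep_dec (P : ℕ × ℕ) {x : ℕ} (hx : x < 512) : rep P (dec 9 x) = dec 2 (RN P x) := by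
  funext j
  unfold rep RN
  rw [enc_dec hx]
  fin_cases j
  · change (if P.1.testBit x = true then (1 : ZMod 2) else 0) = _
    cases P.1.testBit x <;> cases P.2.testBit x <;> decide
  · change (if P.2.testBit x = true then (1 : ZMod 2) else 0) = _
    cases P.1.testBit x <;> cases P.2.testBit x <;> decide

theorem dec2_eq {a b : ℕ} (ha : a < 4) (hb : b < 4) : dec 2 a = dec 2 b ↔ a = b :=
  ⟨fun h => dec_inj (by simpa using ha) (by simpa using hb) h, fun h => h ▸ rfl⟩

def cn (d : ℕ → Bool) (x : ℕ) : ℕ → ℕ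
  | 0 => 0
  | n + 1 => cn d x n + (d (x ^^^ 2 ^ n)).toNat

theorem cn_eq (d : ℕ → Bool) (x n : ℕ) : cn d x n = cnt d x n := by
  induction n with
  | zero => simp [cn, cnt]
  | succ n ih => rw [cn, cnt_succ, ih]

theorem rep_cn : ∀ k < 10, ∀ x < 512, ∀ c < 4,
    cn (fun y => Nat.beq (RN (lkp2 plane k) y) c) x 9 =
      if RN (lkp2 plane k) x = c then 0 else 3 := by
  decide +kernel

theorem exists_dec {n : ℕ} (v : BW n) : ∃ x < 2 ^ n, v = dec n x :=
  ⟨enc v, enc_lt v, (dec_enc v).symm⟩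

theorem rep_eq9 {k : ℕ} (hk : k < 10) : Eq9 (rep (lkp2 plane k)) := by
  intro x y
  obtain ⟨x, hx, rfl⟩ := exists_dec x
  obtain ⟨c, hc, rfl⟩ := exists_dec y
  have hx' : x < 512 := hx
  have hc' : c < 4 := hc
  have h := rep_cn k hk x hx' c hc'
  rw [cn_eq] at h
  generalize lkp2 plane k = P at h ⊢
  simp only [rep_dec P hx', dec2_eq (RN_lt P x) hc']
  rw [← h]
  unfold cnt
  refine Finset.card_bij (fun i _ => (i : ℕ)) ?_ ?_ ?_
  · intro i hi
    simp only [Finset.mem_filter, Finset.mem_univ, true_and] at hi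
    simp only [Finset.mem_filter, Finset.mem_range, i.2, true_and]
    rw [← dec_two_pow, ← dec_xor, rep_dec P (dir_facts i i.2 x hx').2.2.2,
      dec2_eq (RN_lt _ _) hc'] at hi
    rw [hi]
    exact Nat.beq_refl _
  · intro i _ j _ h
    exact Fin.ext h
  · intro i hi
    simp only [Finset.mem_filter, Finset.mem_range] at hi
    obtain ⟨h1, h2⟩ := hi
    refine ⟨⟨i, h1⟩, ?_, rfl⟩
    have e := dec_two_pow ⟨i, h1⟩
    simp only at e
    simp only [Finset.mem_filter, Finset.mem_univ, true_and]
    rw [← e, ← dec_xor, rep_dec P (dir_facts i h1 x hx').2.2.2, dec2_eq (RN_lt _ _) hc']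
    exact Nat.eq_of_beq_eq_true h2

def d2 (q i j : ℕ) : ℕ :=
  force (sh q (2 ^ i) (lowMask i)) fun s =>
    Nat.xor (Nat.xor (Nat.xor q s) (sh q (2 ^ j) (lowMask j))) (sh s (2 ^ j) (lowMask j))

def dm (P : ℕ × ℕ) (i j : ℕ) : ℕ := Nat.mod (Nat.lor (d2 P.1 i j) (d2 P.2 i j)) (2 ^ 512)

theorem testBit_d2 (q : ℕ) {i j x : ℕ} (hi : i < 9) (hj : j < 9) (hx : x < 512) :
    (d2 q i j).testBit x = ((((q.testBit x ^^ q.testBit (x ^^^ 2 ^ i)) ^^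
      q.testBit (x ^^^ 2 ^ j))) ^^ q.testBit (x ^^^ 2 ^ i ^^^ 2 ^ j)) := by
  unfold d2
  rw [force_eq]
  have e : ∀ a b : ℕ, Nat.xor a b = a ^^^ b := fun _ _ => rfl
  simp only [e, Nat.testBit_xor]
  rw [testBit_sh q i x hi hx, testBit_sh q j x hj hx, testBit_sh _ j x hj hx,
    testBit_sh q i _ hi (dir_facts j hj x hx).2.2.2, Nat.xor_right_comm]

def Dn (P : ℕ × ℕ) (i j x : ℕ) : ℕ :=
  RN P x ^^^ RN P (x ^^^ 2 ^ i) ^^^ RN P (x ^^^ 2 ^ j) ^^^ RN P (x ^^^ 2 ^ i ^^^ 2 ^ j)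

theorem Dn_lt (P : ℕ × ℕ) (i j x : ℕ) : Dn P i j x < 4 := by
  have h := RN_lt P
  have hx : ∀ a b : ℕ, a < 4 → b < 4 → a ^^^ b < 4 := fun a b ha hb =>
    Nat.xor_lt_two_pow (n := 2) ha hb
  exact hx _ _ (hx _ _ (hx _ _ (h _) (h _)) (h _)) (h _)

theorem Dz_rep (P : ℕ × ℕ) (i j : Fin 9) {x : ℕ} (hx : x < 512) :
    Dz (rep P) i j (dec 9 x) = dec 2 (Dn P i j x) := by
  have h1 := (dir_facts i i.2 x hx).2.2.2
  have h2 := (dir_facts j j.2 x hx).2.2.2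
  have h3 := (dir_facts j j.2 _ h1).2.2.2
  unfold Dz Dn
  simp only [← dec_two_pow, ← dec_xor]
  rw [rep_dec P hx, rep_dec P h1, rep_dec P h2, rep_dec P h3]
  simp only [← dec_xor]

theorem dm_zero (P : ℕ × ℕ) {i j x : ℕ} (hi : i < 9) (hj : j < 9) (hx : x < 512) :
    Dn P i j x = 0 ↔ (dm P i j).testBit x = false := by
  have e : dm P i j = (Nat.lor (d2 P.1 i j) (d2 P.2 i j)) % 2 ^ 512 := rfl
  rw [e, Nat.testBit_mod_two_pow, testBit_lor, testBit_d2 _ hi hj hx, testBit_d2 _ hi hj hx]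
  unfold Dn RN
  generalize P.1.testBit x = a1, P.1.testBit (x ^^^ 2 ^ i) = a2, P.1.testBit (x ^^^ 2 ^ j) = a3,
    P.1.testBit (x ^^^ 2 ^ i ^^^ 2 ^ j) = a4, P.2.testBit x = b1, P.2.testBit (x ^^^ 2 ^ i) = b2,
    P.2.testBit (x ^^^ 2 ^ j) = b3, P.2.testBit (x ^^^ 2 ^ i ^^^ 2 ^ j) = b4
  have : ∀ a1 a2 a3 a4 b1 b2 b3 b4 : Bool,
      (a1.toNat + 2 * b1.toNat) ^^^ (a2.toNat + 2 * b2.toNat) ^^^ (a3.toNat + 2 * b3.toNat) ^^^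
        (a4.toNat + 2 * b4.toNat) = 0 ↔
      ((a1 ^^ a2 ^^ a3 ^^ a4) || (b1 ^^ b2 ^^ b3 ^^ b4)) = false := by decide +kernel
  rw [this]
  simp [hx]

def invN (P : ℕ × ℕ) : ℕ := ∑ i ∈ Finset.range 9, ∑ j ∈ Finset.range 9, ∑ k ∈ Finset.range 9,
  if dm P i j = dm P j k then 1 else 0

theorem inv_rep (P : ℕ × ℕ) : inv (rep P) = invN P := by
  classical
  have h : ∀ i j k : Fin 9, (∀ x, (Dz (rep P) i j x = 0 ↔ Dz (rep P) j k x = 0)) ↔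
      dm P i j = dm P j k := by
    intro i j k
    have h1 : ∀ i j : Fin 9, ∀ x < 512, (Dz (rep P) i j (dec 9 x) = 0 ↔
        (dm P i j).testBit x = false) := by
      intro i j x hx
      rw [Dz_rep P i j hx, ← dec_zero 2, dec2_eq (Dn_lt _ _ _ _) (by norm_num),
        dm_zero P i.2 j.2 hx]
    constructor
    · intro h2
      apply Nat.eq_of_testBit_eq
      intro x
      by_cases hx : x < 512
      · have := h2 (dec 9 x)
        rw [h1 i j x hx, h1 j k x hx] at this
        rw [Bool.eq_iff_iff, ← not_iff_not]
        simpa using this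
      · have e : ∀ i j : ℕ, (dm P i j).testBit x = false := by
          intro i j
          have e : dm P i j = (Nat.lor (d2 P.1 i j) (d2 P.2 i j)) % 2 ^ 512 := rfl
          rw [e, Nat.testBit_mod_two_pow]
          simp [hx]
        rw [e, e]
    · intro h2 x
      obtain ⟨x, hx, rfl⟩ := exists_dec x
      rw [h1 i j x hx, h1 j k x hx, h2]
  unfold inv invN
  simp only [h]
  rw [Finset.card_filter, Fintype.sum_prod_type, Finset.sum_range]
  refine Finset.sum_congr rfl fun i _ => ?_
  rw [Fintype.sum_prod_type, Finset.sum_range]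
  refine Finset.sum_congr rfl fun j _ => ?_
  rw [Finset.sum_range]

theorem invN_val : ∀ k < 10, invN (lkp2 plane k) =
    lkp [441, 489, 401, 369, 393, 433, 353, 537, 617, 729] k := by
  decide +kernel

theorem rep_inj {k l : ℕ} (hk : k < 10) (hl : l < 10)
    (h : EquivFn (rep (lkp2 plane k)) (rep (lkp2 plane l))) : k = l := by
  have h1 := inv_equiv h
  rw [inv_rep, inv_rep, invN_val k hk, invN_val l hl] at h1
  have : ∀ k < 10, ∀ l < 10, lkp [441, 489, 401, 369, 393, 433, 353, 537, 617, 729] k =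
    lkp [441, 489, 401, 369, 393, 433, 353, 537, 617, 729] l → k = l := by decide
  exact this k hk l hl h1

end Res9

namespace Res9

theorem char2_eq {M : Type} [AddCommGroup M] (hM : ∀ a : M, a + a = 0) {a b : M}
    (h : a + b = 0) : a = b := by
  have := hM b
  exact add_right_cancel (h.trans this.symm)

/-- Functions with vanishing second derivatives are affine. -/
theorem affine_of_Dz {M : Type} [AddCommGroup M] (hM : ∀ a : M, a + a = 0) {G : BW 9 → M}
    (h : ∀ i j x, Dz G i j x = 0) (x y : BW 9) : G (x + y) = G x + G y + G 0 := by
  have h1 : ∀ x, ∀ i, G x + G (x + ev i) = G 0 + G (ev i) := by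
    refine bw_induction ?_ ?_
    · intro i; rw [zero_add]
    · intro x j ih i
      rw [← ih i]
      symm
      apply char2_eq hM
      have := h i j x
      unfold Dz at this
      rw [← this, add_right_comm x (ev i)]
      abel
  have h2 : ∀ x i, G (x + ev i) = G x + (G 0 + G (ev i)) := by
    intro x i
    rw [← h1 x i, ← add_assoc, hM, zero_add]
  revert x
  refine bw_induction (P := fun y => ∀ x, G (x + y) = G x + G y + G 0) ?_ ?_ y
  · intro x; rw [add_zero, add_assoc, hM, add_zero]
  · intro y i ih x
    rw [← add_assoc, h2, h2 y, ih]
    abel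

theorem append_add (x x' : BW 9) (y y' : BW 2) :
    (Fin.append (x + x') (y + y') : BW (9 + 2)) = Fin.append x y + Fin.append x' y' := by
  funext i
  refine Fin.addCases (fun i => ?_) (fun i => ?_) i <;> simp

/-- The direction of the affine span of the graph. -/
noncomputable def V (f : BW 9 → BW 2) : Submodule (ZMod 2) (BW (9 + 2)) :=
  (affineSpan (ZMod 2) (graphOf f)).direction

theorem affRank_eq (f : BW 9 → BW 2) :
    affRank (graphOf f) = Module.finrank (ZMod 2) (V f) := rfl

theorem V_eq (f : BW 9 → BW 2) : V f = vectorSpan (ZMod 2) (graphOf f) :=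
  direction_affineSpan _ _

theorem bw_sub {n : ℕ} (x y : BW n) : x - y = x + y := by
  rw [sub_eq_iff_eq_add, bw_add_cancel]

theorem add_mem_V (f : BW 9 → BW 2) (x y : BW 9) :
    (Fin.append (x + y) (f x + f y) : BW (9 + 2)) ∈ V f := by
  rw [append_add, ← bw_sub, V_eq]
  exact vsub_mem_vectorSpan (ZMod 2) ⟨x, rfl⟩ ⟨y, rfl⟩

theorem Dz_mem_V (f : BW 9 → BW 2) (i j : Fin 9) (x : BW 9) :
    (Fin.append (0 : BW 9) (Dz f i j x) : BW (9 + 2)) ∈ V f := by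
  have h := (V f).add_mem (add_mem_V f x (x + ev i)) (add_mem_V f (x + ev j) (x + ev i + ev j))
  rw [← append_add] at h
  have e : x + (x + ev i) + (x + ev j + (x + ev i + ev j)) = 0 := by
    have e1 : x + (x + ev i) + (x + ev j + (x + ev i + ev j)) =
      (x + x) + (x + x) + (ev i + ev i) + (ev j + ev j) := by abel
    rw [e1]
    simp [bw_add_self]
  rw [e] at h
  unfold Dz
  rw [add_assoc (f x + f (x + ev i))]
  exact h

/-- The projection on the first nine coordinates. -/
def pr : BW (9 + 2) →ₗ[ZMod 2] BW 9 where
  toFun z := fun i => z (Fin.castAdd 2 i)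
  map_add' _ _ := rfl
  map_smul' _ _ := rfl

theorem pr_append (x : BW 9) (y : BW 2) : pr (Fin.append x y) = x := by
  funext i
  simp [pr]

theorem pr_surj (f : BW 9 → BW 2) : Function.Surjective (pr.domRestrict (V f)) := by
  intro x
  refine ⟨⟨_, add_mem_V f x 0⟩, ?_⟩
  simp [LinearMap.domRestrict_apply, pr_append]

theorem rank_ge (f : BW 9 → BW 2) : 9 ≤ Module.finrank (ZMod 2) (V f) := by
  have := LinearMap.finrank_le_finrank_of_surjective (pr_surj f)
  simpa using this

theorem rank_ne_nine {f : BW 9 → BW 2} {i j : Fin 9} {x : BW 9} (h : Dz f i j x ≠ 0) :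
    affRank (graphOf f) ≠ 9 := by
  rw [affRank_eq]
  intro hr
  have hinj : Function.Injective (pr.domRestrict (V f)) := by
    rw [LinearMap.injective_iff_surjective_of_finrank_eq_finrank]
    · exact pr_surj f
    · rw [hr]; simp
  have h1 : (⟨_, Dz_mem_V f i j x⟩ : V f) = 0 := by
    apply hinj
    simp [LinearMap.domRestrict_apply, pr_append]
  have h2 := congrArg Subtype.val h1
  simp only [ZeroMemClass.coe_zero] at h2
  apply h
  funext k
  have := congrFun h2 (Fin.natAdd 9 k)
  simpa using this

theorem rank_nine {f : BW 9 → BW 2} (h : ∀ i j x, Dz f i j x = 0) :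
    affRank (graphOf f) = 9 := by
  rw [affRank_eq]
  refine le_antisymm ?_ (rank_ge f)
  have ha := affine_of_Dz (fun a => bw_add_self a) h
  let L0 : BW 9 →+ BW (9 + 2) := AddMonoidHom.mk' (fun x => Fin.append x (f x + f 0)) (by
    intro x y
    rw [← append_add, ha]
    congr 1
    abel)
  let L := AddMonoidHom.toZModLinearMap 2 L0
  have hV : V f ≤ LinearMap.range L := by
    rw [V_eq, vectorSpan_def, Submodule.span_le]
    rintro _ ⟨_, ⟨x, rfl⟩, _, ⟨y, rfl⟩, rfl⟩
    refine ⟨x + y, ?_⟩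
    change (Fin.append (x + y) (f (x + y) + f 0) : BW (9 + 2)) = Fin.append x (f x) - Fin.append y (f y)
    rw [ha, bw_add_cancel, append_add, bw_sub]
  refine (Submodule.finrank_mono hV).trans ((LinearMap.finrank_range_le L).trans ?_)
  simp

theorem rank_eleven {f : BW 9 → BW 2} {i j i' j' : Fin 9} {x x' : BW 9}
    (h1 : Dz f i j x ≠ 0) (h2 : Dz f i' j' x' ≠ 0) (h3 : Dz f i j x ≠ Dz f i' j' x') :
    affRank (graphOf f) = 11 := by
  have hy : ∀ y : BW 2, (Fin.append (0 : BW 9) y : BW (9 + 2)) ∈ V f := by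
    intro y
    have m1 := Dz_mem_V f i j x
    have m2 := Dz_mem_V f i' j' x'
    have m3 := (V f).add_mem m1 m2
    rw [← append_add, add_zero] at m3
    have m0 : (Fin.append (0 : BW 9) (0 : BW 2) : BW (9 + 2)) ∈ V f := by
      have := add_mem_V f 0 0
      rwa [bw_add_self, bw_add_self] at this
    generalize Dz f i j x = a at *
    generalize Dz f i' j' x' = b at *
    have key : ∀ a b y : BW 2, a = 0 ∨ b = 0 ∨ a = b ∨ y = 0 ∨ y = a ∨ y = b ∨ y = a + b := by
      decide +kernel
    rcases key a b y with e | e | e | rfl | rfl | rfl | rfl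
    · exact absurd e h1
    · exact absurd e h2
    · exact absurd e h3
    all_goals assumption
  have ht : V f = ⊤ := by
    rw [eq_top_iff]
    intro z _
    have e : z = Fin.append (pr z) (fun k => z (Fin.natAdd 9 k)) := by
      funext k
      refine Fin.addCases (fun k => ?_) (fun k => ?_) k <;> simp [pr]
    have m := (V f).add_mem (add_mem_V f (pr z) 0)
      (hy (f (pr z) + f 0 + fun k => z (Fin.natAdd 9 k)))
    rw [← append_add, add_zero, add_zero, ← add_assoc, bw_add_self, zero_add, ← e] at m
    exact m
  rw [affRank_eq, ht, finrank_top]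
  simp

theorem rank_ne_eleven {f : BW 9 → BW 2} {w : BW 2} (hw : w ≠ 0)
    (h : ∀ i j x, w 0 * Dz f i j x 0 + w 1 * Dz f i j x 1 = 0) :
    affRank (graphOf f) ≠ 11 := by
  rw [affRank_eq]
  have h2 : ∀ a : ZMod 2, a + a = 0 := by decide
  let G : BW 9 → ZMod 2 := fun x => w 0 * f x 0 + w 1 * f x 1
  have hG : ∀ i j x, Dz G i j x = 0 := by
    intro i j x
    rw [← h i j x]
    simp only [Dz, G, Pi.add_apply]
    ring
  have ha := affine_of_Dz h2 hG
  let L0 : BW (9 + 2) →+ ZMod 2 := AddMonoidHom.mk' (fun z => G (pr z) + G 0 +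
      (w 0 * z (Fin.natAdd 9 0) + w 1 * z (Fin.natAdd 9 1))) (by
    intro x y
    simp only [map_add, ha, Pi.add_apply]
    have := h2 (G 0)
    ring_nf)
  let L := AddMonoidHom.toZModLinearMap 2 L0
  have hL : ∀ x y, L (Fin.append x y) = G x + G 0 + (w 0 * y 0 + w 1 * y 1) := by
    intro x y
    change G (pr (Fin.append x y)) + G 0 + _ = _
    rw [pr_append, Fin.append_right, Fin.append_right]
  have hV : V f ≤ LinearMap.ker L := by
    rw [V_eq, vectorSpan_def, Submodule.span_le]
    rintro _ ⟨_, ⟨x, rfl⟩, _, ⟨y, rfl⟩, rfl⟩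
    change L (Fin.append x (f x) - Fin.append y (f y)) = 0
    rw [map_sub, hL, hL]
    have e1 : G x + G 0 + (w 0 * f x 0 + w 1 * f x 1) = G 0 := by
      change G x + G 0 + G x = G 0
      rw [add_right_comm, h2, zero_add]
    have e2 : G y + G 0 + (w 0 * f y 0 + w 1 * f y 1) = G 0 := by
      change G y + G 0 + G y = G 0
      rw [add_right_comm, h2, zero_add]
    rw [e1, e2, sub_self]
  have hk : LinearMap.ker L ≠ ⊤ := by
    intro ht
    have : ∀ y : BW 2, w 0 * y 0 + w 1 * y 1 = 0 := by
      intro y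
      have h5 : Fin.append (0 : BW 9) y ∈ LinearMap.ker L := ht ▸ Submodule.mem_top
      have h6 := LinearMap.mem_ker.1 h5
      rw [hL, h2, zero_add] at h6
      exact h6
    have key : ∀ w : BW 2, w ≠ 0 → ∃ y : BW 2, w 0 * y 0 + w 1 * y 1 ≠ 0 := by decide +kernel
    obtain ⟨y, hy⟩ := key w hw
    exact hy (this y)
  have h7 := Submodule.finrank_lt hk
  have h8 := Submodule.finrank_mono hV
  have h9 : Module.finrank (ZMod 2) (BW (9 + 2)) = 11 := by simp
  omega

/-! ### Ranks of the representatives -/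

theorem rep9_zero : ∀ i < 9, ∀ j < 9, dm (lkp2 plane 9) i j = 0 := by
  decide +kernel

theorem rep9_Dz (i j : Fin 9) (x : BW 9) : Dz (rep (lkp2 plane 9)) i j x = 0 := by
  obtain ⟨x, hx, rfl⟩ := exists_dec x
  have h : Dn (lkp2 plane 9) i j x = 0 := by
    rw [dm_zero _ i.2 j.2 hx, rep9_zero i i.2 j j.2, Nat.zero_testBit]
  rw [Dz_rep _ i j hx, h, dec_zero]

theorem rep_nonzero : ∀ k < 9, ∃ i < 9, ∃ j < 9, ∃ x < 512, Dn (lkp2 plane k) i j x ≠ 0 := by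
  decide +kernel

theorem rep6_two : ∃ i < 9, ∃ j < 9, ∃ x < 512, Dn (lkp2 plane 6) i j x = 1 := by
  decide +kernel

theorem rep6_two' : ∃ i < 9, ∃ j < 9, ∃ x < 512, Dn (lkp2 plane 6) i j x = 2 := by
  decide +kernel

theorem rep_rank_nine {k : ℕ} (hk : k < 10) (h : affRank (graphOf (rep (lkp2 plane k))) = 9) :
    k = 9 := by
  by_contra hn
  obtain ⟨i, hi, j, hj, x, hx, hD⟩ := rep_nonzero k (by omega)
  refine rank_ne_nine (i := ⟨i, hi⟩) (j := ⟨j, hj⟩) (x := dec 9 x) ?_ h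
  rw [Dz_rep _ _ _ hx, ← dec_zero 2]
  exact fun e => hD ((dec2_eq (Dn_lt _ _ _ _) (by norm_num)).1 e)

def comb (v : ℕ) (P : ℕ × ℕ) : ℕ :=
  (bif v.testBit 0 then P.1 else 0) ^^^ (bif v.testBit 1 then P.2 else 0)

theorem rep_comb : ∀ k < 10, k ≠ 6 → ∃ v < 4, v ≠ 0 ∧ ∀ i < 9, ∀ j < 9,
    Nat.mod (d2 (comb v (lkp2 plane k)) i j) (2 ^ 512) = 0 := by
  decide +kernel

theorem bool_comb : ∀ v < 4, ∀ a1 a2 a3 a4 b1 b2 b3 b4 : Bool,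
    ((((v.testBit 0 && a1) ^^ (v.testBit 1 && b1)) ^^ ((v.testBit 0 && a2) ^^
      (v.testBit 1 && b2)) ^^ ((v.testBit 0 && a3) ^^ (v.testBit 1 && b3))) ^^
      ((v.testBit 0 && a4) ^^ (v.testBit 1 && b4))) = false →
    dec 2 v 0 * dec 2 ((a1.toNat + 2 * b1.toNat) ^^^ (a2.toNat + 2 * b2.toNat) ^^^
      (a3.toNat + 2 * b3.toNat) ^^^ (a4.toNat + 2 * b4.toNat)) 0 +
    dec 2 v 1 * dec 2 ((a1.toNat + 2 * b1.toNat) ^^^ (a2.toNat + 2 * b2.toNat) ^^^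
      (a3.toNat + 2 * b3.toNat) ^^^ (a4.toNat + 2 * b4.toNat)) 1 = 0 := by
  decide +kernel

theorem rep_rank_eleven {k : ℕ} (hk : k < 10)
    (h : affRank (graphOf (rep (lkp2 plane k))) = 11) : k = 6 := by
  by_contra hn
  obtain ⟨v, hv, hv0, hD⟩ := rep_comb k hk hn
  generalize lkp2 plane k = P at *
  refine rank_ne_eleven (w := dec 2 v) ?_ ?_ h
  · rw [← dec_zero 2]
    exact fun e => hv0 ((dec2_eq hv (by norm_num)).1 e)
  · intro i j x
    obtain ⟨x, hx, rfl⟩ := exists_dec x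
    have hx' : x < 512 := hx
    have h1 : (d2 (comb v P) i j).testBit x = false := by
      have h2 : (d2 (comb v P) i j) % 2 ^ 512 = 0 := hD i i.2 j j.2
      have h3 := Nat.testBit_mod_two_pow (d2 (comb v P) i j) 512 x
      rw [h2, Nat.zero_testBit] at h3
      simpa [hx'] using h3.symm
    rw [testBit_d2 _ i.2 j.2 hx] at h1
    have hc : ∀ y, (comb v P).testBit y =
        ((v.testBit 0 && P.1.testBit y) ^^ (v.testBit 1 && P.2.testBit y)) := by
      intro y
      unfold comb
      rw [Nat.testBit_xor]
      cases v.testBit 0 <;> cases v.testBit 1 <;> simp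
    simp only [hc] at h1
    rw [Dz_rep _ i j hx]
    unfold Dn RN
    revert h1
    generalize P.1.testBit x = a1, P.1.testBit (x ^^^ 2 ^ (i : ℕ)) = a2,
      P.1.testBit (x ^^^ 2 ^ (j : ℕ)) = a3, P.1.testBit (x ^^^ 2 ^ (i : ℕ) ^^^ 2 ^ (j : ℕ)) = a4,
      P.2.testBit x = b1, P.2.testBit (x ^^^ 2 ^ (i : ℕ)) = b2,
      P.2.testBit (x ^^^ 2 ^ (j : ℕ)) = b3, P.2.testBit (x ^^^ 2 ^ (i : ℕ) ^^^ 2 ^ (j : ℕ)) = b4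
    exact bool_comb v hv a1 a2 a3 a4 b1 b2 b3 b4

theorem equiv_rank_nine {f : BW 9 → BW 2} (h : EquivFn f (rep (lkp2 plane 9))) :
    affRank (graphOf f) = 9 := by
  obtain ⟨σ, α, L, hL, hL0, hD⟩ := equiv_Dz h
  refine rank_nine fun i j x => ?_
  rw [hD, rep9_Dz, hL0]

theorem equiv_rank_eleven {f : BW 9 → BW 2} (h : EquivFn f (rep (lkp2 plane 6))) :
    affRank (graphOf f) = 11 := by
  obtain ⟨σ, α, L, hL, hL0, hD⟩ := equiv_Dz h
  have hex : ∀ c < 4, (∃ i < 9, ∃ j < 9, ∃ x < 512, Dn (lkp2 plane 6) i j x = c) →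
      ∃ i j x, Dz f i j x = L (dec 2 c) := by
    rintro c hc ⟨i, hi, j, hj, x, hx, e⟩
    refine ⟨σ.symm ⟨i, hi⟩, σ.symm ⟨j, hj⟩, α.symm (dec 9 x), ?_⟩
    rw [hD]
    simp only [Equiv.apply_symm_apply]
    rw [Dz_rep _ _ _ hx, e]
  obtain ⟨i, j, x, h1⟩ := hex 1 (by norm_num) rep6_two
  obtain ⟨i', j', x', h2⟩ := hex 2 (by norm_num) rep6_two'
  refine rank_eleven (i := i) (j := j) (x := x) (i' := i') (j' := j') (x' := x') ?_ ?_ ?_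
  · rw [h1, ← hL0]; exact fun e => absurd (hL e) (by decide)
  · rw [h2, ← hL0]; exact fun e => absurd (hL e) (by decide)
  · rw [h1, h2]; exact fun e => absurd (hL e) (by decide)

end Res9

namespace Res9

abbrev RF := {f : BW 9 → BW 2 // Resilient f 5}

/-- The representatives as resilient functions. -/
def repR (k : Fin 10) : RF :=
  ⟨rep (lkp2 plane k), resilient_of_eq9 (rep_eq9 k.2)⟩

theorem mk_eq {f g : RF} :
    Quot.mk (fun f g : RF => EquivFn f.1 g.1) f = Quot.mk (fun f g : RF => EquivFn f.1 g.1) g ↔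
      EquivFn f.1 g.1 :=
  Equivalence.quot_mk_eq_iff (r := fun f g : RF => EquivFn f.1 g.1)
    ⟨fun f => equivFn_refl f.1, fun h => equivFn_symm h, fun h h' => equivFn_trans h h'⟩ f g

theorem quot_rep (q : Quot fun f g : RF => EquivFn f.1 g.1) :
    ∃ k : Fin 10, Quot.mk _ (repR k) = q := by
  induction q using Quot.ind with
  | _ f =>
    obtain ⟨k, hk, h⟩ := classify (eq9_of_resilient f.2)
    exact ⟨⟨k, hk⟩, mk_eq.2 (equivFn_symm h)⟩

end Res9

theorem stmt_1 :
    Nat.card (Quot fun f g : {f : BW 9 → BW 2 // Resilient f 5} => EquivFn f.1 g.1) = 10 ∧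
    (∃! q : Quot fun f g : {f : BW 9 → BW 2 // Resilient f 5} => EquivFn f.1 g.1,
      ∀ f : {f : BW 9 → BW 2 // Resilient f 5},
        Quot.mk (fun f g => EquivFn f.1 g.1) f = q → affRank (graphOf f.1) = 9) ∧
    (∃! q : Quot fun f g : {f : BW 9 → BW 2 // Resilient f 5} => EquivFn f.1 g.1,
      ∀ f : {f : BW 9 → BW 2 // Resilient f 5},
        Quot.mk (fun f g => EquivFn f.1 g.1) f = q → affRank (graphOf f.1) = 11) := by
  refine ⟨?_, ?_, ?_⟩
  · have hb : Function.Bijective fun k : Fin 10 =>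
        Quot.mk (fun f g : Res9.RF => EquivFn f.1 g.1) (Res9.repR k) := by
      refine ⟨fun k l h => ?_, Res9.quot_rep⟩
      exact Fin.ext (Res9.rep_inj k.2 l.2 (Res9.mk_eq.1 h))
    rw [← Nat.card_congr (Equiv.ofBijective _ hb)]
    simp
  · refine ⟨Quot.mk _ (Res9.repR 9), fun f hf => ?_, fun q hq => ?_⟩
    · exact Res9.equiv_rank_nine (Res9.mk_eq.1 hf)
    · obtain ⟨k, rfl⟩ := Res9.quot_rep q
      have h : (k : ℕ) = 9 := Res9.rep_rank_nine k.2 (hq (Res9.repR k) rfl)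
      have h' : k = 9 := Fin.ext h
      rw [h']
  · refine ⟨Quot.mk _ (Res9.repR 6), fun f hf => ?_, fun q hq => ?_⟩
    · exact Res9.equiv_rank_eleven (Res9.mk_eq.1 hf)
    · obtain ⟨k, rfl⟩ := Res9.quot_rep q
      have h : (k : ℕ) = 6 := Res9.rep_rank_eleven k.2 (hq (Res9.repR k) rfl)
      have h' : k = 6 := Fin.ext h
      rw [h']
end

section
/- Let n = 3r and let (C, C̄) be an equitable partition of Q_n with quotient matrix [[0, 3r], [r, 2r]]. Then the complement C̄ can be split into two sets C_1 and C_2 such that (C, C_1, C_2) is an equitable partition of Q_n with quotient matrix [[0, r, 2r], [r, 0, 2r], [r, r, r]]. -/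
theorem hAdj_add {n : ℕ} (e v w : BW n) : hAdj (v + e) (w + e) ↔ hAdj v w := by
  unfold hAdj
  simp [hammingDist]

theorem hAdj_single {n : ℕ} (i : Fin n) (v : BW n) : hAdj v (v + Pi.single i 1) := by
  unfold hAdj hammingDist
  rw [Finset.card_eq_one]
  refine ⟨i, ?_⟩
  ext j
  by_cases h : j = i
  · subst h; simp
  · simp [h]

theorem ncard_translate {n : ℕ} (C : Set (BW n)) (e v : BW n) (he : e + e = 0) :
    {w | w ∈ {x | x + e ∈ C} ∧ hAdj v w}.ncard = {w | w ∈ C ∧ hAdj (v + e) w}.ncard := by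
  have : {w | w ∈ C ∧ hAdj (v + e) w} =
      (fun x => x + e) '' {w | w ∈ {x | x + e ∈ C} ∧ hAdj v w} := by
    ext w
    constructor
    · rintro ⟨h1, h2⟩
      have hw : w + e + e = w := by rw [add_assoc, he, add_zero]
      refine ⟨w + e, ⟨?_, ?_⟩, hw⟩
      · simpa [hw] using h1
      · rw [← hAdj_add e, hw]; exact h2
    · rintro ⟨x, ⟨h1, h2⟩, rfl⟩
      exact ⟨h1, (hAdj_add e v x).2 h2⟩
  rw [this, Set.ncard_image_of_injective _ (add_left_injective e)]

theorem ncard_split {n : ℕ} (A B : Set (BW n)) (h : Disjoint A B) (v : BW n) :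
    {w | w ∈ A ∪ B ∧ hAdj v w}.ncard =
      {w | w ∈ A ∧ hAdj v w}.ncard + {w | w ∈ B ∧ hAdj v w}.ncard := by
  rw [← Set.ncard_union_eq _ (Set.toFinite _) (Set.toFinite _)]
  · congr 1
    ext w
    simp only [Set.mem_union, Set.mem_setOf_eq]
    tauto
  · rw [Set.disjoint_left] at h ⊢
    exact fun w h1 h2 => h h1.1 h2.1

theorem stmt_2 (n r : ℕ) (hn : n = 3 * r) (C : Set (BW n))
    (hC : IsEquitablePartition hAdj ![C, Cᶜ] ![![0, 3*r], ![r, 2*r]]) :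
    ∃ C1 C2 : Set (BW n),
      C1 ∪ C2 = Cᶜ ∧ Disjoint C1 C2 ∧
      IsEquitablePartition hAdj ![C, C1, C2]
        ![![0, r, 2*r], ![r, 0, 2*r], ![r, r, r]] := by
  obtain ⟨hne, -, hq⟩ := hC
  have h00 : ∀ v ∈ C, {w | w ∈ C ∧ hAdj v w}.ncard = 0 := fun v hv => hq 0 0 v hv
  have h01 : ∀ v ∈ C, {w | w ∈ Cᶜ ∧ hAdj v w}.ncard = 3 * r := fun v hv => hq 0 1 v hv
  have h10 : ∀ v ∈ Cᶜ, {w | w ∈ C ∧ hAdj v w}.ncard = r := fun v hv => hq 1 0 v hv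
  have h11 : ∀ v ∈ Cᶜ, {w | w ∈ Cᶜ ∧ hAdj v w}.ncard = 2 * r := fun v hv => hq 1 1 v hv
  obtain ⟨a, ha⟩ : C.Nonempty := hne 0
  obtain ⟨b, hb⟩ : (Cᶜ).Nonempty := hne 1
  have hr : 0 < r := by
    rcases Nat.eq_zero_or_pos r with h | h
    · exfalso
      have hn0 : n = 0 := by omega
      subst hn0
      exact hb (Subsingleton.elim a b ▸ ha)
    · exact h
  let i0 : Fin n := ⟨0, by omega⟩
  obtain ⟨e, hedef⟩ : ∃ e : BW n, e = Pi.single i0 1 := ⟨_, rfl⟩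
  have he : e + e = 0 := by
    ext j
    exact CharTwo.add_self_eq_zero (e j)
  have hadj : ∀ v, hAdj v (v + e) := fun v => hedef ▸ hAdj_single i0 v
  have hCe : ∀ v ∈ C, v + e ∉ C := by
    intro v hv hve
    have h := h00 v hv
    rw [Set.ncard_eq_zero (Set.toFinite _)] at h
    have : v + e ∈ {w | w ∈ C ∧ hAdj v w} := ⟨hve, hadj v⟩
    rw [h] at this
    exact this
  obtain ⟨C1, hC1⟩ : ∃ C1 : Set (BW n), C1 = {x | x + e ∈ C} := ⟨_, rfl⟩
  have hm1 : ∀ v, v ∈ C1 ↔ v + e ∈ C := fun v => by rw [hC1]; rfl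
  have hd : Disjoint C C1 := by
    rw [Set.disjoint_left]
    exact fun v h1 h2 => hCe v h1 ((hm1 v).1 h2)
  have hd' := Set.disjoint_left.1 hd
  obtain ⟨C2, hC2⟩ : ∃ C2 : Set (BW n), C2 = (C ∪ C1)ᶜ := ⟨_, rfl⟩
  have hm2 : ∀ v, v ∈ C2 ↔ v ∉ C ∧ v ∉ C1 := fun v => by rw [hC2]; simp
  have hd12 : Disjoint C1 C2 := Set.disjoint_left.2 fun v h1 h2 => ((hm2 v).1 h2).2 h1
  have hun : C1 ∪ C2 = Cᶜ := by
    ext v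
    have := @hd' v
    have := hm2 v
    simp only [Set.mem_union, Set.mem_compl_iff]
    tauto
  have k0 : ∀ v ∈ C1, {w | w ∈ C1 ∧ hAdj v w}.ncard = 0 := by
    intro v hv
    rw [hC1, ncard_translate C e v he]
    exact h00 _ ((hm1 v).1 hv)
  have k1 : ∀ v ∉ C1, {w | w ∈ C1 ∧ hAdj v w}.ncard = r := by
    intro v hv
    rw [hC1, ncard_translate C e v he]
    exact h10 _ (fun h => hv ((hm1 v).2 h))
  have hs : ∀ v, {w | w ∈ Cᶜ ∧ hAdj v w}.ncard =
      {w | w ∈ C1 ∧ hAdj v w}.ncard + {w | w ∈ C2 ∧ hAdj v w}.ncard := by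
    intro v
    rw [← hun]
    exact ncard_split C1 C2 hd12 v
  have m0 : ∀ v ∈ C, {w | w ∈ C2 ∧ hAdj v w}.ncard = 2 * r := by
    intro v hv
    have := hs v
    rw [h01 v hv, k1 v (hd' hv)] at this
    omega
  have m1 : ∀ v ∈ C1, {w | w ∈ C2 ∧ hAdj v w}.ncard = 2 * r := by
    intro v hv
    have := hs v
    rw [h11 v (fun h => hd' h hv), k0 v hv] at this
    omega
  have m2 : ∀ v ∈ C2, {w | w ∈ C2 ∧ hAdj v w}.ncard = r := by
    intro v hv
    have := hs v
    rw [h11 v ((hm2 v).1 hv).1, k1 v ((hm2 v).1 hv).2] at this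
    omega
  refine ⟨C1, C2, hun, hd12, ?_, ?_, ?_⟩
  · intro i
    fin_cases i
    · exact ⟨a, ha⟩
    · refine ⟨a + e, (hm1 _).2 ?_⟩
      rw [add_assoc, he, add_zero]; exact ha
    · have h := m0 a ha
      have hne2 : {w | w ∈ C2 ∧ hAdj a w}.Nonempty := by
        apply Set.nonempty_of_ncard_ne_zero
        omega
      obtain ⟨w, hw, -⟩ := hne2
      exact ⟨w, hw⟩
  · intro v
    have q1 := @hd' v
    have q2 := hm2 v
    by_cases c0 : v ∈ C
    · refine ⟨0, c0, ?_⟩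
      intro j hj
      fin_cases j
      · rfl
      · exact absurd hj (q1 c0)
      · exact absurd c0 (q2.1 hj).1
    · by_cases c1 : v ∈ C1
      · refine ⟨1, c1, ?_⟩
        intro j hj
        fin_cases j
        · exact absurd hj c0
        · rfl
        · exact absurd c1 (q2.1 hj).2
      · refine ⟨2, q2.2 ⟨c0, c1⟩, ?_⟩
        intro j hj
        fin_cases j
        · exact absurd hj c0
        · exact absurd hj c1
        · rfl
  · intro i j v hv
    fin_cases i
    · fin_cases j
      · exact h00 v hv
      · exact k1 v (hd' hv)
      · exact m0 v hv
    · fin_cases j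
      · exact h10 v (fun h => hd' h hv)
      · exact k0 v hv
      · exact m1 v hv
    · fin_cases j
      · exact h10 v ((hm2 v).1 hv).1
      · exact k1 v ((hm2 v).1 hv).2
      · exact m2 v hv
end

section
/- Let n = 3r and let (C, C̄) be an equitable partition of Q_n with quotient matrix [[0, 3r], [r, 2r]]. Set C_1 = C + e_n, the translate of C by the weight-one vector e_n = 0...01. Then C ∩ C_1 = ∅ and (C, C_1, C̄ \ C_1) is an equitable partition of Q_n with quotient matrix [[0, r, 2r], [r, 0, 2r], [r, r, r]]. -/
/-- The weight-one word `e_n = 0...01` (one in the last coordinate). -/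
def lastE (n : ℕ) : BW n := fun i => if (i : ℕ) = n - 1 then 1 else 0

theorem stmt_3 (n r : ℕ) (hn : n = 3 * r) (C : Set (BW n))
    (hC : IsEquitablePartition hAdj ![C, Cᶜ] ![![0, 3*r], ![r, 2*r]])
    (C1 : Set (BW n)) (hC1 : C1 = (fun c => c + lastE n) '' C) :
    C ∩ C1 = ∅ ∧
    IsEquitablePartition hAdj ![C, C1, Cᶜ \ C1]
      ![![0, r, 2*r], ![r, 0, 2*r], ![r, r, r]] := by
  classical
  obtain ⟨hne, -, hS⟩ := hC
  set e := lastE n with he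
  have hCC : ∀ v ∈ C, {w | w ∈ C ∧ hAdj v w}.ncard = 0 := fun v hv => by
    simpa using hS 0 0 v (by simpa using hv)
  have hCD : ∀ v ∈ C, {w | w ∈ Cᶜ ∧ hAdj v w}.ncard = 3 * r := fun v hv => by
    simpa using hS 0 1 v (by simpa using hv)
  have hDC : ∀ v, v ∉ C → {w | w ∈ C ∧ hAdj v w}.ncard = r := fun v hv => by
    simpa using hS 1 0 v (by simpa using hv)
  have hDD : ∀ v, v ∉ C → {w | w ∈ Cᶜ ∧ hAdj v w}.ncard = 2 * r := fun v hv => by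
    simpa using hS 1 1 v (by simpa using hv)
  have hne0 : C.Nonempty := by simpa using hne 0
  have hne1 : Cᶜ.Nonempty := by simpa using hne 1
  have hr : 0 < r := by
    rcases Nat.eq_zero_or_pos r with h | h
    · exfalso
      subst h
      obtain ⟨a, ha⟩ := hne0
      obtain ⟨b, hb⟩ := hne1
      apply hb
      have : b = a := by
        funext i
        exact absurd i.2 (by omega)
      rw [this]; exact ha
    · exact h
  have hee : e + e = 0 := by
    funext i
    exact CharTwo.add_self_eq_zero (e i)
  have hxee : ∀ x : BW n, x + e + e = x := fun x => by rw [add_assoc, hee, add_zero]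
  have hshift : ∀ x y : BW n, hAdj (x + e) (y + e) ↔ hAdj x y := fun x y => by
    simp [hAdj, hammingDist]
  have hadj : ∀ x : BW n, hAdj x (x + e) := fun x => by
    unfold hAdj hammingDist
    rw [Finset.card_eq_one]
    refine ⟨⟨n - 1, by omega⟩, ?_⟩
    ext i
    simp [he, lastE, Fin.ext_iff]
  have hmem : ∀ x, x ∈ C1 ↔ x + e ∈ C := fun x => by
    rw [hC1]
    constructor
    · rintro ⟨c, hc, rfl⟩
      simpa [hxee] using hc
    · intro h
      exact ⟨x + e, h, hxee x⟩
  have hdisj : ∀ x, x ∈ C → x ∉ C1 := fun x hx h => by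
    have h0 := hCC x hx
    rw [Set.ncard_eq_zero (Set.toFinite _)] at h0
    have : x + e ∈ {w | w ∈ C ∧ hAdj x w} := ⟨(hmem x).1 h, hadj x⟩
    rw [h0] at this
    exact this
  have hN1 : ∀ v, {w | w ∈ C1 ∧ hAdj v w}.ncard = {w | w ∈ C ∧ hAdj (v + e) w}.ncard := fun v => by
    rw [← Set.ncard_image_of_injective _ (add_left_injective e)]
    congr 1
    ext w
    constructor
    · rintro ⟨y, ⟨hy, hy2⟩, rfl⟩
      exact ⟨(hmem y).1 hy, (hshift v y).2 hy2⟩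
    · rintro ⟨h1, h2⟩
      refine ⟨w + e, ⟨(hmem _).2 (by rwa [hxee]), ?_⟩, hxee w⟩
      rw [← hshift, hxee]; exact h2
  have hN2 : ∀ v, {w | w ∈ Cᶜ \ C1 ∧ hAdj v w}.ncard + {w | w ∈ C1 ∧ hAdj v w}.ncard
      = {w | w ∈ Cᶜ ∧ hAdj v w}.ncard := fun v => by
    rw [← Set.ncard_union_eq _ (Set.toFinite _) (Set.toFinite _)]
    · congr 1
      ext w
      have := hdisj w
      simp only [Set.mem_union, Set.mem_setOf_eq, Set.mem_diff, Set.mem_compl_iff]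
      tauto
    · rw [Set.disjoint_left]
      rintro w ⟨⟨_, h⟩, _⟩ ⟨h', _⟩
      exact h h'
  have a01 : ∀ v ∈ C, {w | w ∈ C1 ∧ hAdj v w}.ncard = r := fun v hv => by
    rw [hN1]
    exact hDC _ (fun h => hdisj v hv ((hmem v).2 h))
  have a02 : ∀ v ∈ C, {w | w ∈ Cᶜ \ C1 ∧ hAdj v w}.ncard = 2 * r := fun v hv => by
    have := hN2 v
    rw [a01 v hv, hCD v hv] at this
    omega
  have b0 : ∀ v ∈ C1, v ∉ C := fun v hv h => hdisj v h hv
  have a11 : ∀ v ∈ C1, {w | w ∈ C1 ∧ hAdj v w}.ncard = 0 := fun v hv => by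
    rw [hN1]
    exact hCC _ ((hmem v).1 hv)
  have a12 : ∀ v ∈ C1, {w | w ∈ Cᶜ \ C1 ∧ hAdj v w}.ncard = 2 * r := fun v hv => by
    have := hN2 v
    rw [a11 v hv, hDD v (b0 v hv)] at this
    omega
  have a21 : ∀ v ∈ Cᶜ \ C1, {w | w ∈ C1 ∧ hAdj v w}.ncard = r := fun v hv => by
    rw [hN1]
    exact hDC _ (fun h => hv.2 ((hmem v).2 h))
  have a22 : ∀ v ∈ Cᶜ \ C1, {w | w ∈ Cᶜ \ C1 ∧ hAdj v w}.ncard = r := fun v hv => by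
    have := hN2 v
    rw [a21 v hv, hDD v hv.1] at this
    omega
  refine ⟨?_, ?_, ?_, ?_⟩
  · ext x
    simp only [Set.mem_inter_iff, Set.mem_empty_iff_false, iff_false, not_and]
    exact hdisj x
  · intro i
    obtain ⟨c, hc⟩ := hne0
    fin_cases i
    · exact ⟨c, hc⟩
    · exact ⟨c + e, (hmem _).2 (by rwa [hxee])⟩
    · have h2 := a02 c hc
      have : {w | w ∈ Cᶜ \ C1 ∧ hAdj c w}.Nonempty := by
        apply Set.nonempty_of_ncard_ne_zero
        omega
      obtain ⟨w, hw, _⟩ := this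
      exact ⟨w, hw⟩
  · intro v
    have hd := hdisj v
    by_cases h0 : v ∈ C
    · refine ⟨0, h0, ?_⟩
      intro j hj
      fin_cases j
      · rfl
      · exact absurd hj (hd h0)
      · exact absurd h0 hj.1
    · by_cases h1 : v ∈ C1
      · refine ⟨1, h1, ?_⟩
        intro j hj
        fin_cases j
        · exact absurd hj h0
        · rfl
        · exact absurd h1 hj.2
      · refine ⟨2, ⟨h0, h1⟩, ?_⟩
        intro j hj
        fin_cases j
        · exact absurd hj h0
        · exact absurd hj h1
        · rfl
  · intro i j v hv
    fin_cases i <;> fin_cases j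
    · exact hCC v hv
    · exact a01 v hv
    · exact a02 v hv
    · exact hDC v (b0 v hv)
    · exact a11 v hv
    · exact a12 v hv
    · exact hDC v hv.1
    · exact a21 v hv
    · exact a22 v hv
end

section
/- Let n = 3r and let (C_0, C_1, C_2, C_3) be an equitable partition of Q_n with quotient matrix [[0,r,r,r],[r,0,r,r],[r,r,0,r],[r,r,r,0]]. For i ∈ {0,1,2,3} let c_i ∈ F_2^3 be the 3-bit binary representation of i and set T_i = {c_i, c_i + 111} ⊆ F_2^3. Then the set C := ∪_{i=0}^{3} C_i × T_i ⊆ F_2^{n+3} satisfies C + 0^n111 = C, and (C, C̄) is an equitable partition of Q_{n+3} with quotient matrix [[0, 3(r+1)], [r+1, 2(r+1)]]. -/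
/-- The 3-bit binary representation of `i ∈ {0,1,2,3}`. -/
def bits3 : Fin 4 → BW 3 := ![![0,0,0], ![0,0,1], ![0,1,0], ![0,1,1]]

/-- `T_i = {c_i, c_i + 111} ⊆ F_2^3`. -/
def Tpair (i : Fin 4) : Set (BW 3) := {bits3 i, bits3 i + ![1,1,1]}

def cls4 (t : BW 3) : Fin 4 :=
  if t 0 = 0 then (if t 1 = 0 then (if t 2 = 0 then 0 else 1) else (if t 2 = 0 then 2 else 3))
  else (if t 1 = 0 then (if t 2 = 0 then 3 else 2) else (if t 2 = 0 then 1 else 0))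

lemma mem_Tpair (t : BW 3) (i : Fin 4) : t ∈ Tpair i ↔ cls4 t = i := by
  have : ∀ (t : BW 3) (i : Fin 4), (t = bits3 i ∨ t = bits3 i + ![1,1,1]) ↔ cls4 t = i := by
    decide +kernel
  exact this t i

lemma cls4_add (t : BW 3) : cls4 (t + ![1,1,1]) = cls4 t := by
  revert t; decide +kernel

lemma cls4_count (t : BW 3) (i : Fin 4) :
    {t' : BW 3 | cls4 t' = i ∧ hAdj t t'}.ncard = if i = cls4 t then 0 else 1 := by
  have h : ∀ (t : BW 3) (i : Fin 4),
      (Finset.univ.filter (fun t' : BW 3 => cls4 t' = i ∧ hammingDist t t' = 1)).card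
        = if i = cls4 t then 0 else 1 := by
    decide +kernel
  rw [← h t i, ← Set.ncard_coe_finset]
  congr 1
  ext t'
  simp [hAdj]

lemma hdist_append {n m : ℕ} (x y : BW n) (t s : BW m) :
    hammingDist (Fin.append x t) (Fin.append y s) = hammingDist x y + hammingDist t s := by
  simp [hammingDist, Finset.card_filter, Fin.sum_univ_add]

lemma append_inj4 {n m : ℕ} {x y : BW n} {t s : BW m}
    (h : Fin.append x t = Fin.append y s) : x = y ∧ t = s := by
  constructor
  · funext i
    simpa using congrFun h (Fin.castAdd m i)
  · funext i
    simpa using congrFun h (Fin.natAdd n i)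

lemma exists_append4 {n m : ℕ} (z : BW (n + m)) : ∃ x t, z = (Fin.append x t : BW (n + m)) :=
  ⟨fun i => z (Fin.castAdd m i), fun i => z (Fin.natAdd n i), by
    rw [Fin.append_castAdd_natAdd]⟩

lemma degree_BW {n : ℕ} (v : BW n) : {w : BW n | hAdj v w}.ncard = n := by
  have h2 : ∀ a b : ZMod 2, a ≠ b → b = a + 1 := by decide
  have h3 : ∀ a : ZMod 2, a ≠ a + 1 := by decide
  have e : {w : BW n | hAdj v w} = Set.range (fun i => Function.update v i (v i + 1)) := by
    ext w
    simp only [Set.mem_ofPred_eq, hAdj, hammingDist, Finset.card_eq_one, Set.mem_range]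
    constructor
    · rintro ⟨i, hi⟩
      refine ⟨i, ?_⟩
      have hh : ∀ j, v j ≠ w j ↔ j = i := by
        intro j
        have := Finset.ext_iff.mp hi j
        simpa using this
      funext j
      by_cases hj : j = i
      · subst hj
        simp [h2 _ _ ((hh j).2 rfl)]
      · have := (hh j).not.2 hj
        simpa [hj] using this
    · rintro ⟨i, rfl⟩
      refine ⟨i, ?_⟩
      ext j
      by_cases hj : j = i
      · subst hj
        simp
      · simp [hj]
  rw [e, ← Set.image_univ, Set.ncard_image_of_injective, Set.ncard_univ, Nat.card_fin]
  intro i j hij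
  by_contra hne
  have := congrFun hij i
  simp [hne] at this

theorem stmt_4 (n r : ℕ) (hn : n = 3 * r) (Cs : Fin 4 → Set (BW n))
    (hCs : IsEquitablePartition hAdj Cs (fun i j => if i = j then 0 else r))
    (C : Set (BW (n + 3)))
    (hC : C = {z | ∃ i : Fin 4, ∃ x ∈ Cs i, ∃ t ∈ Tpair i, z = Fin.append x t}) :
    (fun z => z + Fin.append (0 : BW n) ![1,1,1]) '' C = C ∧
    IsEquitablePartition hAdj ![C, Cᶜ] ![![0, 3*(r+1)], ![r+1, 2*(r+1)]] := by
  obtain ⟨hne, hpart, hcount⟩ := hCs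
  have memC : ∀ (x : BW n) (t : BW 3), Fin.append x t ∈ C ↔ x ∈ Cs (cls4 t) := by
    intro x t
    rw [hC]
    constructor
    · rintro ⟨i, y, hy, s, hs, h⟩
      obtain ⟨rfl, rfl⟩ := append_inj4 h
      rw [mem_Tpair] at hs
      rw [hs]; exact hy
    · intro h
      exact ⟨_, x, h, t, (mem_Tpair _ _).2 rfl, rfl⟩
  have addA : ∀ (x : BW n) (t : BW 3),
      Fin.append x t + Fin.append (0 : BW n) ![1,1,1] = Fin.append x (t + ![1,1,1]) := by
    intro x t
    funext k
    refine Fin.addCases (fun i => ?_) (fun i => ?_) k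
    · simp only [Pi.add_apply, Fin.append_left, Pi.zero_apply, add_zero]
    · simp only [Pi.add_apply, Fin.append_right]
  have uniq : ∀ x i j, x ∈ Cs i → x ∈ Cs j → i = j := fun x i j hi hj =>
    (hpart x).unique hi hj
  -- the number of neighbours in `C`
  have key : ∀ (x : BW n) (t : BW 3) (i : Fin 4), x ∈ Cs i →
      {w | w ∈ C ∧ hAdj (Fin.append x t) w}.ncard = if i = cls4 t then 0 else r + 1 := by
    intro x t i hx
    have e : {w | w ∈ C ∧ hAdj (Fin.append x t) w} =
        (fun y : BW n => (Fin.append y t : BW (n + 3))) '' {y | y ∈ Cs (cls4 t) ∧ hAdj x y} ∪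
        (fun s : BW 3 => (Fin.append x s : BW (n + 3))) '' {s | cls4 s = i ∧ hAdj t s} := by
      ext w
      obtain ⟨y, s, rfl⟩ := exists_append4 w
      simp only [Set.mem_ofPred_eq, Set.mem_union, Set.mem_image, memC, hAdj, hdist_append]
      constructor
      · rintro ⟨h1, h2⟩
        have : (hammingDist x y = 1 ∧ hammingDist t s = 0) ∨
          (hammingDist x y = 0 ∧ hammingDist t s = 1) := by omega
        rcases this with ⟨h3, h4⟩ | ⟨h3, h4⟩
        · obtain rfl := hammingDist_eq_zero.1 h4
          exact Or.inl ⟨y, ⟨h1, h3⟩, rfl⟩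
        · obtain rfl := hammingDist_eq_zero.1 h3
          exact Or.inr ⟨s, ⟨uniq _ _ _ h1 hx, h4⟩, rfl⟩
      · rintro (⟨y', ⟨h1, h2⟩, h⟩ | ⟨s', ⟨h1, h2⟩, h⟩)
        · obtain ⟨rfl, rfl⟩ := append_inj4 h
          exact ⟨h1, by simp [h2]⟩
        · obtain ⟨rfl, rfl⟩ := append_inj4 h
          exact ⟨by rw [h1]; exact hx, by simp [h2]⟩
    rw [e, Set.ncard_union_eq, Set.ncard_image_of_injective, Set.ncard_image_of_injective,
      hcount i _ x hx, cls4_count]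
    · beta_reduce
      split_ifs <;> rfl
    · intro a b h; exact (append_inj4 h).2
    · intro a b h; exact (append_inj4 h).1
    · rw [Set.disjoint_left]
      rintro _ ⟨y, ⟨_, h2⟩, rfl⟩ ⟨s, ⟨_, h4⟩, h⟩
      obtain ⟨rfl, rfl⟩ := append_inj4 h
      simp [hAdj] at h2
  have tot : ∀ v : BW (n + 3), {w | w ∈ C ∧ hAdj v w}.ncard + {w | w ∈ Cᶜ ∧ hAdj v w}.ncard
      = 3 * (r + 1) := by
    intro v
    rw [← Set.ncard_union_eq]
    · have : {w | w ∈ C ∧ hAdj v w} ∪ {w | w ∈ Cᶜ ∧ hAdj v w} = {w | hAdj v w} := by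
        ext w
        simp only [Set.mem_union, Set.mem_ofPred_eq, Set.mem_compl_iff]
        tauto
      rw [this, degree_BW, hn]
      ring
    · rw [Set.disjoint_left]
      rintro w ⟨h, _⟩ ⟨h', _⟩
      exact h' h
  have inC : ∀ v ∈ C, {w | w ∈ C ∧ hAdj v w}.ncard = 0 := by
    intro v hv
    obtain ⟨x, t, rfl⟩ := exists_append4 v
    rw [key x t _ ((memC _ _).1 hv), if_pos rfl]
  have outC : ∀ v ∈ Cᶜ, {w | w ∈ C ∧ hAdj v w}.ncard = r + 1 := by
    intro v hv
    obtain ⟨x, t, rfl⟩ := exists_append4 v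
    obtain ⟨i, hi, -⟩ := hpart x
    rw [key x t i hi, if_neg]
    rintro rfl
    exact hv ((memC _ _).2 hi)
  refine ⟨?_, ?_, ?_, ?_⟩
  · have step : ∀ z ∈ C, z + Fin.append (0 : BW n) ![1,1,1] ∈ C := by
      intro z hz
      obtain ⟨x, t, rfl⟩ := exists_append4 z
      rw [addA, memC, cls4_add]
      exact (memC _ _).1 hz
    ext z
    constructor
    · rintro ⟨w, hw, rfl⟩
      exact step w hw
    · intro hz
      refine ⟨_, step z hz, ?_⟩
      have h2 : ∀ a b : ZMod 2, a + b + b = a := by decide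
      funext k
      exact h2 _ _
  · obtain ⟨x, hx⟩ := hne 0
    rw [Fin.forall_fin_two]
    refine ⟨⟨Fin.append x (bits3 0), ?_⟩, ⟨Fin.append x (bits3 1), ?_⟩⟩
    · exact (memC _ _).2 hx
    · intro h
      have h1 := uniq _ _ _ hx ((memC _ _).1 h)
      exact absurd h1 (by decide)
  · intro v
    by_cases hv : v ∈ C
    · refine ⟨0, hv, ?_⟩
      rw [Fin.forall_fin_two]
      exact ⟨fun _ => rfl, fun h => absurd hv h⟩
    · refine ⟨1, hv, ?_⟩
      rw [Fin.forall_fin_two]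
      exact ⟨fun h => absurd h hv, fun _ => rfl⟩
  · rw [Fin.forall_fin_two]
    constructor <;> rw [Fin.forall_fin_two] <;> refine ⟨fun v hv => ?_, fun v hv => ?_⟩
    · exact inC v hv
    · have h1 := inC v hv
      have h2 := tot v
      change {w | w ∈ Cᶜ ∧ hAdj v w}.ncard = 3 * (r + 1)
      omega
    · exact outC v hv
    · have h1 := outC v hv
      have h2 := tot v
      change {w | w ∈ Cᶜ ∧ hAdj v w}.ncard = 2 * (r + 1)
      omega
end

section
/- Let (C, C̄) be an equitable partition of Q_n with quotient matrix [[a,b],[c,d]] (so a + b = c + d = n). Then every nonzero vector of the affine dual C^⊥ has Hamming weight (b+c)/2. In particular, if the quotient matrix is [[0,3r],[r,2r]] with n = 3r, every nonzero vector of C^⊥ has weight 2r = 2n/3. -/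
/-- The (affine) dual of `C ⊆ F_2^n`: all `v` such that the standard inner product
`⟨c, v⟩` is constant as `c` ranges over `C`. -/
def affDual {n : ℕ} (C : Set (BW n)) : Set (BW n) :=
  {v | (∀ c ∈ C, ∑ i, c i * v i = 0) ∨ (∀ c ∈ C, ∑ i, c i * v i = 1)}

/-- Sign character of `ZMod 2`. -/
def sgnZ (t : ZMod 2) : ℤ := if t = 0 then 1 else -1

lemma sgnZ_add (s t : ZMod 2) : sgnZ (s + t) = sgnZ s * sgnZ t := by
  revert s t; decide

/-- The character of the cube attached to `v`. -/
def chiZ {n : ℕ} (v x : BW n) : ℤ := sgnZ (∑ i, x i * v i)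

lemma chiZ_flip {n : ℕ} (v x : BW n) (i : Fin n) :
    chiZ v (x + Pi.single i 1) = sgnZ (v i) * chiZ v x := by
  unfold chiZ
  rw [mul_comm, ← sgnZ_add]
  congr 1
  simp [add_mul, Finset.sum_add_distrib, Pi.single_apply]

lemma chiZ_sum {n : ℕ} (v : BW n) (hv : v ≠ 0) : ∑ x, chiZ v x = 0 := by
  obtain ⟨i, hi⟩ := Function.ne_iff.mp hv
  have h : ∑ x : BW n, chiZ v (x + Pi.single i 1) = ∑ x, chiZ v x :=
    Fintype.sum_equiv (Equiv.addRight (Pi.single i 1 : BW n)) _ _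
      (fun x => by rw [Equiv.coe_addRight])
  have hs : sgnZ (v i) = -1 := by
    have hi' : v i ≠ 0 := by simpa using hi
    simp [sgnZ, hi']
  have h2 : ∑ x : BW n, chiZ v (x + Pi.single i 1) = -1 * ∑ x, chiZ v x := by
    rw [Finset.mul_sum]
    exact Finset.sum_congr rfl fun x _ => by rw [chiZ_flip, hs]
  rw [h2] at h
  generalize (∑ x, chiZ v x) = z at h ⊢
  omega

lemma hAdj_iff {n : ℕ} (x w : BW n) :
    hAdj x w ↔ ∃ i, x + Pi.single i 1 = w := by
  have key : ∀ s t : ZMod 2, s ≠ t → s + 1 = t := by decide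
  unfold hAdj hammingDist
  rw [Finset.card_eq_one]
  constructor
  · rintro ⟨i, hi⟩
    refine ⟨i, funext fun j => ?_⟩
    have hj := Finset.ext_iff.mp hi j
    simp only [Finset.mem_filter, Finset.mem_univ, true_and, Finset.mem_singleton] at hj
    by_cases h : j = i
    · subst h
      simpa using key _ _ (hj.mpr rfl)
    · simp only [Pi.add_apply, Pi.single_apply, if_neg h, add_zero]
      by_contra h'
      exact h (hj.mp h')
  · rintro ⟨i, rfl⟩
    refine ⟨i, ?_⟩
    ext j
    by_cases h : j = i <;> simp [Pi.single_apply, h]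

open Classical in
lemma ncard_nbrs {n : ℕ} (C : Set (BW n)) (x : BW n) :
    (({w | w ∈ C ∧ hAdj x w}.ncard : ℕ) : ℤ) =
      ∑ i : Fin n, if x + Pi.single i 1 ∈ C then (1 : ℤ) else 0 := by
  have hE : {w | w ∈ C ∧ hAdj x w} =
      (fun i : Fin n => x + Pi.single i 1) '' {i | x + Pi.single i 1 ∈ C} := by
    ext w
    simp only [Set.mem_ofPred_eq, Set.mem_image, hAdj_iff]
    constructor
    · rintro ⟨h, i, rfl⟩
      exact ⟨i, h, rfl⟩
    · rintro ⟨i, h, rfl⟩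
      exact ⟨h, i, rfl⟩
  have hinj : Function.Injective (fun i : Fin n => x + (Pi.single i 1 : BW n)) := by
    intro i j h
    have h1 := congrFun (add_left_cancel h) i
    by_contra hne
    simp [Pi.single_apply, hne] at h1
  rw [hE, Set.ncard_image_of_injective _ hinj, Set.ncard_eq_toFinset_card']
  simp

lemma sum_sgnZ {n : ℕ} (v : BW n) : ∑ i, sgnZ (v i) = (n : ℤ) - 2 * hammingNorm v := by
  have h : ∀ i, sgnZ (v i) = 1 - 2 * (if v i ≠ 0 then (1 : ℤ) else 0) := by
    intro i
    unfold sgnZ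
    split_ifs <;> simp_all
  simp only [h, Finset.sum_sub_distrib, ← Finset.mul_sum, Finset.sum_boole, hammingNorm]
  simp

open Classical in
lemma weight_main (n a b c d : ℕ) (C : Set (BW n))
    (hC : IsEquitablePartition hAdj ![C, Cᶜ] ![![a, b], ![c, d]])
    (hab : a + b = n) (v : BW n) (hv : v ∈ affDual C) (hv0 : v ≠ 0) :
    2 * hammingNorm v = b + c := by
  obtain ⟨hne, -, hq⟩ := hC
  have hneC : C.Nonempty := hne 0
  have h00 : ∀ x ∈ C, {w | w ∈ C ∧ hAdj x w}.ncard = a := hq 0 0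
  have h10 : ∀ x ∈ Cᶜ, {w | w ∈ C ∧ hAdj x w}.ncard = c := hq 1 0
  let f : BW n → ℤ := fun x => if x ∈ C then 1 else 0
  have hf : ∀ x, ∑ i : Fin n, f (x + Pi.single i 1) = ((a : ℤ) - c) * f x + c := by
    intro x
    have := ncard_nbrs C x
    change _ = ∑ i : Fin n, f (x + Pi.single i 1) at this
    rw [← this]
    by_cases hx : x ∈ C
    · rw [h00 x hx]; simp [f, hx]
    · rw [h10 x hx]; simp [f, hx]
  have e1 : ∑ x, (∑ i : Fin n, f (x + Pi.single i 1)) * chiZ v x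
      = ((a : ℤ) - c) * ∑ x, f x * chiZ v x := by
    simp only [hf, add_mul, Finset.sum_add_distrib, ← Finset.mul_sum, chiZ_sum v hv0, mul_assoc]
    simp
  have hss : ∀ t : ZMod 2, sgnZ t * sgnZ t = 1 := by decide
  have e2 : ∑ x, (∑ i : Fin n, f (x + Pi.single i 1)) * chiZ v x
      = ((n : ℤ) - 2 * hammingNorm v) * ∑ x, f x * chiZ v x := by
    simp only [Finset.sum_mul]
    rw [Finset.sum_comm, ← sum_sgnZ, Finset.sum_mul]
    refine Finset.sum_congr rfl fun i _ => ?_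
    rw [← Equiv.sum_comp (Equiv.addRight (Pi.single i 1 : BW n)) (fun x => f x * chiZ v x),
      Finset.mul_sum]
    refine Finset.sum_congr rfl fun x _ => ?_
    simp only [Equiv.coe_addRight, chiZ_flip]
    linear_combination (-(f (x + Pi.single i 1) * chiZ v x)) * hss (v i)
  have hpos : 0 < ∑ x, f x := by
    obtain ⟨y, hy⟩ := hneC
    refine Finset.sum_pos' (fun x _ => ?_) ⟨y, Finset.mem_univ _, ?_⟩
    · simp only [f]; split_ifs <;> simp
    · simp [f, hy]
  have hF : ∑ x, f x * chiZ v x ≠ 0 := by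
    have hcst : ∃ e : ℤ, e ≠ 0 ∧ ∀ x ∈ C, chiZ v x = e := by
      rcases hv with h | h
      · exact ⟨1, by simp, fun x hx => by simp [chiZ, h x hx, sgnZ]⟩
      · exact ⟨-1, by simp, fun x hx => by simp [chiZ, h x hx, sgnZ]⟩
    obtain ⟨e, he, hce⟩ := hcst
    have : ∑ x, f x * chiZ v x = (∑ x, f x) * e := by
      rw [Finset.sum_mul]
      refine Finset.sum_congr rfl fun x _ => ?_
      by_cases hx : x ∈ C
      · rw [hce x hx]
      · simp [f, hx]
    rw [this]
    exact mul_ne_zero hpos.ne' he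
  have := mul_right_cancel₀ hF (e1.symm.trans e2)
  omega

theorem stmt_6 (n a b c d : ℕ) (C : Set (BW n))
    (hC : IsEquitablePartition hAdj ![C, Cᶜ] ![![a, b], ![c, d]])
    (hab : a + b = n) (hcd : c + d = n) :
    (∀ v ∈ affDual C, v ≠ 0 → 2 * hammingNorm v = b + c) ∧
    (∀ r : ℕ, n = 3*r → a = 0 → b = 3*r → c = r → d = 2*r →
      ∀ v ∈ affDual C, v ≠ 0 → hammingNorm v = 2*r) := by
  refine ⟨weight_main n a b c d C hC hab, ?_⟩
  intro r _ _ hb hc _ v hv hv0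
  have := weight_main n a b c d C hC hab v hv hv0
  omega
end
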